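/- Let S be a d-singular quasi-Hermitian variety in PG(r,q^2), and suppose either (r = 3, d = 0 and q = p^h > 4), or (r ≥ 4, d ≤ r-3 and q = p > 4), or (r ≥ 4, d ≤ r-3, q = p^2 and p > 3 is prime). Then S is a singular Hermitian variety with singular space of dimension d if and only if its characteristic vector v^S belongs to C_p, the F_p-code spanned by the characteristic vectors of the hyperplanes of PG(r,q^2). -/

import Mathlib

/-!
Common framework: `ProjPoint F n` is the set of points of the projective space
PG(n-1, |F|) (so PG(r, q²) corresponds to `n = r + 1` and `Fintype.card F = q ^ 2`).
Projective subspaces of projective dimension `k` are the submodules of `Fin n → F`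
of `finrank` equal to `k + 1`; lines have finrank 2, planes finrank 3 and
hyperplanes finrank `n - 1 = r`.
-/

open Module Matrix

/-- The points of the projective space PG(n-1, |F|): one-dimensional subspaces
of `F^n`. -/
def ProjPoint (F : Type) [Field F] (n : ℕ) : Type :=
  {W : Submodule F (Fin n → F) // finrank F W = 1}

/-- The set of projective points lying in a given subspace `W`. -/
def pointsIn (F : Type) [Field F] (n : ℕ) (W : Submodule F (Fin n → F)) :
    Set (ProjPoint F n) :=
  {P | P.1 ≤ W}

/-- The number of points of `V` lying in the subspace `W`. -/
noncomputable def secant (F : Type) [Field F] (n : ℕ) (V : Set (ProjPoint F n))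
    (W : Submodule F (Fin n → F)) : ℕ :=
  (V ∩ pointsIn F n W).ncard

/-- The characteristic vector of a set of projective points, with values in `F_p`. -/
noncomputable def charVec (F : Type) [Field F] (p n : ℕ) (S : Set (ProjPoint F n)) :
    ProjPoint F n → ZMod p :=
  Set.indicator S 1

/-- `C_p`: the `F_p`-code spanned by the characteristic vectors of hyperplanes. -/
def hypCode (F : Type) [Field F] (p n : ℕ) :
    Submodule (ZMod p) (ProjPoint F n → ZMod p) :=
  Submodule.span (ZMod p)
    {v | ∃ H : Submodule F (Fin n → F), finrank F H = n - 1 ∧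
      v = charVec F p n (pointsIn F n H)}

/-- A quasi-Hermitian variety of PG(r, q²): it has the size of a non-singular
Hermitian variety and the same two intersection numbers with hyperplanes.
(All identities are stated multiplied through by `q² - 1`.) -/
def IsQuasiHermitian (F : Type) [Field F] (q r : ℕ)
    (V : Set (ProjPoint F (r + 1))) : Prop :=
  (V.ncard : ℤ) * ((q : ℤ) ^ 2 - 1)
      = ((q : ℤ) ^ (r + 1) + (-1) ^ r) * ((q : ℤ) ^ r - (-1) ^ r) ∧
  ∀ H : Submodule F (Fin (r + 1) → F), finrank F H = r →
    ((secant F (r + 1) V H : ℤ) * ((q : ℤ) ^ 2 - 1)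
        = ((q : ℤ) ^ r + (-1) ^ (r - 1)) * ((q : ℤ) ^ (r - 1) - (-1) ^ (r - 1)) ∨
     (secant F (r + 1) V H : ℤ) * ((q : ℤ) ^ 2 - 1)
        = ((q : ℤ) ^ 2 - 1)
          + (q : ℤ) ^ 2 * (((q : ℤ) ^ (r - 1) + (-1) ^ r) * ((q : ℤ) ^ (r - 2) - (-1) ^ r)))

/-- The zero set, in PG(n-1,|F|), of the Hermitian form `x ↦ xᵀ A x^(q)`. -/
def hermSet (F : Type) [Field F] (q n : ℕ) (A : Matrix (Fin n) (Fin n) F) :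
    Set (ProjPoint F n) :=
  {P | ∀ x ∈ P.1, ∑ i, ∑ j, x i * A i j * (x j) ^ q = 0}

/-- A non-singular Hermitian variety of PG(n-1, q²). -/
def IsNonsingHermitian (F : Type) [Field F] (q n : ℕ)
    (V : Set (ProjPoint F n)) : Prop :=
  ∃ A : Matrix (Fin n) (Fin n) F, IsUnit A.det ∧
    Aᵀ = A.map (fun a => a ^ q) ∧ V = hermSet F q n A

/-- A singular Hermitian variety of PG(n-1, q²) whose singular space (the radical
of the Hermitian form) has projective dimension `d`. -/
def IsSingularHermitian (F : Type) [Field F] (q n d : ℕ)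
    (S : Set (ProjPoint F n)) : Prop :=
  ∃ A : Matrix (Fin n) (Fin n) F,
    Aᵀ = A.map (fun a => a ^ q) ∧
    finrank F (LinearMap.ker (Matrix.toLin' Aᵀ)) = d + 1 ∧
    S = hermSet F q n A

/-- A `d`-singular quasi-Hermitian variety of PG(r, q²). -/
def IsSingularQuasiHermitian (F : Type) [Field F] (q r d : ℕ)
    (S : Set (ProjPoint F (r + 1))) : Prop :=
  ∃ S₀ : Set (ProjPoint F (r + 1)), IsSingularHermitian F q (r + 1) d S₀ ∧
    S.ncard = S₀.ncard ∧
    ∀ H : Submodule F (Fin (r + 1) → F), finrank F H = r →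
      ∃ H₀ : Submodule F (Fin (r + 1) → F), finrank F H₀ = r ∧
        secant F (r + 1) S H = secant F (r + 1) S₀ H₀

/-- `U` is a classical unital (Hermitian curve) of the plane `π` of PG(n-1, q²):
in some coordinatization `e` of `π`, it is the zero set of a non-degenerate
Hermitian form on `F³`. -/
def IsClassicalUnital (F : Type) [Field F] (q n : ℕ)
    (π : Submodule F (Fin n → F)) (U : Set (ProjPoint F n)) : Prop :=
  ∃ e : (Fin 3 → F) →ₗ[F] (Fin n → F), LinearMap.ker e = ⊥ ∧ LinearMap.range e = π ∧
    ∃ A : Matrix (Fin 3) (Fin 3) F, IsUnit A.det ∧ Aᵀ = A.map (fun a => a ^ q) ∧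
      U = {P | ∃ y : Fin 3 → F, y ≠ 0 ∧ P.1 = Submodule.span F {e y} ∧
        ∑ i, ∑ j, y i * A i j * (y j) ^ q = 0}

open Module Matrix

section FieldFacts
open scoped Classical
open Finset

/-- Field data: `F` has order `q^2`, `q` a power of the prime `p`. -/
structure FD (F : Type) [Field F] [Fintype F] (p q : ℕ) : Prop where
  hp : p.Prime
  hq : ∃ h, q = p ^ h
  hF : Fintype.card F = q ^ 2

variable {F : Type} [Field F] [Fintype F] {p q : ℕ}

theorem FD.two_le (D : FD F p q) : 2 ≤ q := by
  have h1 : 1 < Fintype.card F := Fintype.one_lt_card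
  rw [D.hF] at h1
  by_contra hc
  have : q ≤ 1 := by omega
  have : q ^ 2 ≤ 1 := by nlinarith
  omega

theorem FD.p_dvd (D : FD F p q) : p ∣ q := by
  obtain ⟨h, hh⟩ := D.hq
  have := D.two_le
  rcases h with _ | h
  · simp at hh; omega
  · exact hh ▸ dvd_pow_self p (by omega)

theorem FD.charP (D : FD F p q) : CharP F p := by
  obtain ⟨h, hh⟩ := D.hq
  haveI := Fact.mk D.hp
  have hc : Fintype.card F = p ^ (h * 2) := by rw [D.hF, hh, pow_mul]
  exact charP_of_card_eq_prime_pow hc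

theorem FD.cast_q (D : FD F p q) : (q : F) = 0 := by
  haveI := D.charP
  exact (CharP.cast_eq_zero_iff F p q).2 D.p_dvd

theorem FD.add_pow (D : FD F p q) (x y : F) : (x + y) ^ q = x ^ q + y ^ q := by
  haveI := D.charP
  haveI := Fact.mk D.hp
  obtain ⟨h, hh⟩ := D.hq
  rw [hh]; exact add_pow_char_pow x y p h

theorem FD.q_ne (D : FD F p q) : q ≠ 0 := by have := D.two_le; omega

theorem FD.one_lt_Q (D : FD F p q) : 1 < q ^ 2 := by have := D.two_le; nlinarith

/-- Frobenius as a ring hom. -/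
def FD.frob (D : FD F p q) : F →+* F where
  toFun x := x ^ q
  map_one' := one_pow q
  map_mul' x y := mul_pow x y q
  map_zero' := zero_pow D.q_ne
  map_add' := D.add_pow

theorem FD.frob_apply (D : FD F p q) (x : F) : D.frob x = x ^ q := rfl

theorem FD.sum_pow (D : FD F p q) {ι : Type*} (s : Finset ι) (f : ι → F) :
    (∑ i ∈ s, f i) ^ q = ∑ i ∈ s, f i ^ q := by
  exact map_sum D.frob f s

theorem FD.neg_pow (D : FD F p q) (x : F) : (-x) ^ q = -x ^ q := by
  have := map_neg D.frob x
  simpa [FD.frob_apply] using this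

theorem FD.sub_pow (D : FD F p q) (x y : F) : (x - y) ^ q = x ^ q - y ^ q := by
  have := map_sub D.frob x y
  simpa [FD.frob_apply] using this

theorem FD.pow_Q (D : FD F p q) (x : F) : x ^ (q ^ 2) = x := by
  rw [← D.hF]; exact FiniteField.pow_card x

theorem FD.pow_pow (D : FD F p q) (x : F) : (x ^ q) ^ q = x := by
  rw [← pow_mul, ← pow_two]; exact D.pow_Q x

theorem FD.pow_Q_sub (D : FD F p q) {x : F} (hx : x ≠ 0) : x ^ (q ^ 2 - 1) = 1 := by
  rw [← D.hF]; exact FiniteField.pow_card_sub_one_eq_one x hx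

theorem FD.pow_Q_sub' (D : FD F p q) (x : F) : x ^ (q ^ 2 - 1) = if x = 0 then 0 else 1 := by
  split_ifs with h
  · rw [h, zero_pow]; have := D.one_lt_Q; omega
  · exact D.pow_Q_sub h

theorem FD.psum (D : FD F p q) {k : ℕ} (hk : k < q ^ 2 - 1) : ∑ t : F, t ^ k = 0 := by
  apply FiniteField.sum_pow_lt_card_sub_one
  rw [D.hF]; exact hk

theorem FD.psum_top (D : FD F p q) : ∑ t : F, t ^ (q ^ 2 - 1) = -1 := by
  simp_rw [D.pow_Q_sub']
  rw [Finset.sum_ite]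
  simp
  have : (univ.filter (fun x : F => ¬ x = 0)).card = q ^ 2 - 1 := by
    rw [← D.hF]
    have := Finset.filter_ne' (univ : Finset F) 0
    simp only [ne_eq] at this
    rw [this, Finset.card_erase_of_mem (mem_univ _), Finset.card_univ]
  rw [this, Nat.cast_sub D.one_lt_Q.le]
  simp [D.cast_q, D.q_ne]

/-- fibres of the norm -/
theorem FD.card_fixed (D : FD F p q) : (univ.filter (fun c : F => c ^ q = c)).card ≤ q := by
  have h2 := D.two_le
  let P : Polynomial F := Polynomial.X ^ q - Polynomial.X
  have hP : P ≠ 0 := FiniteField.X_pow_card_sub_X_ne_zero F (by omega)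
  have hd : P.natDegree = q := FiniteField.X_pow_card_sub_X_natDegree_eq F (by omega)
  calc (univ.filter (fun c : F => c ^ q = c)).card ≤ P.roots.toFinset.card := by
        apply Finset.card_le_card
        intro c hc
        simp at hc
        simp [hP, P, hc, Polynomial.IsRoot]
    _ ≤ Multiset.card P.roots := Multiset.toFinset_card_le _
    _ ≤ P.natDegree := Polynomial.card_roots' _
    _ = q := hd

theorem card_pow_eq_le {n : ℕ} (hn : 0 < n) (c : F) :
    (univ.filter (fun t : F => t ^ n = c)).card ≤ n := by
  calc (univ.filter (fun c' : F => c' ^ n = c)).card ≤ (Polynomial.nthRoots n c).toFinset.card := by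
        apply Finset.card_le_card
        intro t ht
        simp at ht
        simp [Polynomial.mem_nthRoots hn, ht]
    _ ≤ _ := Multiset.toFinset_card_le _
    _ ≤ n := Polynomial.card_nthRoots n c

theorem FD.norm_fixed (D : FD F p q) (t : F) : (t ^ (q + 1)) ^ q = t ^ (q + 1) := by
  rw [pow_succ, mul_pow, D.pow_pow, mul_comm]

theorem FD.norm_fibre (D : FD F p q) {c : F} (hc : c ≠ 0) (hcq : c ^ q = c) :
    (univ.filter (fun t : F => t ^ (q + 1) = c)).card = q + 1 := by
  have h2 := D.two_le
  set K := univ.filter (fun c : F => c ^ q = c ∧ c ≠ 0) with hK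
  have hKc : K.card ≤ q - 1 := by
    have h1 : insert 0 K ⊆ univ.filter (fun c : F => c ^ q = c) := by
      intro x hx
      simp [hK] at hx
      rcases hx with rfl | hx
      · simp [D.q_ne]
      · simp [hx.1]
    have h3 := (Finset.card_le_card h1).trans D.card_fixed
    rw [Finset.card_insert_of_notMem (by simp [hK])] at h3
    omega
  have htot : (univ.filter (fun t : F => t ≠ 0)).card = q ^ 2 - 1 := by
    rw [Finset.filter_ne', Finset.card_erase_of_mem (mem_univ _), Finset.card_univ, D.hF]
  have hsum : (univ.filter (fun t : F => t ≠ 0)).card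
      = ∑ c ∈ K, (univ.filter (fun t : F => t ^ (q + 1) = c)).card := by
    rw [Finset.card_eq_sum_card_fiberwise (f := fun t => t ^ (q + 1)) (t := K)]
    · apply Finset.sum_congr rfl
      intro c hc
      simp [hK] at hc
      congr 1
      ext t
      simp
      intro h
      rintro rfl
      simp at h
      exact hc.2 h.symm
    · intro t ht
      simp at ht
      simp [hK, ht]
      exact D.norm_fixed t
  have hle : ∀ c ∈ K, (univ.filter (fun t : F => t ^ (q + 1) = c)).card ≤ q + 1 :=
    fun c _ => card_pow_eq_le (by omega) c
  by_contra hne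
  have hlt : (univ.filter (fun t : F => t ^ (q + 1) = c)).card < q + 1 :=
    lt_of_le_of_ne (card_pow_eq_le (by omega) c) hne
  have : ∑ c ∈ K, (univ.filter (fun t : F => t ^ (q + 1) = c)).card < ∑ c ∈ K, (q + 1) :=
    Finset.sum_lt_sum hle ⟨c, by simp [hK, hc, hcq], hlt⟩
  rw [← hsum, htot, Finset.sum_const, smul_eq_mul] at this
  have h4 : K.card * (q + 1) ≤ (q - 1) * (q + 1) := Nat.mul_le_mul_right _ hKc
  have h5 : (q - 1) * (q + 1) = q ^ 2 - 1 := by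
    obtain ⟨s, rfl⟩ : ∃ s, q = s + 1 := ⟨q - 1, by omega⟩
    simp only [Nat.add_sub_cancel]
    have : (s + 1) ^ 2 = s * (s + 1 + 1) + 1 := by ring
    omega
  omega

theorem sum_poly_zero {f : F → F} {K : ℕ} (hm : ∀ k < K, ∑ t, t ^ k * f t = 0)
    (P : Polynomial F) (hP : P.natDegree < K) : ∑ t, P.eval t * f t = 0 := by
  simp_rw [Polynomial.eval_eq_sum_range, Finset.sum_mul]
  rw [Finset.sum_comm]
  apply Finset.sum_eq_zero
  intro k hk
  simp at hk
  have := hm k (by omega)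
  calc _ = P.coeff k * ∑ t, t ^ k * f t := by rw [Finset.mul_sum]; simp [mul_assoc]
    _ = 0 := by rw [this, mul_zero]

/-- Vandermonde tool. -/
theorem vandermonde_zero {f : F → F} {K : ℕ} (hs : (univ.filter (fun t => f t ≠ 0)).card ≤ K)
    (hm : ∀ k < K, ∑ t, t ^ k * f t = 0) : ∀ t, f t = 0 := by
  by_contra hne
  push Not at hne
  obtain ⟨t0, ht0⟩ := hne
  set s := univ.filter (fun t => f t ≠ 0) with hsdef
  have hmem : t0 ∈ s := by simp [hsdef, ht0]
  let P : Polynomial F := ∏ a ∈ s.erase t0, (Polynomial.X - Polynomial.C a)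
  have hd : P.natDegree < K := by
    have : P.natDegree = (s.erase t0).card := by
      simp only [P]
      rw [Polynomial.natDegree_prod_of_monic _ _ (fun a _ => Polynomial.monic_X_sub_C a)]
      simp
    rw [this, Finset.card_erase_of_mem hmem]
    have := Finset.card_pos.2 ⟨t0, hmem⟩
    omega
  have h0 := sum_poly_zero hm P hd
  rw [Finset.sum_eq_single t0] at h0
  · have hP0 : P.eval t0 ≠ 0 := by
      simp only [P, Polynomial.eval_prod]
      apply Finset.prod_ne_zero_iff.2
      intro a ha
      simp at ha
      simp [sub_ne_zero]
      exact fun h => ha.1 h.symm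
    exact (mul_ne_zero hP0 ht0) h0
  · intro b _ hb
    by_cases hfb : f b = 0
    · simp [hfb]
    · have : P.eval b = 0 := by
        simp only [P, Polynomial.eval_prod]
        apply Finset.prod_eq_zero (i := b)
        · simp [hb, hsdef, hfb]
        · simp
      simp [this]
  · simp

end FieldFacts

open Module Matrix

section HermCount
open scoped Classical
open Finset

variable {F : Type} [Field F] [Fintype F] {p q : ℕ}
variable {V : Type} [AddCommGroup V] [Module F V] [Fintype V]

/-- Hermitian sesquilinear forms, as bare functions. -/
structure IsHerm (F : Type) [Field F] {V : Type} [AddCommGroup V] [Module F V] (q : ℕ)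
    (H : V → V → F) : Prop where
  add : ∀ x y z, H (x + y) z = H x z + H y z
  smul : ∀ (c : F) x z, H (c • x) z = c * H x z
  symm : ∀ x y, H y x = (H x y) ^ q

theorem IsHerm.add_right (D : FD F p q) {H : V → V → F} (h : IsHerm F q H) (x y z : V) :
    H x (y + z) = H x y + H x z := by
  rw [h.symm (y + z) x, h.add, D.add_pow, ← h.symm, ← h.symm]

theorem IsHerm.smul_right {H : V → V → F} (h : IsHerm F q H) (c : F) (x y : V) :
    H x (c • y) = c ^ q * H x y := by
  rw [h.symm (c • y) x, h.smul, mul_pow, ← h.symm]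

theorem IsHerm.zero_left {H : V → V → F} (h : IsHerm F q H) (y : V) : H 0 y = 0 := by
  have := h.smul 0 0 y; simpa using this

theorem IsHerm.zero_right (D : FD F p q) {H : V → V → F} (h : IsHerm F q H) (y : V) :
    H y 0 = 0 := by
  rw [h.symm 0 y, h.zero_left, zero_pow D.q_ne]

/-- The kernel of `H · v` inside `U`. -/
def IsHerm.perpIn {H : V → V → F} (h : IsHerm F q H) (U : Submodule F V) (v : V) :
    Submodule F V where
  carrier := {x | x ∈ U ∧ H x v = 0}
  add_mem' := by
    rintro x y ⟨hx, hx'⟩ ⟨hy, hy'⟩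
    exact ⟨U.add_mem hx hy, by rw [h.add, hx', hy', add_zero]⟩
  zero_mem' := ⟨U.zero_mem, h.zero_left v⟩
  smul_mem' := by
    rintro c x ⟨hx, hx'⟩
    exact ⟨U.smul_mem c hx, by rw [h.smul, hx', mul_zero]⟩

/-- radical of the restriction of the form to `U`. -/
def IsHerm.rad {H : V → V → F} (h : IsHerm F q H) (U : Submodule F V) :
    Submodule F V where
  carrier := {x | x ∈ U ∧ ∀ y ∈ U, H x y = 0}
  add_mem' := by
    rintro x y ⟨hx, hx'⟩ ⟨hy, hy'⟩
    exact ⟨U.add_mem hx hy, fun z hz => by rw [h.add, hx' z hz, hy' z hz, add_zero]⟩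
  zero_mem' := ⟨U.zero_mem, fun z _ => h.zero_left z⟩
  smul_mem' := by
    rintro c x ⟨hx, hx'⟩
    exact ⟨U.smul_mem c hx, fun z hz => by rw [h.smul, hx' z hz, mul_zero]⟩

theorem FD.card_sub (D : FD F p q) (U : Submodule F V) :
    (univ.filter (fun x : V => x ∈ U)).card = q ^ (2 * finrank F U) := by
  have h1 : Fintype.card U = q ^ (2 * finrank F U) := by
    rw [Module.card_eq_pow_finrank (K := F), D.hF, pow_mul]
  rw [← h1, Fintype.card_subtype]

theorem FD.exists_trace_ne (D : FD F p q) (b : F) (hb : b ≠ 0) :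
    ∃ t : F, t * b + t ^ q * b ^ q ≠ 0 := by
  by_contra hc
  push Not at hc
  have h1 : ∀ s : F, s ^ q = -s := by
    intro s
    have := hc (s / b)
    rw [← mul_pow, div_mul_cancel₀ _ hb] at this
    linear_combination this
  have h2 : (1 : F) = -1 := by have := h1 1; simpa using this
  have h3 : ∀ s : F, s ^ q = s := by
    intro s; rw [h1 s, neg_eq_neg_one_mul, ← h2, one_mul]
  have h4 := D.card_fixed
  rw [Finset.filter_true_of_mem (fun x _ => h3 x), Finset.card_univ, D.hF] at h4
  have := D.two_le
  nlinarith

/-- splitting off a vector. -/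
theorem card_filter_split {U U' : Submodule F V} {v : V} (hv : v ∈ U) (hU' : U' ≤ U)
    (hunique : ∀ c : F, c • v ∈ U' → c = 0)
    (hex : ∀ x ∈ U, ∃ c : F, x - c • v ∈ U') (P : V → Prop) :
    (univ.filter (fun x : V => x ∈ U ∧ P x)).card
      = ∑ x ∈ univ.filter (fun x : V => x ∈ U'), (univ.filter (fun t : F => P (x + t • v))).card := by
  rw [← Finset.card_sigma]
  symm
  apply Finset.card_bij (fun (a : Σ _ : V, F) _ => a.1 + a.2 • v)
  · rintro ⟨x, t⟩ ha
    simp at ha ⊢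
    exact ⟨U.add_mem (hU' ha.1) (U.smul_mem t hv), ha.2⟩
  · rintro ⟨x, t⟩ ha ⟨y, s⟩ hb hab
    simp at ha hb hab
    have h1 : (t - s) • v = y - x := by
      rw [sub_smul]
      have : t • v = y + s • v - x := by rw [← hab]; abel
      rw [this]; abel
    have h2 : t - s = 0 := hunique _ (by rw [h1]; exact U'.sub_mem hb.1 ha.1)
    have h3 : t = s := sub_eq_zero.1 h2
    subst h3
    simp at h1
    have h4 : x = y := (sub_eq_zero.1 h1.symm).symm
    subst h4
    rfl
  · intro x hx
    simp at hx
    obtain ⟨c, hc⟩ := hex x hx.1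
    exact ⟨⟨x - c • v, c⟩, by simp [hc, hx.2], by simp⟩

theorem IsHerm.count (D : FD F p q) {H : V → V → F} (h : IsHerm F q H) :
    ∀ (n : ℕ) (U : Submodule F V), finrank F U = n →
    (q : ℤ) * (univ.filter (fun x : V => x ∈ U ∧ H x x = 0)).card
      = (q : ℤ) ^ (2 * n) + (-1) ^ (n + finrank F (h.rad U)) * ((q : ℤ) - 1)
        * (q : ℤ) ^ (n + finrank F (h.rad U)) := by
  intro n
  induction n with
  | zero =>
    intro U hU
    have hU0 : U = ⊥ := Submodule.finrank_eq_zero.1 hU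
    have hr : finrank F (h.rad U) = 0 := by
      have : h.rad U ≤ U := fun x hx => hx.1
      have := Submodule.finrank_mono this
      omega
    have hc : univ.filter (fun x : V => x ∈ U ∧ H x x = 0) = {0} := by
      ext x
      simp [hU0]
      rintro rfl
      exact h.zero_left 0
    rw [hr, hc]; simp
  | succ n ih =>
    intro U hU
    by_cases hz : ∀ x ∈ U, H x x = 0
    · have hH : ∀ x ∈ U, ∀ y ∈ U, H x y = 0 := by
        intro x hx y hy
        by_contra hb
        obtain ⟨t, ht⟩ := D.exists_trace_ne _ hb
        apply ht
        have h1 := hz (t • x + y) (U.add_mem (U.smul_mem t hx) hy)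
        rw [h.add, h.add_right D, h.add_right D, hz _ (U.smul_mem t hx), hz y hy, h.smul,
          h.smul_right, h.symm x y] at h1
        linear_combination h1
      have hr : h.rad U = U := by
        apply le_antisymm
        · exact fun x hx => hx.1
        · exact fun x hx => ⟨hx, fun y hy => hH x hx y hy⟩
      have hc : univ.filter (fun x : V => x ∈ U ∧ H x x = 0) = univ.filter (fun x : V => x ∈ U) := by
        ext x
        simp
        exact hz x
      rw [hr, hc, D.card_sub, hU]
      have : (-1 : ℤ) ^ (n + 1 + (n + 1)) = 1 := by
        rw [← two_mul, pow_mul]; simp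
      rw [this, ← two_mul]; push_cast; ring
    · push Not at hz
      obtain ⟨v, hv, hvv⟩ := hz
      set U' := h.perpIn U v with hU'
      have hle : U' ≤ U := fun x hx => hx.1
      have huni : ∀ c : F, c • v ∈ U' → c = 0 := by
        intro c hc
        have := hc.2
        rw [h.smul] at this
        exact (mul_eq_zero.1 this).resolve_right hvv
      have hex : ∀ x ∈ U, ∃ c : F, x - c • v ∈ U' := by
        intro x hx
        refine ⟨H x v / H v v, U.sub_mem hx (U.smul_mem _ hv), ?_⟩
        rw [sub_eq_add_neg, ← neg_smul, h.add, h.smul, neg_mul, div_mul_cancel₀ _ hvv, add_neg_cancel]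
      have hsplit := card_filter_split hv hle huni hex (P := fun x => H x x = 0)
      have hcU := card_filter_split hv hle huni hex (P := fun x => True)
      have hq2 := D.two_le
      have hfr : finrank F U' = n := by
        simp only [and_true, Finset.filter_true, Finset.card_univ, D.hF, Finset.sum_const, D.card_sub, hU,
          smul_eq_mul] at hcU
        rw [← pow_add] at hcU
        have := Nat.pow_right_injective hq2 hcU
        omega
      have hrad : h.rad U' = h.rad U := by
        apply le_antisymm
        · rintro x ⟨hx, hx'⟩
          refine ⟨hx.1, fun y hy => ?_⟩
          obtain ⟨c, hc⟩ := hex y hy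
          have : y = (y - c • v) + c • v := by abel
          rw [this, h.add_right D, hx' _ hc, h.smul_right, hx.2]; ring
        · rintro x ⟨hx, hx'⟩
          exact ⟨⟨hx, hx' v hv⟩, fun y hy => hx' y hy.1⟩
      have ihU := ih U' hfr
      rw [hrad] at ihU
      have hfib : ∀ x ∈ univ.filter (fun x : V => x ∈ U'),
          (univ.filter (fun t : F => H (x + t • v) (x + t • v) = 0)).card
            = if H x x = 0 then 1 else q + 1 := by
        intro x hx
        simp at hx
        have hxv : H x v = 0 := hx.2
        have hvx : H v x = 0 := by rw [h.symm x v, hxv, zero_pow D.q_ne]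
        have hexp : ∀ t : F, H (x + t • v) (x + t • v) = H x x + t ^ (q + 1) * H v v := by
          intro t
          rw [h.add, h.add_right D, h.add_right D, h.smul, h.smul, h.smul_right, h.smul_right, hxv, hvx]
          ring
        simp_rw [hexp]
        split_ifs with h0
        · rw [Finset.card_eq_one]
          refine ⟨0, ?_⟩
          ext t
          simp [h0, hvv]
        · have h1 : univ.filter (fun t : F => H x x + t ^ (q + 1) * H v v = 0)
              = univ.filter (fun t : F => t ^ (q + 1) = -H x x / H v v) := by
            ext t
            simp only [mem_filter, mem_univ, true_and]
            rw [eq_div_iff hvv, eq_neg_iff_add_eq_zero, add_comm]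
          rw [h1]
          apply D.norm_fibre
          · exact div_ne_zero (neg_ne_zero.2 h0) hvv
          · rw [div_pow, D.neg_pow, ← h.symm, ← h.symm]
      rw [Finset.sum_congr rfl hfib, Finset.sum_ite, Finset.filter_filter, Finset.filter_filter] at hsplit
      have hcomp : (univ.filter (fun x : V => x ∈ U' ∧ H x x = 0)).card
          + (univ.filter (fun x : V => x ∈ U' ∧ ¬ H x x = 0)).card = q ^ (2 * n) := by
        rw [← hfr, ← D.card_sub U', ← Finset.filter_filter, ← Finset.filter_filter]
        exact Finset.card_filter_add_card_filter_not _
      simp only [Finset.sum_const, smul_eq_mul, mul_one] at hsplit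
      rw [hsplit]
      push_cast
      have hcomp' : ((univ.filter (fun x : V => x ∈ U' ∧ ¬ H x x = 0)).card : ℤ)
          = (q : ℤ) ^ (2 * n) - (univ.filter (fun x : V => x ∈ U' ∧ H x x = 0)).card := by
        rw [eq_sub_iff_add_eq, add_comm]; exact_mod_cast hcomp
      rw [hcomp']
      set N := ((univ.filter (fun x : V => x ∈ U' ∧ H x x = 0)).card : ℤ)
      have e1 : (-1 : ℤ) ^ (n + 1 + finrank F (h.rad U)) = - (-1) ^ (n + finrank F (h.rad U)) := by
        rw [show n + 1 + finrank F (h.rad U) = (n + finrank F (h.rad U)) + 1 by ring, pow_succ]; ring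
      have e2 : (q : ℤ) ^ (n + 1 + finrank F (h.rad U)) = q * (q : ℤ) ^ (n + finrank F (h.rad U)) := by
        rw [show n + 1 + finrank F (h.rad U) = (n + finrank F (h.rad U)) + 1 by ring, pow_succ]; ring
      rw [e1, e2]
      rw [show 2 * (n + 1) = 2 * n + 2 by ring, pow_add]
      linear_combination (-(q : ℤ)) * ihU

end HermCount

open Module Matrix

section FourierPart
open scoped Classical
open Finset

variable {F : Type} [Field F] [Fintype F] {p q : ℕ}

/-- Cones: sets of vectors containing zero and closed under scalars. -/
structure IsCone (F : Type) [Field F] {V : Type} [AddCommGroup V] [Module F V]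
    (X : Finset V) : Prop where
  zero : (0 : V) ∈ X
  smul : ∀ (c : F) x, x ∈ X → c • x ∈ X

theorem IsCone.smul_iff {V : Type} [AddCommGroup V] [Module F V] {X : Finset V} (hX : IsCone F X)
    {c : F} (hc : c ≠ 0) (x : V) : c • x ∈ X ↔ x ∈ X := by
  constructor
  · intro h
    have := hX.smul c⁻¹ _ h
    rwa [smul_smul, inv_mul_cancel₀ hc, one_smul] at this
  · exact hX.smul c x

theorem IsCone.neg_iff {V : Type} [AddCommGroup V] [Module F V] {X : Finset V} (hX : IsCone F X)
    (x : V) : -x ∈ X ↔ x ∈ X := by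
  have := hX.smul_iff (c := (-1 : F)) (by simp) x
  simpa using this

theorem sum_char_dot {n : ℕ} {ψ : AddChar F ℂ} (hψ : ψ.IsPrimitive) (x : Fin n → F) :
    ∑ a : Fin n → F, ψ (a ⬝ᵥ x) = if x = 0 then (Fintype.card (Fin n → F) : ℂ) else 0 := by
  have h1 : ∀ a : Fin n → F, ψ (a ⬝ᵥ x) = ∏ i, ψ (a i * x i) := by
    intro a
    simp only [dotProduct]
    have gen : ∀ (s : Finset (Fin n)) (f : Fin n → F), ψ (∑ i ∈ s, f i) = ∏ i ∈ s, ψ (f i) := by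
      intro s f
      induction s using Finset.induction_on with
      | empty => simp
      | insert i s hi ih => rw [Finset.sum_insert hi, Finset.prod_insert hi, AddChar.map_add_eq_mul, ih]
    exact gen _ _
  simp_rw [h1]
  have h2 := Finset.prod_univ_sum (fun _ : Fin n => (univ : Finset F)) (fun i t => ψ (t * x i))
  rw [Fintype.piFinset_univ] at h2
  rw [← h2]
  have h3 : ∀ i, ∑ t : F, ψ (t * x i) = if x i = 0 then (Fintype.card F : ℂ) else 0 :=
    fun i => by simpa using AddChar.sum_mulShift (x i) hψ
  simp_rw [h3]
  split_ifs with h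
  · simp [h]
  · have : ∃ i, x i ≠ 0 := by
      by_contra hc; push Not at hc; exact h (funext hc)
    obtain ⟨i, hi⟩ := this
    exact Finset.prod_eq_zero (mem_univ i) (by simp [hi])

variable {n : ℕ}

theorem fourier_E (D : FD F p q) {ψ : AddChar F ℂ} (hψ : ψ.IsPrimitive) {X : Finset (Fin n → F)}
    (hX : IsCone F X) (a : Fin n → F) :
    ((q : ℂ) ^ 2 - 1) * ∑ x ∈ X, ψ (a ⬝ᵥ x)
      = (q : ℂ) ^ 2 * (X.filter (fun x => a ⬝ᵥ x = 0)).card - X.card := by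
  have h1 : ∀ c ∈ (univ : Finset F).erase 0, ∑ x ∈ X, ψ (c * (a ⬝ᵥ x)) = ∑ x ∈ X, ψ (a ⬝ᵥ x) := by
    intro c hc
    have hc0 : c ≠ 0 := by simpa using hc
    apply Finset.sum_bij (fun x _ => c • x)
    · exact fun x hx => hX.smul c x hx
    · intro x _ y _ h
      exact smul_right_injective _ hc0 h
    · intro y hy
      exact ⟨c⁻¹ • y, hX.smul _ _ hy, by rw [smul_smul, mul_inv_cancel₀ hc0, one_smul]⟩
    · intro x _
      rw [dotProduct_smul, smul_eq_mul]
  have h2 : ∑ c ∈ (univ : Finset F).erase 0, ∑ x ∈ X, ψ (c * (a ⬝ᵥ x))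
      = ((q : ℂ) ^ 2 - 1) * ∑ x ∈ X, ψ (a ⬝ᵥ x) := by
    rw [Finset.sum_congr rfl h1, Finset.sum_const, Finset.card_erase_of_mem (mem_univ _),
      Finset.card_univ, D.hF, nsmul_eq_mul, Nat.cast_sub D.one_lt_Q.le]
    simp
  rw [← h2, Finset.sum_comm]
  have h3 : ∀ x ∈ X, ∑ c ∈ (univ : Finset F).erase 0, ψ (c * (a ⬝ᵥ x))
      = (if a ⬝ᵥ x = 0 then (q : ℂ) ^ 2 else 0) - 1 := by
    intro x _
    have := AddChar.sum_mulShift (a ⬝ᵥ x) hψ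
    rw [← Finset.add_sum_erase _ _ (mem_univ 0), D.hF] at this
    rw [zero_mul, AddChar.map_zero_eq_one] at this
    push_cast at this
    linear_combination this
  rw [Finset.sum_congr rfl h3, Finset.sum_sub_distrib, ← Finset.sum_filter]
  simp
  ring

theorem fourier_1 {ψ : AddChar F ℂ} (hψ : ψ.IsPrimitive) {X : Finset (Fin n → F)}
    (hX : IsCone F X) :
    ∑ a : Fin n → F, ∑ x ∈ X, ψ (a ⬝ᵥ x) = Fintype.card (Fin n → F) := by
  rw [Finset.sum_comm]
  simp_rw [sum_char_dot hψ]
  rw [Finset.sum_ite_eq' X]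
  simp [hX.zero]

theorem fourier_2 {ψ : AddChar F ℂ} (hψ : ψ.IsPrimitive) {X : Finset (Fin n → F)}
    (hX : IsCone F X) :
    ∑ a : Fin n → F, (∑ x ∈ X, ψ (a ⬝ᵥ x)) ^ 2 = Fintype.card (Fin n → F) * (X.card : ℂ) := by
  have h1 : ∀ a : Fin n → F, (∑ x ∈ X, ψ (a ⬝ᵥ x)) ^ 2 = ∑ x ∈ X, ∑ y ∈ X, ψ (a ⬝ᵥ (x + y)) := by
    intro a
    rw [pow_two, Finset.sum_mul_sum]
    simp_rw [dotProduct_add, AddChar.map_add_eq_mul]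
  simp_rw [h1]
  rw [Finset.sum_comm]
  have h2 : ∀ x ∈ X, ∑ a : Fin n → F, ∑ y ∈ X, ψ (a ⬝ᵥ (x + y)) = (Fintype.card (Fin n → F) : ℂ) := by
    intro x hx
    rw [Finset.sum_comm]
    simp_rw [sum_char_dot hψ]
    have : ∀ y, (if x + y = 0 then (Fintype.card (Fin n → F) : ℂ) else 0)
        = if y = -x then (Fintype.card (Fin n → F) : ℂ) else 0 := by
      intro y; congr 1; rw [eq_neg_iff_add_eq_zero, add_comm]
    simp_rw [this]
    rw [Finset.sum_ite_eq' X, if_pos ((hX.neg_iff x).2 hx)]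
  rw [Finset.sum_congr rfl h2]
  simp [mul_comm]

/-- Number of pairs in `X` with sum in `X`. -/
noncomputable def Tcount {V : Type} [AddCommGroup V] (X : Finset V) : ℕ :=
  ∑ x ∈ X, (X.filter (fun y => x + y ∈ X)).card

theorem fourier_3 {ψ : AddChar F ℂ} (hψ : ψ.IsPrimitive) {X : Finset (Fin n → F)}
    (hX : IsCone F X) :
    ∑ a : Fin n → F, (∑ x ∈ X, ψ (a ⬝ᵥ x)) ^ 3 = Fintype.card (Fin n → F) * (Tcount X : ℂ) := by
  have h1 : ∀ a : Fin n → F, (∑ x ∈ X, ψ (a ⬝ᵥ x)) ^ 3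
      = ∑ x ∈ X, ∑ y ∈ X, ∑ z ∈ X, ψ (a ⬝ᵥ (x + y + z)) := by
    intro a
    rw [pow_succ, pow_two, Finset.sum_mul_sum, Finset.sum_mul]
    apply Finset.sum_congr rfl; intro x _
    rw [Finset.sum_mul_sum]
    simp_rw [dotProduct_add, AddChar.map_add_eq_mul]
  simp_rw [h1]
  rw [Finset.sum_comm]
  unfold Tcount
  push_cast
  rw [Finset.mul_sum]
  apply Finset.sum_congr rfl; intro x _
  rw [Finset.sum_comm, Finset.card_filter, Nat.cast_sum, Finset.mul_sum]
  apply Finset.sum_congr rfl; intro y _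
  rw [Finset.sum_comm]
  simp_rw [sum_char_dot hψ]
  have : ∀ z, (if x + y + z = 0 then (Fintype.card (Fin n → F) : ℂ) else 0)
      = if z = -(x + y) then (Fintype.card (Fin n → F) : ℂ) else 0 := by
    intro z; congr 1; rw [eq_neg_iff_add_eq_zero, add_comm]
  simp_rw [this]
  rw [Finset.sum_ite_eq' X]
  simp only [hX.neg_iff]
  split_ifs <;> simp

/-- Equal sizes and hyperplane sections in a common three-element list give the same `Tcount`. -/
theorem Tcount_eq (D : FD F p q) {X Y : Finset (Fin n → F)} (hX : IsCone F X) (hY : IsCone F Y)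
    (hc : X.card = Y.card) (b : Fin 3 → ℕ)
    (hbX : ∀ a : Fin n → F, a ≠ 0 → ∃ i, (X.filter (fun x => a ⬝ᵥ x = 0)).card = b i)
    (hbY : ∀ a : Fin n → F, a ≠ 0 → ∃ i, (Y.filter (fun x => a ⬝ᵥ x = 0)).card = b i) :
    Tcount X = Tcount Y := by
  obtain ⟨ψ, hψ⟩ : ∃ ψ : AddChar F ℂ, ψ.IsPrimitive :=
    ⟨_, AddChar.FiniteField.primitiveChar_to_Complex_isPrimitive F⟩
  have hQ : ((q : ℂ) ^ 2 - 1) ≠ 0 := by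
    have := D.one_lt_Q
    intro h
    have h' : ((q ^ 2 : ℕ) : ℂ) = (1 : ℕ) := by push_cast; linear_combination h
    have := Nat.cast_injective h'
    omega
  let e : Fin 3 → ℂ := fun i => ((q : ℂ) ^ 2 * b i - X.card) / ((q : ℂ) ^ 2 - 1)
  have key : ∀ Z : Finset (Fin n → F), IsCone F Z → Z.card = X.card →
      (∀ a : Fin n → F, a ≠ 0 → ∃ i, (Z.filter (fun x => a ⬝ᵥ x = 0)).card = b i) →
      (Fintype.card (Fin n → F) : ℂ) * (Tcount Z : ℂ)
        - (e 0 + e 1 + e 2) * (Fintype.card (Fin n → F) * (X.card : ℂ))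
        + (e 0 * e 1 + e 0 * e 2 + e 1 * e 2) * Fintype.card (Fin n → F)
        - e 0 * e 1 * e 2 * Fintype.card (Fin n → F)
        = ((X.card : ℂ) - e 0) * (X.card - e 1) * (X.card - e 2) := by
    intro Z hZ hcZ hbZ
    rw [← hcZ, ← fourier_2 hψ hZ, ← fourier_3 hψ hZ]
    have h0 : ∑ a : Fin n → F, ((∑ x ∈ Z, ψ (a ⬝ᵥ x)) - e 0) * ((∑ x ∈ Z, ψ (a ⬝ᵥ x)) - e 1)
        * ((∑ x ∈ Z, ψ (a ⬝ᵥ x)) - e 2)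
        = ((Z.card : ℂ) - e 0) * (Z.card - e 1) * (Z.card - e 2) := by
      rw [Finset.sum_eq_single 0]
      · simp
      · intro a _ ha
        obtain ⟨i, hi⟩ := hbZ a ha
        have hE : ∑ x ∈ Z, ψ (a ⬝ᵥ x) = e i := by
          have := fourier_E D hψ hZ a
          simp only [e]
          rw [eq_div_iff hQ, ← hi, ← hcZ, ← this]; ring
        rw [hE]
        fin_cases i <;> simp
      · simp
    rw [← h0]
    have h1 := fourier_1 hψ hZ
    have h4 : ∑ a : Fin n → F, (1 : ℂ) = Fintype.card (Fin n → F) := by simp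
    have h5 : (e 0 * e 1 + e 0 * e 2 + e 1 * e 2) * (Fintype.card (Fin n → F) : ℂ)
      = (e 0 * e 1 + e 0 * e 2 + e 1 * e 2) * ∑ a : Fin n → F, ∑ x ∈ Z, ψ (a ⬝ᵥ x) := by rw [h1]
    rw [h5, ← h4]
    simp only [Finset.mul_sum (s := (univ : Finset (Fin n → F)))]
    rw [← Finset.sum_sub_distrib, ← Finset.sum_add_distrib, ← Finset.sum_sub_distrib]
    apply Finset.sum_congr rfl
    intro a _
    ring
  have k1 := key X hX rfl hbX
  have k2 := key Y hY hc.symm hbY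
  have hV : (Fintype.card (Fin n → F) : ℂ) ≠ 0 := by
    exact_mod_cast Fintype.card_ne_zero
  have : (Tcount X : ℂ) = Tcount Y := by
    apply mul_left_cancel₀ hV
    linear_combination k1 - k2
  exact_mod_cast this

end FourierPart

open Module Matrix

section ZPart
open scoped Classical
open Finset

variable {F : Type} [Field F] [Fintype F] {p q : ℕ}
variable {V : Type} [AddCommGroup V] [Module F V] [Fintype V]

/-- number of `t` with `x + t v ∈ X`. -/
noncomputable def nv (F : Type) [Field F] [Fintype F] {V : Type} [AddCommGroup V] [Module F V]
    (X : Finset V) (v x : V) : ℕ :=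
  (univ.filter (fun t : F => x + t • v ∈ X)).card

theorem nv_shift (X : Finset V) (v x : V) (c : F) : nv F X v (x + c • v) = nv F X v x := by
  unfold nv
  apply Finset.card_bij (fun t _ => c + t)
  · intro t ht
    simp at ht ⊢
    rwa [add_smul, ← add_assoc]
  · intro a _ b _ h
    simpa using h
  · intro t ht
    simp at ht
    refine ⟨t - c, ?_, by ring⟩
    simp
    rw [add_assoc, ← add_smul]
    simpa using ht

theorem card_shift (X : Finset V) (w : V) : (univ.filter (fun x : V => x + w ∈ X)).card = X.card := by
  apply Finset.card_bij (fun x _ => x + w)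
  · intro x hx; simpa using hx
  · intro a _ b _ h; simpa using h
  · intro y hy
    exact ⟨y - w, by simpa using hy, by simp⟩

theorem sum_nv (D : FD F p q) (X : Finset V) (v : V) :
    ∑ x : V, nv F X v x = q ^ 2 * X.card := by
  unfold nv
  simp_rw [Finset.card_filter]
  rw [Finset.sum_comm]
  simp_rw [← Finset.card_filter, card_shift]
  simp [D.hF]

theorem sum_nv_sq (D : FD F p q) (X : Finset V) (v : V) :
    ∑ x : V, nv F X v x ^ 2 = q ^ 2 * ∑ y ∈ X, nv F X v y := by
  have h1 : ∀ x, nv F X v x ^ 2 = ∑ t : F, if x + t • v ∈ X then nv F X v (x + t • v) else 0 := by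
    intro x
    simp_rw [nv_shift]
    rw [← Finset.sum_filter, Finset.sum_const, smul_eq_mul, pow_two]
    rfl
  simp_rw [h1]
  rw [Finset.sum_comm]
  have h2 : ∀ t : F, ∑ x : V, (if x + t • v ∈ X then nv F X v (x + t • v) else 0)
      = ∑ y ∈ X, nv F X v y := by
    intro t
    rw [← Finset.sum_filter]
    apply Finset.sum_bij (fun x _ => x + t • v)
    · intro x hx; simpa using hx
    · intro a _ b _ h; simpa using h
    · intro y hy
      exact ⟨y - t • v, by simpa using hy, by simp⟩
    · intro x _; rfl
  simp_rw [h2]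
  simp [D.hF]

theorem sum_nv_X (D : FD F p q) {X : Finset V} (hX : IsCone F X) (v : V) :
    ∑ y ∈ X, nv F X v y = X.card + (q ^ 2 - 1) * (X.filter (fun y => y + v ∈ X)).card := by
  unfold nv
  simp_rw [Finset.card_filter]
  rw [Finset.sum_comm, ← Finset.add_sum_erase _ _ (mem_univ (0 : F))]
  congr 1
  · simp
  · have h : ∀ c ∈ (univ : Finset F).erase 0, ∑ x ∈ X, (if x + c • v ∈ X then 1 else 0)
        = ∑ x ∈ X, (if x + v ∈ X then 1 else 0) := by
      intro c hc
      have hc0 : c ≠ 0 := by simpa using hc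
      symm
      apply Finset.sum_bij (fun x _ => c • x)
      · exact fun x hx => hX.smul c x hx
      · intro x _ y _ h
        exact smul_right_injective _ hc0 h
      · intro y hy
        exact ⟨c⁻¹ • y, hX.smul _ _ hy, by rw [smul_smul, mul_inv_cancel₀ hc0, one_smul]⟩
      · intro x _
        rw [← smul_add]
        simp only [hX.smul_iff hc0]
    rw [Finset.sum_congr rfl h, Finset.sum_const, Finset.card_erase_of_mem (mem_univ _),
      Finset.card_univ, D.hF, smul_eq_mul]

/-- The variance-type sum. -/
noncomputable def Zsum (F : Type) [Field F] [Fintype F] {V : Type} [AddCommGroup V] [Module F V]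
    [Fintype V] (q : ℕ) (X : Finset V) : ℤ :=
  ∑ v ∈ univ.filter (fun v : V => v ∉ X), ∑ x : V,
    ((nv F X v x : ℤ) - 1) * ((nv F X v x : ℤ) - q - 1)

theorem Zsum_eq (D : FD F p q) {X : Finset V} (hX : IsCone F X) :
    Zsum F q X = (q : ℤ) ^ 2 * ((X.card : ℤ) * (Fintype.card V - X.card)
        + ((q : ℤ) ^ 2 - 1) * ((X.card : ℤ) ^ 2 - Tcount X))
      - (q + 2) * ((q : ℤ) ^ 2 * X.card * (Fintype.card V - X.card))
      + (q + 1) * (Fintype.card V * (Fintype.card V - X.card)) := by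
  have hin : ∀ v : V, ∑ x : V, ((nv F X v x : ℤ) - 1) * ((nv F X v x : ℤ) - q - 1)
      = (q : ℤ) ^ 2 * (X.card + ((q : ℤ) ^ 2 - 1) * (X.filter (fun y => y + v ∈ X)).card)
        - (q + 2) * ((q : ℤ) ^ 2 * X.card) + (q + 1) * Fintype.card V := by
    intro v
    have h1 := sum_nv D X v
    have h2 := sum_nv_sq D X v
    rw [sum_nv_X D hX] at h2
    have h1' : ∑ x : V, (nv F X v x : ℤ) = (q : ℤ) ^ 2 * X.card := by exact_mod_cast h1
    have h2' : ∑ x : V, (nv F X v x : ℤ) ^ 2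
      = (q : ℤ) ^ 2 * (X.card + ((q : ℤ) ^ 2 - 1) * (X.filter (fun y => y + v ∈ X)).card) := by
      have := congrArg (Nat.cast : ℕ → ℤ) h2
      push_cast [Nat.cast_sub D.one_lt_Q.le] at this
      exact this
    have h3 : ∑ x : V, (1 : ℤ) = Fintype.card V := by simp
    rw [← h1', ← h2', ← h3, Finset.mul_sum, Finset.mul_sum, ← Finset.sum_sub_distrib,
      ← Finset.sum_add_distrib]
    apply Finset.sum_congr rfl
    intro x _; ring
  unfold Zsum
  simp_rw [hin]
  have hcard : ((univ.filter (fun v : V => v ∉ X)).card : ℤ) = Fintype.card V - X.card := by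
    have : (univ.filter (fun v : V => v ∉ X)) = univ \ X := by ext; simp
    rw [this, Finset.card_sdiff_of_subset (subset_univ _), Finset.card_univ,
      Nat.cast_sub (Finset.card_le_univ X)]
  have hT : ∑ v ∈ univ.filter (fun v : V => v ∉ X), ((X.filter (fun y => y + v ∈ X)).card : ℤ)
      = (X.card : ℤ) ^ 2 - Tcount X := by
    have h1 : ∑ v : V, (X.filter (fun y => y + v ∈ X)).card = X.card ^ 2 := by
      simp_rw [Finset.card_filter]
      rw [Finset.sum_comm]
      have : ∀ y ∈ X, ∑ v : V, (if y + v ∈ X then 1 else 0) = X.card := by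
        intro y _
        rw [← Finset.card_filter, ← card_shift X y]
        simp_rw [add_comm y]
      rw [Finset.sum_congr rfl this, Finset.sum_const, smul_eq_mul, pow_two]
    have h2 : ∑ v ∈ univ.filter (fun v : V => v ∈ X), (X.filter (fun y => y + v ∈ X)).card = Tcount X := by
      unfold Tcount
      rw [Finset.filter_mem_eq_inter, Finset.univ_inter]
      simp_rw [add_comm]
    have h3 := Finset.sum_filter_add_sum_filter_not (univ : Finset V) (fun v => v ∈ X)
      (fun v => (X.filter (fun y => y + v ∈ X)).card)
    rw [h1, h2] at h3
    have h4 : (Tcount X : ℤ) + ∑ v ∈ univ.filter (fun v : V => v ∉ X), ((X.filter (fun y => y + v ∈ X)).card : ℤ)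
      = (X.card : ℤ) ^ 2 := by exact_mod_cast h3
    linear_combination h4
  rw [Finset.sum_add_distrib, Finset.sum_sub_distrib, ← Finset.mul_sum, Finset.sum_add_distrib,
    ← Finset.mul_sum, hT]
  simp only [Finset.sum_const, nsmul_eq_mul, hcard]
  ring

/-- For a Hermitian zero set, lines through points off the set have `1` or `q+1` points. -/
theorem IsHerm.nv_eq (D : FD F p q) {H : V → V → F} (h : IsHerm F q H) {v : V} (hv : H v v ≠ 0)
    (x : V) : nv F (univ.filter (fun x => H x x = 0)) v x = 1 ∨
      nv F (univ.filter (fun x => H x x = 0)) v x = q + 1 := by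
  rw [← nv_shift _ v x (-(H x v / H v v))]
  set y := x + (-(H x v / H v v)) • v with hy
  have hyv : H y v = 0 := by
    rw [hy, h.add, h.smul, neg_mul, div_mul_cancel₀ _ hv, add_neg_cancel]
  have hvy : H v y = 0 := by rw [h.symm y v, hyv, zero_pow D.q_ne]
  clear_value y
  have hexp : ∀ t : F, H (y + t • v) (y + t • v) = H y y + t ^ (q + 1) * H v v := by
    intro t
    rw [h.add, h.add_right D, h.add_right D, h.smul, h.smul, h.smul_right, h.smul_right, hyv, hvy]
    ring
  unfold nv
  simp only [mem_filter, mem_univ, true_and, hexp]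
  by_cases h0 : H y y = 0
  · left
    rw [Finset.card_eq_one]
    refine ⟨0, ?_⟩
    ext t
    simp [h0, hv]
  · right
    have h1 : univ.filter (fun t : F => H y y + t ^ (q + 1) * H v v = 0)
        = univ.filter (fun t : F => t ^ (q + 1) = -H y y / H v v) := by
      ext t
      simp only [mem_filter, mem_univ, true_and]
      rw [eq_div_iff hv, eq_neg_iff_add_eq_zero, add_comm]
    rw [h1]
    apply D.norm_fibre
    · exact div_ne_zero (neg_ne_zero.2 h0) hv
    · rw [div_pow, D.neg_pow, ← h.symm, ← h.symm]

theorem IsHerm.isCone {H : V → V → F} (h : IsHerm F q H) :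
    IsCone F (univ.filter (fun x => H x x = 0)) := by
  constructor
  · simp [h.zero_left]
  · intro c x hx
    simp at hx ⊢
    rw [h.smul, h.smul_right, hx]; ring

theorem IsHerm.Zsum_zero (D : FD F p q) {H : V → V → F} (h : IsHerm F q H) :
    Zsum F q (univ.filter (fun x => H x x = 0)) = 0 := by
  unfold Zsum
  apply Finset.sum_eq_zero
  intro v hv
  simp at hv
  apply Finset.sum_eq_zero
  intro x _
  rcases h.nv_eq D hv x with h1 | h1 <;> rw [h1] <;> simp

end ZPart

open Module Matrix

section RepPart
open scoped Classical
open Finset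

variable {F : Type} [Field F] [Fintype F] {p q : ℕ}
variable {V : Type} [AddCommGroup V] [Module F V] [Fintype V]

/-- A representation of the indicator function of `X` as a combination of hyperplanes. -/
structure CRep (F : Type) [Field F] {V : Type} [AddCommGroup V] [Module F V]
    (q : ℕ) (X : Finset V) where
  ι : Type
  fin : Fintype ι
  φ : ι → V →ₗ[F] F
  α : ι → F
  hα : ∀ i, α i ^ q = α i
  rep : ∀ x, (if x ∈ X then (1 : F) else 0) = ∑ i, α i * if φ i x = 0 then 1 else 0

attribute [instance] CRep.fin

/-- moments of the line through `x` in direction `v`. -/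
noncomputable def mom (F : Type) [Field F] [Fintype F] {V : Type} [AddCommGroup V] [Module F V]
    (X : Finset V) (v : V) (k : ℕ) (x : V) : F :=
  ∑ t : F, t ^ k * if x + t • v ∈ X then 1 else 0

theorem mom_eq_sum (X : Finset V) (v : V) (k : ℕ) (x : V) :
    mom F X v k x = ∑ t ∈ univ.filter (fun t : F => x + t • v ∈ X), t ^ k := by
  unfold mom
  rw [Finset.sum_filter]
  apply Finset.sum_congr rfl
  intro t _
  split_ifs <;> simp

theorem mom_zero_eq (X : Finset V) (v x : V) : mom F X v 0 x = (nv F X v x : F) := by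
  rw [mom_eq_sum]; simp [nv]

/-- the functional attached to an index. -/
noncomputable def CRep.ψ {X : Finset V} (R : CRep F q X) (v : V) (i : R.ι) : V →ₗ[F] F :=
  (-(R.φ i v)⁻¹) • R.φ i

theorem CRep.ψ_self {X : Finset V} (R : CRep F q X) (v : V) (i : R.ι) (h : R.φ i v ≠ 0) :
    R.ψ v i v = -1 := by
  simp [CRep.ψ, h]

theorem CRep.mom_eq (D : FD F p q) {X : Finset V} (R : CRep F q X) (v : V) {k : ℕ}
    (hk : k < q ^ 2 - 1) (x : V) :
    mom F X v k x = ∑ i ∈ univ.filter (fun i => R.φ i v ≠ 0), R.α i * (R.ψ v i x) ^ k := by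
  unfold mom
  simp_rw [R.rep, Finset.mul_sum]
  rw [Finset.sum_comm, Finset.sum_filter]
  apply Finset.sum_congr rfl
  intro i _
  have h1 : ∀ t : F, t ^ k * (R.α i * if R.φ i (x + t • v) = 0 then 1 else 0)
      = R.α i * (t ^ k * if R.φ i x + t * R.φ i v = 0 then 1 else 0) := by
    intro t; rw [map_add, map_smul, smul_eq_mul]; ring
  simp_rw [h1]
  rw [← Finset.mul_sum]
  split_ifs with h
  · congr 1
    rw [Finset.sum_eq_single (R.ψ v i x)]
    · rw [if_pos, mul_one]
      simp only [CRep.ψ, LinearMap.smul_apply, smul_eq_mul]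
      field_simp
      ring
    · intro t _ ht
      rw [if_neg, mul_zero]
      intro h0
      apply ht
      simp only [CRep.ψ, LinearMap.smul_apply, smul_eq_mul]
      field_simp
      linear_combination h0
    · simp
  · push Not at h
    simp only [h, mul_zero, add_zero]
    rw [← Finset.sum_mul, D.psum hk]
    simp

theorem CRep.mom_zero (D : FD F p q) {X : Finset V} (hX : IsCone F X) (R : CRep F q X) {v : V}
    (hv : v ∉ X) (x : V) : mom F X v 0 x = 1 := by
  have hQ := D.one_lt_Q
  have hQ4 : 0 < q ^ 2 - 1 := by omega
  rw [R.mom_eq D v hQ4]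
  simp only [pow_zero, mul_one]
  have h1 := R.rep 0
  have h2 := R.rep v
  rw [if_pos hX.zero] at h1
  rw [if_neg hv] at h2
  simp only [map_zero, if_true, mul_one] at h1
  have h3 : ∑ i, R.α i = ∑ i ∈ univ.filter (fun i => R.φ i v ≠ 0), R.α i
      + ∑ i, R.α i * (if R.φ i v = 0 then 1 else 0) := by
    rw [Finset.sum_filter, ← Finset.sum_add_distrib]
    apply Finset.sum_congr rfl
    intro i _
    by_cases h : R.φ i v = 0 <;> simp [h]
  rw [h3, ← h2, add_zero] at h1
  exact h1.symm

theorem CRep.nv_mod (D : FD F p q) {X : Finset V} (hX : IsCone F X) (R : CRep F q X) {v : V}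
    (hv : v ∉ X) (x : V) : nv F X v x ≡ 1 [MOD p] := by
  haveI := D.charP
  have := R.mom_zero D hX hv x
  rw [mom_zero_eq] at this
  unfold Nat.ModEq
  rw [← CharP.cast_eq_iff_mod_eq F]
  simpa using this

theorem CRep.nv_pos (D : FD F p q) {X : Finset V} (hX : IsCone F X) (R : CRep F q X) {v : V}
    (hv : v ∉ X) (x : V) : 1 ≤ nv F X v x := by
  by_contra h
  have h0 : nv F X v x = 0 := by omega
  have := R.nv_mod D hX hv x
  rw [h0] at this
  have h2 := (Nat.modEq_iff_dvd' (by omega)).1 this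
  have := D.hp.two_le
  have := Nat.le_of_dvd (by omega) h2
  omega

theorem mom_frob (D : FD F p q) (X : Finset V) (v : V) (k : ℕ) (x : V) :
    mom F X v (k * q) x = (mom F X v k x) ^ q := by
  rw [mom_eq_sum, mom_eq_sum, D.sum_pow]
  apply Finset.sum_congr rfl
  intro t _
  rw [pow_mul]

theorem mom_smul {X : Finset V} (hX : IsCone F X) (v : V) (k : ℕ) {c : F} (hc : c ≠ 0) (x : V) :
    mom F X v k (c • x) = c ^ k * mom F X v k x := by
  unfold mom
  rw [Finset.mul_sum]
  symm
  apply Finset.sum_bij (fun t _ => c * t)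
  · simp
  · intro a _ b _ h
    exact mul_left_cancel₀ hc h
  · intro b _
    exact ⟨c⁻¹ * b, mem_univ _, by rw [← mul_assoc, mul_inv_cancel₀ hc, one_mul]⟩
  · intro t _
    rw [mul_smul, ← smul_add]
    simp only [hX.smul_iff hc]
    ring

theorem nv_smul {X : Finset V} (hX : IsCone F X) (v : V) {c : F} (hc : c ≠ 0) (x : V) :
    nv F X v (c • x) = nv F X v x := by
  unfold nv
  symm
  apply Finset.card_bij (fun t _ => c * t)
  · intro t ht
    simp at ht ⊢
    rw [mul_smul, ← smul_add]
    exact hX.smul c _ ht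
  · intro a _ b _ h
    exact mul_left_cancel₀ hc h
  · intro b hb
    simp at hb
    refine ⟨c⁻¹ * b, ?_, by rw [← mul_assoc, mul_inv_cancel₀ hc, one_mul]⟩
    simp
    have := hX.smul c⁻¹ _ hb
    rwa [smul_add, smul_smul, inv_mul_cancel₀ hc, one_smul, smul_smul] at this

/-- polynomial form of the moments along a line `x + s z`. -/
noncomputable def CRep.momPoly {X : Finset V} (R : CRep F q X) (v : V) (k : ℕ) (x z : V) :
    Polynomial F :=
  ∑ i ∈ univ.filter (fun i => R.φ i v ≠ 0),
    Polynomial.C (R.α i) * (Polynomial.C (R.ψ v i x) + Polynomial.C (R.ψ v i z) * Polynomial.X) ^ k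

theorem CRep.momPoly_eval (D : FD F p q) {X : Finset V} (R : CRep F q X) (v : V) {k : ℕ}
    (hk : k < q ^ 2 - 1) (x z : V) (s : F) :
    (R.momPoly v k x z).eval s = mom F X v k (x + s • z) := by
  rw [R.mom_eq D v hk]
  unfold CRep.momPoly
  rw [Polynomial.eval_finset_sum]
  apply Finset.sum_congr rfl
  intro i _
  simp only [Polynomial.eval_mul, Polynomial.eval_C, Polynomial.eval_pow, Polynomial.eval_add,
    Polynomial.eval_X, map_add, map_smul, smul_eq_mul]
  ring

theorem CRep.momPoly_natDegree {X : Finset V} (R : CRep F q X) (v : V) (k : ℕ)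
    (x z : V) : (R.momPoly v k x z).natDegree ≤ k := by
  unfold CRep.momPoly
  apply Polynomial.natDegree_sum_le_of_forall_le
  intro i _
  refine (Polynomial.natDegree_C_mul_le _ _).trans ?_
  refine Polynomial.natDegree_pow_le.trans ?_
  have : (Polynomial.C (R.ψ v i x) + Polynomial.C (R.ψ v i z) * Polynomial.X).natDegree ≤ 1 := by
    rw [add_comm]; exact Polynomial.natDegree_linear_le
  nlinarith

theorem CRep.momPoly_coeff (D : FD F p q) {X : Finset V} (R : CRep F q X) (v : V) {k : ℕ}
    (hk : k < q ^ 2 - 1) (x z : V) : (R.momPoly v k x z).coeff k = mom F X v k z := by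
  rw [R.mom_eq D v hk]
  unfold CRep.momPoly
  rw [Polynomial.finset_sum_coeff]
  apply Finset.sum_congr rfl
  intro i _
  rw [Polynomial.coeff_C_mul]
  congr 1
  have h1 : (Polynomial.C (R.ψ v i x) + Polynomial.C (R.ψ v i z) * Polynomial.X).natDegree ≤ 1 := by
    rw [add_comm]; exact Polynomial.natDegree_linear_le
  have := Polynomial.coeff_pow_of_natDegree_le (m := k) h1
  rw [mul_one] at this
  rw [this]
  simp

/-- if the moment function vanishes at more than `k` points of an affine line then it
vanishes on the line and at its direction -/
theorem CRep.mom_vanish (D : FD F p q) {X : Finset V} (R : CRep F q X) (v : V) {k : ℕ}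
    (hk : k < q ^ 2 - 1) (x z : V) (T : Finset F) (hT : k < T.card)
    (h0 : ∀ s ∈ T, mom F X v k (x + s • z) = 0) :
    (∀ s : F, mom F X v k (x + s • z) = 0) ∧ mom F X v k z = 0 := by
  have hP : R.momPoly v k x z = 0 := by
    apply Polynomial.eq_zero_of_natDegree_lt_card_of_eval_eq_zero' _ T
    · intro s hs
      rw [R.momPoly_eval D v hk]; exact h0 s hs
    · exact lt_of_le_of_lt (R.momPoly_natDegree v k x z) hT
  constructor
  · intro s
    rw [← R.momPoly_eval D v hk, hP]; simp
  · rw [← R.momPoly_coeff D v hk x z, hP]; simp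

/-- first moment as a linear form -/
noncomputable def CRep.lam {X : Finset V} (R : CRep F q X) (v : V) : V →ₗ[F] F :=
  ∑ i ∈ univ.filter (fun i => R.φ i v ≠ 0), R.α i • R.ψ v i

theorem CRep.lam_eq (D : FD F p q) {X : Finset V} (R : CRep F q X) (v x : V) :
    R.lam v x = mom F X v 1 x := by
  have h2 := D.two_le
  have : 1 < q ^ 2 - 1 := by
    have : 2 * 2 ≤ q ^ 2 := by nlinarith
    omega
  rw [R.mom_eq D v this]
  simp [CRep.lam]

theorem CRep.lam_self (D : FD F p q) {X : Finset V} (hX : IsCone F X) (R : CRep F q X) {v : V}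
    (hv : v ∉ X) : R.lam v v = -1 := by
  have h0 := R.mom_zero D hX hv 0
  have hQ4 : 0 < q ^ 2 - 1 := by have := D.one_lt_Q; omega
  rw [R.mom_eq D v hQ4] at h0
  simp only [pow_zero, mul_one] at h0
  simp only [CRep.lam, LinearMap.sum_apply, LinearMap.smul_apply, smul_eq_mul]
  rw [← h0, ← Finset.sum_neg_distrib]
  apply Finset.sum_congr rfl
  intro i hi
  simp at hi
  rw [R.ψ_self v i hi]; ring

/-- The Hermitian form given by the moment `q+1`. -/
noncomputable def CRep.mu {X : Finset V} (R : CRep F q X) (v : V) (x y : V) : F :=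
  ∑ i ∈ univ.filter (fun i => R.φ i v ≠ 0), R.α i * (R.ψ v i x * (R.ψ v i y) ^ q)

theorem CRep.mu_herm (D : FD F p q) {X : Finset V} (R : CRep F q X) (v : V) :
    IsHerm F q (R.mu v) := by
  constructor
  · intro x y z
    simp only [CRep.mu, map_add]
    rw [← Finset.sum_add_distrib]
    apply Finset.sum_congr rfl; intro i _; ring
  · intro c x z
    simp only [CRep.mu, map_smul, smul_eq_mul]
    rw [Finset.mul_sum]
    apply Finset.sum_congr rfl; intro i _; ring
  · intro x y
    simp only [CRep.mu]
    rw [D.sum_pow]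
    apply Finset.sum_congr rfl; intro i _
    rw [mul_pow, mul_pow, D.pow_pow, R.hα]; ring

theorem CRep.mu_self (D : FD F p q) (hq : 2 < q) {X : Finset V} (R : CRep F q X) (v x : V) :
    R.mu v x x = mom F X v (q + 1) x := by
  have : q + 1 < q ^ 2 - 1 := by
    have : q ^ 2 ≥ 3 * q := by nlinarith
    omega
  rw [R.mom_eq D v this]
  simp only [CRep.mu]
  apply Finset.sum_congr rfl; intro i _; ring

theorem single_line {X : Finset V} {v x : V} (h1 : nv F X v x = 1) (hl : mom F X v 1 x = 0) :
    ∀ t : F, x + t • v ∈ X ↔ t = 0 := by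
  unfold nv at h1
  rw [Finset.card_eq_one] at h1
  obtain ⟨a, ha⟩ := h1
  rw [mom_eq_sum, ha] at hl
  simp at hl
  subst hl
  intro t
  have : t ∈ univ.filter (fun t : F => x + t • v ∈ X) ↔ t ∈ ({0} : Finset F) := by rw [ha]
  simpa using this

theorem single_mom {X : Finset V} {v x : V} (h : ∀ t : F, x + t • v ∈ X ↔ t = 0) {k : ℕ} (hk : k ≠ 0) :
    mom F X v k x = 0 := by
  unfold mom
  apply Finset.sum_eq_zero
  intro t _
  split_ifs with h0
  · rw [h t] at h0; simp [h0, hk]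
  · simp

end RepPart

open Module Matrix

section LemL
open scoped Classical
open Finset

variable {F : Type} [Field F] [Fintype F] {p q : ℕ}
variable {V : Type} [AddCommGroup V] [Module F V] [Fintype V]

theorem CRep.mom_smul' (D : FD F p q) {X : Finset V} (R : CRep F q X) (v : V) {k : ℕ}
    (hk : k < q ^ 2 - 1) (c : F) (x : V) :
    mom F X v k (c • x) = c ^ k * mom F X v k x := by
  rw [R.mom_eq D v hk, R.mom_eq D v hk, Finset.mul_sum]
  apply Finset.sum_congr rfl
  intro i _
  rw [map_smul, smul_eq_mul, mul_pow]; ring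

theorem lemL1 (D : FD F p q) {X : Finset V} {v y : V}
    (hs : nv F X v y = 1 ∨ nv F X v y = q + 1)
    (hm : ∀ k, 1 ≤ k → k ≤ q → mom F X v k y = 0) :
    (y ∈ X ↔ nv F X v y = 1) ∧ (nv F X v y = 1 ↔ mom F X v (q + 1) y = 0) := by
  have h2 := D.two_le
  by_cases h1 : nv F X v y = 1
  · have hsl := single_line h1 (hm 1 le_rfl (by omega))
    refine ⟨⟨fun _ => h1, fun _ => ?_⟩, ⟨fun _ => single_mom hsl (by omega), fun _ => h1⟩⟩
    have := (hsl 0).2 rfl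
    simpa using this
  · have hn : nv F X v y = q + 1 := hs.resolve_left h1
    let f : F → F := fun t => t * if y + t • v ∈ X then 1 else 0
    have hmom : ∀ k, ∑ t, t ^ k * f t = mom F X v (k + 1) y := by
      intro k
      unfold mom
      apply Finset.sum_congr rfl
      intro t _
      simp only [f]; ring
    have hsup : univ.filter (fun t => f t ≠ 0) ⊆ (univ.filter (fun t : F => y + t • v ∈ X)).erase 0 := by
      intro t ht
      simp [f] at ht
      simp [ht.1, ht.2]
    have hcard : (univ.filter (fun t : F => y + t • v ∈ X)).card = q + 1 := hn
    have hf0 : ¬ ∀ t, f t = 0 := by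
      intro hf
      have hsub : univ.filter (fun t : F => y + t • v ∈ X) ⊆ {0} := by
        intro t ht
        have := hf t
        simp at ht
        simp [f, ht] at this
        simp [this]
      have := Finset.card_le_card hsub
      rw [hcard] at this
      simp at this
      omega
    have hz : y ∉ X := by
      intro hy
      apply hf0
      apply vandermonde_zero (K := q)
      · refine (Finset.card_le_card hsup).trans ?_
        rw [Finset.card_erase_of_mem (by simpa using hy), hcard]; omega
      · intro k hk
        rw [hmom]; exact hm _ (by omega) (by omega)
    refine ⟨⟨fun h => absurd h hz, fun h => absurd h h1⟩, ⟨fun h => absurd h h1, fun h => ?_⟩⟩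
    exfalso
    apply hf0
    apply vandermonde_zero (K := q + 1)
    · refine (Finset.card_le_card hsup).trans ?_
      refine (Finset.card_erase_le).trans ?_
      rw [hcard]
    · intro k hk
      rw [hmom]
      rcases Nat.lt_or_ge k q with h' | h'
      · exact hm _ (by omega) (by omega)
      · have : k = q := by omega
        rw [this]; exact h

theorem lemL (D : FD F p q) (hq : 4 < q) {X : Finset V} (hX : IsCone F X) (R : CRep F q X)
    (star : ∀ v, v ∉ X → ∀ x, nv F X v x = 1 ∨ nv F X v x = q + 1)
    {v : V} (hv : v ∉ X) {w z : V} (hw : R.lam v w = 0) (hz : R.lam v z = 0)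
    (hwn : nv F X v w = q + 1)
    (hτ : q ≤ (univ.filter (fun c : F => nv F X v (z + c • w) = 1)).card) :
    (∀ a b : F, (a • w + b • z ∈ X ↔ R.mu v (a • w + b • z) (a • w + b • z) = 0)) ∧
    (univ.filter (fun c : F => nv F X v (z + c • w) = 1)).card = q + 1 := by
  have hqq : q ^ 2 ≥ 5 * q := by nlinarith
  set T := univ.filter (fun c : F => nv F X v (z + c • w) = 1) with hT
  have hT0 : ∀ c ∈ T, ∀ k, k ≠ 0 → mom F X v k (z + c • w) = 0 := by
    intro c hc k hk
    simp [hT] at hc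
    apply single_mom _ hk
    apply single_line hc
    rw [← R.lam_eq D, map_add, map_smul, hz, hw]; simp
  have hvan : ∀ k, 1 ≤ k → k < q → (∀ s : F, mom F X v k (z + s • w) = 0) ∧ mom F X v k w = 0 := by
    intro k h1 hk
    apply R.mom_vanish D v (by omega) z w T (by omega)
    intro s hs
    exact hT0 s hs k (by omega)
  have hall' : ∀ k, 1 ≤ k → k < q → ∀ a b : F, mom F X v k (a • w + b • z) = 0 := by
    intro k h1 hk a b
    by_cases hb : b = 0
    · rw [hb, zero_smul, add_zero, R.mom_smul' D v (by omega), (hvan k h1 hk).2, mul_zero]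
    · have : a • w + b • z = b • (z + (a / b) • w) := by
        rw [smul_add, smul_smul, mul_div_cancel₀ _ hb, add_comm]
      rw [this, R.mom_smul' D v (by omega), (hvan k h1 hk).1, mul_zero]
  have hall : ∀ k, 1 ≤ k → k ≤ q → ∀ a b : F, mom F X v k (a • w + b • z) = 0 := by
    intro k h1 hk a b
    rcases Nat.lt_or_ge k q with h | h
    · exact hall' k h1 h a b
    · have : k = 1 * q := by omega
      rw [this, mom_frob D, hall' 1 le_rfl (by omega), zero_pow D.q_ne]
  have hpt : ∀ a b : F, (a • w + b • z ∈ X ↔ nv F X v (a • w + b • z) = 1) ∧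
      (nv F X v (a • w + b • z) = 1 ↔ R.mu v (a • w + b • z) (a • w + b • z) = 0) := by
    intro a b
    have := lemL1 D (star v hv (a • w + b • z)) (fun k h1 h2 => hall k h1 h2 a b)
    rw [R.mu_self D (by omega)]
    exact this
  refine ⟨fun a b => (hpt a b).1.trans (hpt a b).2, ?_⟩
  have hmuw : R.mu v w w ≠ 0 := by
    have := (hpt 1 0).2
    simp at this
    intro h
    rw [this.2 h] at hwn
    omega
  have hTeq : T.card = nv F (univ.filter (fun x => R.mu v x x = 0)) w z := by
    unfold nv
    rw [hT]
    congr 1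
    ext c
    have := (hpt c 1).2
    rw [one_smul, add_comm (c • w)] at this
    simp [this]
  rcases (R.mu_herm D v).nv_eq D hmuw z with h | h
  · rw [← hTeq] at h; omega
  · rw [hTeq, h]

end LemL

open Module Matrix

section EPart
open scoped Classical
open Finset

variable {F : Type} [Field F] [Fintype F] {p q : ℕ}
variable {V : Type} [AddCommGroup V] [Module F V] [Fintype V]

theorem nv_zero {X : Finset V} (hX : IsCone F X) {v : V} (hv : v ∉ X) : nv F X v 0 = 1 := by
  unfold nv
  rw [Finset.card_eq_one]
  refine ⟨0, ?_⟩
  ext t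
  simp
  constructor
  · intro h
    by_contra ht
    exact hv ((hX.smul_iff ht v).1 h)
  · rintro rfl; simp [hX.zero]

/-- number of points (affinely counted) in `z + ⟨v,w⟩`. -/
noncomputable def gz (F : Type) [Field F] [Fintype F] {V : Type} [AddCommGroup V] [Module F V]
    (X : Finset V) (v w z : V) : ℕ := ∑ c : F, nv F X v (z + c • w)

theorem gz_mem {X : Finset V} (D : FD F p q) (hX : IsCone F X) {v w z : V} (hv : v ∉ X)
    (hz : z ∈ Submodule.span F {v, w}) : gz F X v w z = 1 + (q ^ 2 - 1) * nv F X v w := by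
  rw [Submodule.mem_span_pair] at hz
  obtain ⟨a, b, rfl⟩ := hz
  unfold gz
  have h1 : ∀ c : F, nv F X v (a • v + b • w + c • w) = nv F X v ((b + c) • w) := by
    intro c
    rw [← nv_shift X v ((b + c) • w) a, add_smul]
    congr 1; abel
  simp_rw [h1]
  rw [Fintype.sum_equiv (Equiv.addLeft b) (fun c => nv F X v ((b + c) • w)) (fun c => nv F X v (c • w))
    (fun c => rfl)]
  rw [← Finset.add_sum_erase _ _ (mem_univ (0 : F))]
  congr 1
  · simp [nv_zero hX hv]
  · have : ∀ c ∈ (univ : Finset F).erase 0, nv F X v (c • w) = nv F X v w := by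
      intro c hc
      exact nv_smul hX v (by simpa using hc) w
    rw [Finset.sum_congr rfl this, Finset.sum_const, Finset.card_erase_of_mem (mem_univ _),
      Finset.card_univ, D.hF, smul_eq_mul]

theorem sum_gz (D : FD F p q) (X : Finset V) (v w : V) :
    ∑ z : V, gz F X v w z = q ^ 4 * X.card := by
  unfold gz
  rw [Finset.sum_comm]
  have : ∀ c : F, ∑ z : V, nv F X v (z + c • w) = q ^ 2 * X.card := by
    intro c
    rw [← sum_nv D X v]
    exact Fintype.sum_equiv (Equiv.addRight (c • w)) _ _ (fun z => rfl)
  simp_rw [this]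
  simp [D.hF]; ring

theorem card_span_pair (D : FD F p q) {v w : V} (hi : LinearIndependent F ![v, w]) :
    (univ.filter (fun z : V => z ∈ Submodule.span F {v, w})).card = q ^ 4 := by
  rw [D.card_sub]
  have h := finrank_span_eq_card hi
  have h2 : Set.range ![v, w] = {v, w} := by simp [Set.pair_comm]
  rw [h2] at h
  rw [h]; simp

theorem exists_below (D : FD F p q) {X : Finset V} (hX : IsCone F X) {v w : V} (hv : v ∉ X)
    (hi : LinearIndependent F ![v, w]) (B : ℕ)
    (hB : q ^ 4 * X.card < (Fintype.card V - q ^ 4) * B + q ^ 4 * (1 + (q ^ 2 - 1) * nv F X v w)) :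
    ∃ z, z ∉ Submodule.span F {v, w} ∧ gz F X v w z < B := by
  by_contra hc
  push Not at hc
  have h1 := sum_gz D X v w
  rw [← Finset.sum_filter_add_sum_filter_not univ (fun z => z ∈ Submodule.span F {v, w})] at h1
  have h2 : ∑ z ∈ univ.filter (fun z => z ∈ Submodule.span F {v, w}), gz F X v w z
      = q ^ 4 * (1 + (q ^ 2 - 1) * nv F X v w) := by
    rw [← card_span_pair D hi, ← smul_eq_mul, ← Finset.sum_const]
    apply Finset.sum_congr rfl
    intro z hz
    exact gz_mem D hX hv (by simpa using hz)
  have h3 : (Fintype.card V - q ^ 4) * B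
      ≤ ∑ z ∈ univ.filter (fun z => ¬ z ∈ Submodule.span F {v, w}), gz F X v w z := by
    have hcd : (univ.filter (fun z => ¬ z ∈ Submodule.span F {v, w})).card = Fintype.card V - q ^ 4 := by
      rw [← card_span_pair D hi, ← Finset.card_univ,
        ← Finset.card_filter_add_card_filter_not (s := (univ : Finset V)) (fun z => z ∈ Submodule.span F {v, w})]
      omega
    rw [← hcd, ← smul_eq_mul, ← Finset.sum_const]
    apply Finset.sum_le_sum
    intro z hz
    exact hc z (by simpa using hz)
  omega

/-- secant lines at a point `P ∈ X` have many points. -/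
theorem star_line (D : FD F p q) {X : Finset V} (hX : IsCone F X)
    (star : ∀ v, v ∉ X → ∀ x, nv F X v x = 1 ∨ nv F X v x = q + 1)
    {P y : V} (hP : P ∈ X) {s0 : F} (h0 : y + s0 • P ∈ X) :
    q ≤ nv F X P y := by
  by_cases hall : ∀ s : F, y + s • P ∈ X
  · unfold nv
    rw [Finset.filter_true_of_mem (fun x _ => hall x), Finset.card_univ, D.hF]
    have := D.two_le; nlinarith
  · push Not at hall
    obtain ⟨s1, hs1⟩ := hall
    set u := y + s1 • P with hu
    have hne : s0 - s1 ≠ 0 := by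
      intro h
      rw [sub_eq_zero.1 h] at h0
      exact hs1 h0
    have hmem : ∀ s : F, s ≠ 0 → (P + s • u ∈ X ↔ y + (s1 + s⁻¹) • P ∈ X) := by
      intro s hs
      rw [← hX.smul_iff (c := s) hs (y + (s1 + s⁻¹) • P)]
      have : s • (y + (s1 + s⁻¹) • P) = P + s • u := by
        rw [hu, smul_add, smul_smul, mul_add, mul_inv_cancel₀ hs, add_smul, one_smul, smul_add, smul_smul]
        abel
      rw [this]
    have hn : nv F X u P = q + 1 := by
      refine (star u hs1 P).resolve_left ?_
      intro h1
      unfold nv at h1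
      rw [Finset.card_eq_one] at h1
      obtain ⟨a, ha⟩ := h1
      have ha0 : (0 : F) ∈ univ.filter (fun t : F => P + t • u ∈ X) := by simp [hP]
      have ha1 : (s0 - s1)⁻¹ ∈ univ.filter (fun t : F => P + t • u ∈ X) := by
        simp only [mem_filter, mem_univ, true_and]
        rw [hmem _ (inv_ne_zero hne)]
        simpa using h0
      rw [ha] at ha0 ha1
      simp at ha0 ha1
      rw [← ha0] at ha1
      exact hne (inv_eq_zero.1 ha1)
    have hle : ((univ.filter (fun t : F => P + t • u ∈ X)).erase 0).card ≤ nv F X P y := by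
      unfold nv
      apply Finset.card_le_card_of_injOn (fun t => s1 + t⁻¹)
      · intro t ht
        simp at ht ⊢
        exact (hmem t ht.2).1 ht.1
      · intro a _ b _ hab
        simpa using hab
    rw [Finset.card_erase_of_mem (by simp [hP])] at hle
    unfold nv at hn
    rw [hn] at hle
    simpa using hle

theorem gz_eq_sum (X : Finset V) (v w z : V) :
    gz F X v w z = ∑ c : F, ∑ t : F, if z + c • w + t • v ∈ X then 1 else 0 := by
  unfold gz nv
  simp_rw [Finset.card_filter]

/-- existence of a tangent at `P = w + t v`. -/
theorem exists_tangent (D : FD F p q) {X : Finset V} (hX : IsCone F X)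
    (star : ∀ v, v ∉ X → ∀ x, nv F X v x = 1 ∨ nv F X v x = q + 1)
    {v w z : V} {t : F} (hP : w + t • v ∈ X) (hg : gz F X v w z < q ^ 3) :
    ∃ c : F, ∀ s : F, z + c • v + s • (w + t • v) ∉ X := by
  by_contra hc
  push Not at hc
  have h1 : gz F X v w z = ∑ c : F, nv F X (w + t • v) (z + c • v) := by
    rw [gz_eq_sum]
    unfold nv
    simp_rw [Finset.card_filter]
    rw [Finset.sum_comm (γ := F)]
    have : ∀ s : F, ∑ c : F, (if z + c • v + s • (w + t • v) ∈ X then 1 else 0)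
        = ∑ c : F, (if z + s • w + c • v ∈ X then 1 else 0) := by
      intro s
      apply Fintype.sum_equiv (Equiv.addRight (s * t))
      intro c
      have : z + s • w + (Equiv.addRight (s * t) c) • v = z + c • v + s • (w + t • v) := by
        simp only [Equiv.coe_addRight, add_smul, smul_add, smul_smul]; abel
      rw [this]
    calc _ = ∑ s : F, ∑ c : F, (if z + s • w + c • v ∈ X then 1 else 0) := by rw [Finset.sum_comm]
      _ = ∑ s : F, ∑ c : F, (if z + c • v + s • (w + t • v) ∈ X then 1 else 0) := by simp_rw [this]
      _ = _ := by rw [Finset.sum_comm]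
  have h2 : ∑ c : F, q ≤ ∑ c : F, nv F X (w + t • v) (z + c • v) := by
    apply Finset.sum_le_sum
    intro c _
    obtain ⟨s, hs⟩ := hc c
    exact star_line D hX star hP hs
  rw [← h1] at h2
  simp [D.hF] at h2
  have : q ^ 2 * q = q ^ 3 := by ring
  omega

theorem sum_span_pair {v w : V} (hi : LinearIndependent F ![v, w]) {M : Type} [AddCommMonoid M]
    (f : V → M) :
    ∑ y ∈ univ.filter (fun y : V => y ∈ Submodule.span F {v, w}), f y
      = ∑ a : F, ∑ b : F, f (a • v + b • w) := by
  rw [← Finset.sum_product']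
  symm
  rw [LinearIndependent.pair_iff] at hi
  apply Finset.sum_bij (fun (x : F × F) _ => x.1 • v + x.2 • w)
  · rintro ⟨a, b⟩ _
    simp only [mem_filter, mem_univ, true_and]
    exact Submodule.mem_span_pair.2 ⟨a, b, rfl⟩
  · rintro ⟨a, b⟩ _ ⟨c, d⟩ _ h
    simp only at h
    have := hi (a - c) (b - d) (by
      rw [sub_smul, sub_smul]
      have : a • v - c • v + (b • w - d • w) = (a • v + b • w) - (c • v + d • w) := by abel
      rw [this, h, sub_self])
    rw [Prod.mk.injEq]
    exact ⟨sub_eq_zero.1 this.1, sub_eq_zero.1 this.2⟩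
  · intro y hy
    simp only [mem_filter, mem_univ, true_and] at hy
    obtain ⟨a, b, rfl⟩ := Submodule.mem_span_pair.1 hy
    exact ⟨(a, b), by simp, rfl⟩
  · intros; rfl

/-- Sum of a projectively invariant function over a 2-dim space. -/
theorem sum_hom (D : FD F p q) {M : Type} [CommSemiring M] (f : V → M)
    (hf : ∀ c : F, c ≠ 0 → ∀ y, f (c • y) = f y)
    (z w : V) : ∑ a : F, ∑ b : F, f (a • z + b • w)
      = f 0 + (q ^ 2 - 1 : ℕ) * (f w + ∑ c : F, f (z + c • w)) := by
  have hcard : ((univ : Finset F).erase 0).card = q ^ 2 - 1 := by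
    rw [Finset.card_erase_of_mem (mem_univ _), Finset.card_univ, D.hF]
  rw [← Finset.add_sum_erase _ _ (mem_univ (0 : F))]
  have h1 : ∑ b : F, f ((0 : F) • z + b • w) = f 0 + (q ^ 2 - 1 : ℕ) * f w := by
    rw [← Finset.add_sum_erase _ _ (mem_univ (0 : F))]
    congr 1
    · simp
    · rw [← hcard, ← nsmul_eq_mul, ← Finset.sum_const]
      apply Finset.sum_congr rfl
      intro c hc
      rw [zero_smul, zero_add, hf c (by simpa using hc)]
  have h2 : ∑ a ∈ (univ : Finset F).erase 0, ∑ b : F, f (a • z + b • w)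
      = (q ^ 2 - 1 : ℕ) * ∑ c : F, f (z + c • w) := by
    rw [← hcard, ← nsmul_eq_mul, ← Finset.sum_const]
    apply Finset.sum_congr rfl
    intro a ha
    have ha0 : a ≠ 0 := by simpa using ha
    symm
    apply Fintype.sum_equiv (Equiv.mulLeft₀ a ha0)
    intro c
    rw [← hf a ha0]
    simp [smul_add, smul_smul]
  rw [h1, h2]; ring

end EPart

open Module Matrix

section EMain
open scoped Classical
open Finset

variable {F : Type} [Field F] [Fintype F] {p q : ℕ}
variable {V : Type} [AddCommGroup V] [Module F V] [Fintype V]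

theorem sum_two_val (D : FD F p q) (f : F → ℕ) (hf : ∀ c, f c = 1 ∨ f c = q + 1) :
    ∑ c, f c + q * (univ.filter (fun c => f c = 1)).card = (q + 1) * q ^ 2 := by
  have : ∀ c, f c + q * (if f c = 1 then 1 else 0) = q + 1 := by
    intro c
    have := D.two_le
    rcases hf c with h | h
    · simp [h]
      try omega
    · have : ¬ (q + 1 = 1) := by omega
      simp [h]
  rw [Finset.card_filter, Finset.mul_sum, ← Finset.sum_add_distrib]
  simp_rw [this]
  simp [D.hF]; ring

theorem sum_norm_fibre_zero (D : FD F p q) {κ : F} :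
    ∑ s ∈ univ.filter (fun s : F => s ^ (q + 1) = κ), s = 0 := by
  have h2 := D.two_le
  have h1 := D.norm_fibre (c := 1) one_ne_zero (one_pow q)
  obtain ⟨ζ, hζ, hζ1⟩ := Finset.exists_mem_ne (s := univ.filter (fun t : F => t ^ (q + 1) = 1))
    (by omega) 1
  simp at hζ
  have hζ0 : ζ ≠ 0 := by rintro rfl; simp at hζ
  have : ∑ s ∈ univ.filter (fun s : F => s ^ (q + 1) = κ), s
      = ∑ s ∈ univ.filter (fun s : F => s ^ (q + 1) = κ), ζ * s := by
    symm
    apply Finset.sum_bij (fun s _ => ζ * s)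
    · intro s hs; simp at hs ⊢; rw [mul_pow, hζ, hs, one_mul]
    · intro a _ b _ h; exact mul_left_cancel₀ hζ0 h
    · intro b hb
      simp at hb
      refine ⟨ζ⁻¹ * b, ?_, by rw [← mul_assoc, mul_inv_cancel₀ hζ0, one_mul]⟩
      simp [mul_pow, hζ, hb]
    · intros; rfl
  rw [← Finset.mul_sum] at this
  have h3 : (1 - ζ) * ∑ s ∈ univ.filter (fun s : F => s ^ (q + 1) = κ), s = 0 := by
    linear_combination this
  rcases mul_eq_zero.1 h3 with h | h
  · exact absurd (sub_eq_zero.1 h).symm hζ1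
  · exact h

/-- conclusion on one secant line, given a suitable `u`. -/
theorem final_line (D : FD F p q) (hq : 4 < q) {X : Finset V} {v w u : V}
    (R : CRep F q X) (hv : v ∉ X) (hw : R.lam v w = 0) (hn : nv F X v w = q + 1)
    (hU : ∀ a b : F, (a • v + b • w ∈ X ↔ R.mu u (a • v + b • w) (a • v + b • w) = 0)) :
    ∀ t : F, w + t • v ∈ X ↔ t ^ (q + 1) = R.mu v w w := by
  have H := R.mu_herm D u
  have hvv : R.mu u v v ≠ 0 := by
    intro h
    have := (hU 1 0).2 (by simpa using h)
    simp at this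
    exact hv this
  set e := R.mu u w v / R.mu u v v with he
  set y := w + (-e) • v with hy
  have hyv : R.mu u y v = 0 := by
    rw [hy, H.add, H.smul, he, neg_mul, div_mul_cancel₀ _ hvv, add_neg_cancel]
  have hvy : R.mu u v y = 0 := by rw [H.symm y v, hyv, zero_pow D.q_ne]
  set κ := - R.mu u y y / R.mu u v v with hκ
  have hA : ∀ t : F, w + t • v ∈ X ↔ (t + e) ^ (q + 1) = κ := by
    intro t
    have h1 := hU t 1
    rw [one_smul, add_comm (t • v)] at h1
    rw [h1]
    have h2 : w + t • v = y + (t + e) • v := by rw [hy, add_smul, neg_smul]; abel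
    rw [h2]
    clear_value y
    rw [H.add, H.add_right D, H.add_right D, H.smul, H.smul, H.smul_right, H.smul_right, hyv, hvy,
      hκ, eq_div_iff hvv, eq_neg_iff_add_eq_zero]
    ring_nf
  have hfib : (univ.filter (fun s : F => s ^ (q + 1) = κ)).card = q + 1 := by
    have hnn : (univ.filter (fun s : F => s ^ (q + 1) = κ)).card = nv F X v w := by
     unfold nv
     symm
     apply Finset.card_bij (fun t _ => t + e)
     · intro t ht
       simp at ht ⊢
       exact (hA t).1 ht
     · intro a _ b _ h; simpa using h
     · intro s hs
       simp at hs
       exact ⟨s - e, by simp only [mem_filter, mem_univ, true_and]; rw [hA]; simpa using hs, by ring⟩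
    rw [hnn, hn]
  have hmv : ∀ k : ℕ, mom F X v k w = ∑ s ∈ univ.filter (fun s : F => s ^ (q + 1) = κ), (s - e) ^ k := by
    intro k
    rw [mom_eq_sum]
    apply Finset.sum_bij (fun t _ => t + e)
    · intro t ht
      simp at ht ⊢
      exact (hA t).1 ht
    · intro a _ b _ h; simpa using h
    · intro s hs
      simp at hs
      exact ⟨s - e, by simp only [mem_filter, mem_univ, true_and]; rw [hA]; simpa using hs, by ring⟩
    · intro t _; simp
  have he0 : e = 0 := by
    have h1 := hmv 1
    rw [← R.lam_eq D, hw] at h1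
    simp only [pow_one] at h1
    rw [Finset.sum_sub_distrib, sum_norm_fibre_zero D, Finset.sum_const, hfib, nsmul_eq_mul] at h1
    push_cast at h1
    rw [D.cast_q] at h1
    linear_combination h1
  have hκ2 : R.mu v w w = κ := by
    rw [R.mu_self D (by omega), hmv, he0]
    simp only [sub_zero]
    have : ∀ s ∈ univ.filter (fun s : F => s ^ (q + 1) = κ), s ^ (q + 1) = κ := by
      intro s hs; simpa using hs
    rw [Finset.sum_congr rfl this, Finset.sum_const, hfib, nsmul_eq_mul]
    push_cast
    rw [D.cast_q]; ring
  intro t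
  rw [hA, he0, add_zero, hκ2]

theorem secant_line (D : FD F p q) (hq : 4 < q) {X : Finset V} (hX : IsCone F X) (R : CRep F q X)
    (star : ∀ v, v ∉ X → ∀ x, nv F X v x = 1 ∨ nv F X v x = q + 1)
    {v w z : V} (hv : v ∉ X) (hw : R.lam v w = 0) (hz : R.lam v z = 0)
    (hi : LinearIndependent F ![v, w])
    (hn : nv F X v w = q + 1)
    (hg : gz F X v w z < q ^ 3 + q) :
    ∀ t : F, w + t • v ∈ X ↔ t ^ (q + 1) = R.mu v w w := by
  have h2 := D.two_le
  have hs := sum_two_val D (fun c => nv F X v (z + c • w)) (fun c => star v hv _)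
  have hgz : ∑ c : F, nv F X v (z + c • w) = gz F X v w z := rfl
  rw [hgz] at hs
  have hτ : q ≤ (univ.filter (fun c : F => nv F X v (z + c • w) = 1)).card := by
    by_contra hlt
    have h3 : q * (univ.filter (fun c : F => nv F X v (z + c • w) = 1)).card ≤ q * (q - 1) :=
      Nat.mul_le_mul_left _ (by omega)
    obtain ⟨s, rfl⟩ : ∃ s, q = s + 1 := ⟨q - 1, by omega⟩
    simp only [Nat.add_sub_cancel] at h3
    nlinarith
  obtain ⟨hL, hτ2⟩ := lemL D hq hX R star hv hw hz hn hτ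
  rw [hτ2] at hs
  have hg3 : gz F X v w z + q = q ^ 3 := by nlinarith
  -- two points on the line
  have hc : 1 < (univ.filter (fun t : F => w + t • v ∈ X)).card := by
    have : (univ.filter (fun t : F => w + t • v ∈ X)).card = q + 1 := hn
    omega
  obtain ⟨t1, ht1, t2, ht2, h12⟩ := Finset.one_lt_card.1 hc
  simp at ht1 ht2
  obtain ⟨c1, hc1⟩ := exists_tangent D hX star ht1 (z := z) (by omega)
  obtain ⟨c2, hc2⟩ := exists_tangent D hX star ht2 (z := z) (by omega)
  have h12' : t1 - t2 ≠ 0 := sub_ne_zero.2 h12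
  set s := (c2 - c1) / (t1 - t2) with hsdef
  set P1 := w + t1 • v with hP1
  set P2 := w + t2 • v with hP2
  set u := z + c1 • v + s • P1 with hu
  have hu2 : u = z + c2 • v + s • P2 := by
    have hcc : c1 + s * t1 = c2 + s * t2 := by
      rw [hsdef]; field_simp; ring
    have e1 : u = z + s • w + (c1 + s * t1) • v := by
      rw [hu, hP1, add_smul, smul_add, smul_smul]; abel
    have e2 : z + c2 • v + s • P2 = z + s • w + (c2 + s * t2) • v := by
      rw [hP2, add_smul, smul_add, smul_smul]; abel
    rw [e1, e2, hcc]
  have huX : u ∉ X := hc1 s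
  have tang : ∀ (P : V) (c : F), P ∈ X → (∀ s' : F, z + c • v + s' • P ∉ X) → u = z + c • v + s • P →
      ∀ t : F, P + t • u ∈ X ↔ t = 0 := by
    intro P c hP hno hu' t
    constructor
    · intro ht
      by_contra ht0
      apply hno (s + t⁻¹)
      rw [← hX.smul_iff ht0]
      have : t • (z + c • v + (s + t⁻¹) • P) = P + t • u := by
        rw [hu', add_smul, ← add_assoc, smul_add t _ (t⁻¹ • P), smul_smul, mul_inv_cancel₀ ht0, one_smul]
        abel
      rw [this]; exact ht
    · rintro rfl; simpa using hP
  have hT1 := tang P1 c1 ht1 hc1 hu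
  have hT2 := tang P2 c2 ht2 hc2 hu2
  have hl1 : R.lam u P1 = 0 := by rw [R.lam_eq D]; exact single_mom hT1 one_ne_zero
  have hl2 : R.lam u P2 = 0 := by rw [R.lam_eq D]; exact single_mom hT2 one_ne_zero
  have hlv : R.lam u v = 0 := by
    have : P1 - P2 = (t1 - t2) • v := by rw [hP1, hP2, sub_smul]; abel
    have h := congrArg (R.lam u) this
    rw [map_sub, hl1, hl2, map_smul, smul_eq_mul, sub_zero] at h
    exact (mul_eq_zero.1 h.symm).resolve_left h12'
  have hlw : R.lam u w = 0 := by
    have h := hl1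
    rw [hP1, map_add, map_smul, hlv, smul_zero, add_zero] at h
    exact h
  have hl : ∀ a b : F, R.lam u (a • v + b • w) = 0 := by
    intro a b; rw [map_add, map_smul, map_smul, hlv, hlw]; simp
  -- counting over U
  have hcount : ∑ a : F, ∑ b : F, nv F X u (a • v + b • w) = 1 + (q ^ 2 - 1) * (q ^ 3 + 1) := by
    have e1 : ∀ a b : F, nv F X u (a • v + b • w)
        = ∑ t : F, if a • v + b • w + t • u ∈ X then 1 else 0 := by
      intro a b; unfold nv; rw [Finset.card_filter]
    simp_rw [e1]
    have e2 : ∑ a : F, ∑ b : F, ∑ t : F, (if a • v + b • w + t • u ∈ X then 1 else 0)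
        = ∑ t : F, ∑ a : F, ∑ b : F, (if a • v + b • w + t • u ∈ X then 1 else 0) := by
      rw [Finset.sum_comm' (t' := univ) (s' := fun _ => univ) (by simp)]
      have : ∀ b : F, ∑ a : F, ∑ t : F, (if a • v + b • w + t • u ∈ X then 1 else 0)
        = ∑ t : F, ∑ a : F, (if a • v + b • w + t • u ∈ X then 1 else 0) := fun b => Finset.sum_comm
      simp_rw [this]
      rw [Finset.sum_comm]
      apply Finset.sum_congr rfl; intro t _
      rw [Finset.sum_comm]
    rw [e2, ← Finset.add_sum_erase _ _ (mem_univ (0 : F))]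
    have e3 : ∑ a : F, ∑ b : F, (if a • v + b • w + (0 : F) • u ∈ X then 1 else 0)
        = 1 + (q ^ 2 - 1) * (q + 1) := by
      have h := gz_mem D hX hv (z := 0) (Submodule.zero_mem (Submodule.span F {v, w}))
      rw [hn, gz_eq_sum] at h
      rw [← h, Finset.sum_comm]
      apply Finset.sum_congr rfl; intro b _
      apply Finset.sum_congr rfl; intro a _
      have : a • v + b • w + (0 : F) • u = 0 + b • w + a • v := by rw [zero_smul]; abel
      rw [this]
    have e4 : ∀ t ∈ (univ : Finset F).erase 0,
        ∑ a : F, ∑ b : F, (if a • v + b • w + t • u ∈ X then 1 else 0) = gz F X v w z := by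
      intro t ht
      have ht0 : t ≠ 0 := by simpa using ht
      have e1 : u = z + s • w + (c1 + s * t1) • v := by
        rw [hu, hP1, add_smul, smul_add, smul_smul]; abel
      rw [gz_eq_sum, Finset.sum_comm]
      apply Fintype.sum_equiv ((Equiv.mulLeft₀ t⁻¹ (inv_ne_zero ht0)).trans (Equiv.addRight s))
      intro b
      apply Fintype.sum_equiv ((Equiv.mulLeft₀ t⁻¹ (inv_ne_zero ht0)).trans (Equiv.addRight (c1 + s * t1)))
      intro a
      simp only [Equiv.trans_apply, Equiv.coe_addRight]
      have e5 : a • v + b • w + t • u = t • (z + (t⁻¹ * b + s) • w + (t⁻¹ * a + (c1 + s * t1)) • v) := by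
        rw [e1]
        simp only [smul_add, smul_smul, mul_add, add_smul, mul_inv_cancel_left₀ ht0]
        abel
      rw [e5]
      simp only [hX.smul_iff ht0]
      rfl
    rw [e3, Finset.sum_congr rfl e4, Finset.sum_const, Finset.card_erase_of_mem (mem_univ _),
      Finset.card_univ, D.hF, smul_eq_mul, add_assoc, ← mul_add]
    congr 2
    omega
  -- find a nontangent point
  have hsumspan : ∑ y ∈ univ.filter (fun y : V => y ∈ Submodule.span F {v, w}), nv F X u y
      = 1 + (q ^ 2 - 1) * (q ^ 3 + 1) := by rw [sum_span_pair hi, hcount]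
  have hnt : ∃ w' ∈ Submodule.span F {v, w}, nv F X u w' = q + 1 := by
    by_contra hno
    push Not at hno
    have : ∑ y ∈ univ.filter (fun y : V => y ∈ Submodule.span F {v, w}), nv F X u y = q ^ 4 := by
      rw [← card_span_pair D hi, Finset.card_eq_sum_ones]
      apply Finset.sum_congr rfl
      intro y hy
      exact (star u huX y).resolve_right (hno y (by simpa using hy))
    rw [this] at hsumspan
    have h5 : q ^ 2 = (q ^ 2 - 1) + 1 := by have := D.one_lt_Q; omega
    have h6 : q ^ 4 = (q ^ 2 - 1) * (q ^ 2 - 1) + 2 * (q ^ 2 - 1) + 1 := by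
      have : q ^ 4 = q ^ 2 * q ^ 2 := by ring
      rw [this]
      nth_rewrite 1 2 [h5]
      ring
    rw [h6] at hsumspan
    have h7 : (q ^ 2 - 1) * ((q ^ 2 - 1) + 2) = (q ^ 2 - 1) * (q ^ 3 + 1) := by linarith
    have h8 : 0 < q ^ 2 - 1 := by have := D.one_lt_Q; omega
    have h9 := Nat.eq_of_mul_eq_mul_left h8 h7
    have h10 : q ^ 2 = q ^ 3 := by omega
    have h11 : q ^ 3 = q * q ^ 2 := by ring
    nlinarith
  obtain ⟨w', hw'U, hw'n⟩ := hnt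
  have hP1U : P1 ∈ Submodule.span F {v, w} := Submodule.mem_span_pair.2 ⟨t1, 1, by rw [hP1, one_smul]; abel⟩
  have hn1 : nv F X u P1 = 1 := by
    unfold nv
    rw [Finset.card_eq_one]
    exact ⟨0, by ext t; simp [hT1 t]⟩
  have hP1ne : P1 ≠ 0 := by
    intro h0
    rw [LinearIndependent.pair_iff] at hi
    have := hi t1 1 (by rw [one_smul, add_comm]; exact h0)
    exact one_ne_zero this.2
  have hi' : LinearIndependent F ![P1, w'] := by
    rw [LinearIndependent.pair_iff' hP1ne]
    intro a ha
    rw [← ha] at hw'n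
    by_cases ha0 : a = 0
    · rw [ha0, zero_smul, nv_zero hX huX] at hw'n; omega
    · rw [nv_smul hX u ha0, hn1] at hw'n; omega
  have hspan : Submodule.span F {P1, w'} = Submodule.span F {v, w} := by
    apply Submodule.eq_of_le_of_finrank_eq
    · rw [Submodule.span_le]
      rintro x (rfl | rfl)
      · exact hP1U
      · exact hw'U
    · have h1 := finrank_span_eq_card hi
      have h2 := finrank_span_eq_card hi'
      have r1 : Set.range ![v, w] = {v, w} := by simp [Set.pair_comm]
      have r2 : Set.range ![P1, w'] = {P1, w'} := by simp [Set.pair_comm]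
      rw [r1] at h1; rw [r2] at h2
      rw [h1, h2]
  have hsum2 : ∑ a : F, ∑ b : F, nv F X u (a • P1 + b • w') = 1 + (q ^ 2 - 1) * (q ^ 3 + 1) := by
    rw [← sum_span_pair hi', hspan, hsumspan]
  have hh := sum_hom D (fun y => nv F X u y) (fun c hc y => nv_smul hX u hc y) P1 w'
  rw [hsum2, nv_zero hX huX, hw'n] at hh
  have h8 : 0 < q ^ 2 - 1 := by have := D.one_lt_Q; omega
  have hgg : q ^ 3 + 1 = q + 1 + ∑ c : F, nv F X u (P1 + c • w') := by
    have := Nat.add_left_cancel hh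
    simp only [Nat.cast_id] at this
    exact Nat.eq_of_mul_eq_mul_left h8 this
  have hs' := sum_two_val D (fun c => nv F X u (P1 + c • w')) (fun c => star u huX _)
  have hτ' : q ≤ (univ.filter (fun c : F => nv F X u (P1 + c • w') = 1)).card := by
    by_contra hlt
    have h3 : q * (univ.filter (fun c : F => nv F X u (P1 + c • w') = 1)).card ≤ q * (q - 1) :=
      Nat.mul_le_mul_left _ (by omega)
    obtain ⟨s, rfl⟩ : ∃ s, q = s + 1 := ⟨q - 1, by omega⟩
    simp only [Nat.add_sub_cancel] at h3
    nlinarith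
  have hlw' : R.lam u w' = 0 := by
    obtain ⟨a, b, rfl⟩ := Submodule.mem_span_pair.1 hw'U
    exact hl a b
  obtain ⟨hL', -⟩ := lemL D hq hX R star huX hlw' hl1 hw'n hτ'
  apply final_line D hq R hv hw hn (u := u)
  intro a b
  have hmem : a • v + b • w ∈ Submodule.span F {P1, w'} := by
    rw [hspan]; exact Submodule.mem_span_pair.2 ⟨a, b, rfl⟩
  obtain ⟨a', b', h'⟩ := Submodule.mem_span_pair.1 hmem
  rw [← h', add_comm]
  exact hL' b' a'

end EMain

open Module Matrix

section EFinal
open scoped Classical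
open Finset

variable {F : Type} [Field F] [Fintype F] {p q : ℕ}
variable {V : Type} [AddCommGroup V] [Module F V] [Fintype V]

theorem gz_shift (X : Finset V) (v w z : V) (c : F) : gz F X v w (z + c • v) = gz F X v w z := by
  unfold gz
  apply Finset.sum_congr rfl
  intro a _
  have : z + c • v + a • w = (z + a • w) + c • v := by abel
  rw [this, nv_shift]

theorem final_E (D : FD F p q) (hq : 4 < q) {X : Finset V} (hX : IsCone F X) (R : CRep F q X)
    (star : ∀ v, v ∉ X → ∀ x, nv F X v x = 1 ∨ nv F X v x = q + 1)
    {M : ℕ} (hM : 1 ≤ M) (hV : Fintype.card V = q ^ 4 * M) (hXc : X.card ≤ M * q ^ 3 + M)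
    (hne : ∃ v, v ∉ X) :
    ∃ H : V → V → F, IsHerm F q H ∧ ∀ x, x ∈ X ↔ H x x = 0 := by
  obtain ⟨v, hv⟩ := hne
  have hlv := R.lam_self D hX hv
  have key : ∀ w, R.lam v w = 0 → ∀ t : F, w + t • v ∈ X ↔ t ^ (q + 1) = R.mu v w w := by
    intro w hw
    rcases star v hv w with h1 | h1
    · have hl : mom F X v 1 w = 0 := by rw [← R.lam_eq D, hw]
      have hs := single_line h1 hl
      intro t
      rw [hs, R.mu_self D (by omega), single_mom hs (by omega)]
      constructor
      · rintro rfl; exact zero_pow (by omega)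
      · intro h; exact pow_eq_zero_iff (by omega) |>.1 h
    · have hi : LinearIndependent F ![v, w] := by
        have hv0 : v ≠ 0 := by rintro rfl; exact hv hX.zero
        rw [LinearIndependent.pair_iff' hv0]
        intro a ha
        rw [← ha, map_smul, hlv] at hw
        have ha0 : a = 0 := by simpa using hw
        rw [← ha, ha0, zero_smul, nv_zero hX hv] at h1
        omega
      obtain ⟨z, -, hz⟩ := exists_below D hX hv hi (q ^ 3 + q) (by
        rw [h1, hV]
        obtain ⟨M', rfl⟩ : ∃ M', M = M' + 1 := ⟨M - 1, by omega⟩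
        have e1 : q ^ 4 * (M' + 1) - q ^ 4 = q ^ 4 * M' := by rw [mul_add, mul_one]; omega
        rw [e1]
        have e2 : q ^ 4 * X.card ≤ q ^ 4 * ((M' + 1) * q ^ 3 + (M' + 1)) := Nat.mul_le_mul_left _ hXc
        refine lt_of_le_of_lt e2 ?_
        rw [mul_assoc, ← mul_add]
        apply Nat.mul_lt_mul_of_pos_left _ (by positivity)
        obtain ⟨s, rfl⟩ : ∃ s, q = s + 5 := ⟨q - 5, by omega⟩
        have e3 : (s + 5) ^ 2 - 1 = s ^ 2 + 10 * s + 24 := by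
          have : (s + 5) ^ 2 = s ^ 2 + 10 * s + 24 + 1 := by ring
          omega
        rw [e3]
        ring_nf
        nlinarith [Nat.zero_le (M' * s), Nat.zero_le s])
      apply secant_line D hq hX R star hv hw (z := z + R.lam v z • v) _ hi h1
      · rwa [gz_shift]
      · rw [map_add, map_smul, hlv]; simp
  have hm := R.mu_herm D v
  let π : V → V := fun x => x + R.lam v x • v
  have πadd : ∀ x y, π (x + y) = π x + π y := by
    intro x y; simp only [π, map_add, add_smul]; abel
  have πsmul : ∀ (c : F) x, π (c • x) = c • π x := by
    intro c x; simp only [π, map_smul, smul_eq_mul, smul_add, smul_smul]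
  refine ⟨fun x y => R.lam v x * (R.lam v y) ^ q - R.mu v (π x) (π y), ⟨?_, ?_, ?_⟩, ?_⟩
  · intro x y z
    simp only [πadd, map_add, hm.add]; ring
  · intro c x z
    simp only [πsmul, map_smul, hm.smul, smul_eq_mul]; ring
  · intro x y
    beta_reduce
    rw [D.sub_pow, mul_pow, D.pow_pow, ← hm.symm]; ring
  · intro x
    have hπ : R.lam v (π x) = 0 := by simp only [π, map_add, map_smul, hlv]; simp
    have := key (π x) hπ (-(R.lam v x))
    have e : π x + (-(R.lam v x)) • v = x := by simp only [π, neg_smul]; abel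
    rw [e] at this
    rw [this, sub_eq_zero, pow_succ, D.neg_pow]
    constructor
    · intro h; rw [← h]; ring
    · intro h; rw [← h]; ring

end EFinal

open Module Matrix

section Transl
open scoped Classical
open Finset

variable {F : Type} [Field F] [Fintype F] {p q n : ℕ}

noncomputable instance instFintypeProjPoint : Fintype (ProjPoint F n) := by
  unfold ProjPoint
  exact Fintype.ofFinite _

def ptOf {x : Fin n → F} (hx : x ≠ 0) : ProjPoint F n :=
  ⟨Submodule.span F {x}, finrank_span_singleton hx⟩

theorem eq_ptOf {x : Fin n → F} (hx : x ≠ 0) {P : ProjPoint F n} (h : x ∈ P.1) : P = ptOf hx := by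
  apply Subtype.ext
  symm
  apply Submodule.eq_of_le_of_finrank_eq
  · simpa [ptOf, Submodule.span_le] using h
  · rw [P.2]; exact (ptOf hx).2

theorem mem_ptOf {x : Fin n → F} (hx : x ≠ 0) : x ∈ (ptOf hx).1 := Submodule.mem_span_singleton_self x

theorem exists_rep (P : ProjPoint F n) : ∃ x : Fin n → F, x ≠ 0 ∧ x ∈ P.1 := by
  have h := P.2
  have : P.1 ≠ ⊥ := by
    intro h0
    rw [h0, finrank_bot] at h
    omega
  obtain ⟨x, hx, h0⟩ := Submodule.exists_mem_ne_zero_of_ne_bot this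
  exact ⟨x, h0, hx⟩

noncomputable def coneOf (S : Set (ProjPoint F n)) : Finset (Fin n → F) :=
  univ.filter (fun x => x = 0 ∨ ∃ P ∈ S, x ∈ P.1)

theorem mem_coneOf {S : Set (ProjPoint F n)} {x : Fin n → F} (hx : x ≠ 0) :
    x ∈ coneOf S ↔ ptOf hx ∈ S := by
  simp only [coneOf, mem_filter, mem_univ, true_and, hx, false_or]
  constructor
  · rintro ⟨P, hP, hxP⟩
    rwa [← eq_ptOf hx hxP]
  · intro h; exact ⟨_, h, mem_ptOf hx⟩

theorem mem_coneOf' {S : Set (ProjPoint F n)} {x : Fin n → F} (hx : x ≠ 0) {P : ProjPoint F n}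
    (hP : x ∈ P.1) : x ∈ coneOf S ↔ P ∈ S := by
  rw [mem_coneOf hx, eq_ptOf hx hP]

theorem coneOf_isCone (S : Set (ProjPoint F n)) : IsCone F (coneOf S) := by
  constructor
  · simp [coneOf]
  · intro c x hx
    simp only [coneOf, mem_filter, mem_univ, true_and] at hx ⊢
    rcases hx with rfl | ⟨P, hP, hx⟩
    · left; simp
    · right; exact ⟨P, hP, P.1.smul_mem c hx⟩

theorem card_coneOf (D : FD F p q) (S : Set (ProjPoint F n)) (W : Submodule F (Fin n → F)) :
    ((coneOf S).filter (fun x => x ∈ W)).card = 1 + (q ^ 2 - 1) * secant F n S W := by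
  have h1 : (coneOf S).filter (fun x => x ∈ W) = insert 0
      ((univ.filter (fun P : ProjPoint F n => P ∈ S ∩ pointsIn F n W)).biUnion
        (fun P => univ.filter (fun x : Fin n → F => x ∈ P.1 ∧ x ≠ 0))) := by
    ext x
    by_cases hx : x = 0
    · subst hx; simp [(coneOf_isCone S).zero]
    · simp only [mem_filter, mem_insert, hx, false_or, mem_biUnion, mem_univ, true_and]
      rw [mem_coneOf hx]
      constructor
      · rintro ⟨h1, h2⟩
        refine ⟨ptOf hx, ⟨h1, ?_⟩, mem_ptOf hx, by simp [hx]⟩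
        change Submodule.span F {x} ≤ W
        rwa [Submodule.span_singleton_le_iff_mem]
      · rintro ⟨P, ⟨hP, hPW⟩, hxP, -⟩
        rw [← eq_ptOf hx hxP]
        exact ⟨hP, hPW hxP⟩
  rw [h1, Finset.card_insert_of_notMem (by simp), Finset.card_biUnion]
  · have h2 : ∀ P ∈ univ.filter (fun P : ProjPoint F n => P ∈ S ∩ pointsIn F n W),
        (univ.filter (fun x : Fin n → F => x ∈ P.1 ∧ x ≠ 0)).card = q ^ 2 - 1 := by
      intro P _
      have h3 : univ.filter (fun x : Fin n → F => x ∈ P.1 ∧ x ≠ 0)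
          = (univ.filter (fun x : Fin n → F => x ∈ P.1)).erase 0 := by
        ext x; simp [and_comm]
      rw [h3, Finset.card_erase_of_mem (by simp), D.card_sub, P.2]
    rw [Finset.sum_congr rfl h2, Finset.sum_const, smul_eq_mul, secant, Set.ncard_eq_toFinset_card']
    rw [add_comm, mul_comm]
    congr 3
    ext P; simp
  · intro P _ P' _ hne
    rw [Function.onFun, Finset.disjoint_left]
    intro x hx hx'
    simp only [mem_filter, mem_univ, true_and] at hx hx'
    exact hne ((eq_ptOf hx.2 hx.1).trans (eq_ptOf hx.2 hx'.1).symm)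

theorem card_coneOf_univ (D : FD F p q) (S : Set (ProjPoint F n)) :
    (coneOf S).card = 1 + (q ^ 2 - 1) * S.ncard := by
  have := card_coneOf D S ⊤
  simp only [Submodule.mem_top, Finset.filter_true] at this
  rw [this]
  unfold secant
  congr 3
  ext P; simp [pointsIn]

/-- The sesquilinear form of a matrix. -/
def Hf (q : ℕ) (A : Matrix (Fin n) (Fin n) F) (x y : Fin n → F) : F :=
  ∑ i, ∑ j, x i * A i j * (y j) ^ q

theorem Hf_herm (D : FD F p q) {A : Matrix (Fin n) (Fin n) F} (hA : Aᵀ = A.map (fun a => a ^ q)) :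
    IsHerm F q (Hf q A) := by
  constructor
  · intro x y z
    simp only [Hf, ← Finset.sum_add_distrib, Pi.add_apply]
    refine Finset.sum_congr rfl fun i _ => Finset.sum_congr rfl fun j _ => ?_
    ring
  · intro c x z
    simp only [Hf, Finset.mul_sum, Pi.smul_apply, smul_eq_mul]
    refine Finset.sum_congr rfl fun i _ => Finset.sum_congr rfl fun j _ => ?_
    ring
  · intro x y
    simp only [Hf]
    rw [D.sum_pow, Finset.sum_comm]
    refine Finset.sum_congr rfl fun i _ => ?_
    rw [D.sum_pow]
    refine Finset.sum_congr rfl fun j _ => ?_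
    rw [mul_pow, mul_pow, D.pow_pow]
    have : A j i = A i j ^ q := by
      have := congrFun (congrFun hA i) j
      simpa using this
    rw [this]; ring

theorem Hf_eq_cone (D : FD F p q) {A : Matrix (Fin n) (Fin n) F} (hA : Aᵀ = A.map (fun a => a ^ q))
    (S : Set (ProjPoint F n)) :
    S = hermSet F q n A ↔ ∀ x, x ∈ coneOf S ↔ Hf q A x x = 0 := by
  have hH := Hf_herm D hA
  have key : ∀ (P : ProjPoint F n) x, x ≠ 0 → x ∈ P.1 → (P ∈ hermSet F q n A ↔ Hf q A x x = 0) := by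
    intro P x hx hxP
    constructor
    · intro h; exact h x hxP
    · intro h y hy
      rw [eq_ptOf hx hxP] at hy
      obtain ⟨c, rfl⟩ := Submodule.mem_span_singleton.1 hy
      change Hf q A (c • x) (c • x) = 0
      rw [hH.smul, hH.smul_right, h]; ring
  constructor
  · rintro rfl x
    by_cases hx : x = 0
    · subst hx; simp [(coneOf_isCone _).zero, hH.zero_left]
    · rw [mem_coneOf hx, key _ x hx (mem_ptOf hx)]
  · intro h
    ext P
    obtain ⟨x, hx, hxP⟩ := exists_rep P
    rw [key P x hx hxP, ← h, mem_coneOf' hx hxP]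

theorem Hf_rad (D : FD F p q) {A : Matrix (Fin n) (Fin n) F} (hA : Aᵀ = A.map (fun a => a ^ q)) :
    (Hf_herm D hA).rad ⊤ = LinearMap.ker (Matrix.toLin' Aᵀ) := by
  ext x
  have e : ∀ y, Hf q A x y = ∑ j, (Aᵀ *ᵥ x) j * (y j) ^ q := by
    intro y
    simp only [Hf, Matrix.mulVec, dotProduct, Matrix.transpose_apply, Finset.sum_mul]
    rw [Finset.sum_comm]
    refine Finset.sum_congr rfl fun i _ => Finset.sum_congr rfl fun j _ => ?_
    ring
  change (x ∈ (⊤ : Submodule F (Fin n → F)) ∧ ∀ y ∈ (⊤ : Submodule F (Fin n → F)), Hf q A x y = 0) ↔ _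
  simp only [Submodule.mem_top, true_and, forall_const, LinearMap.mem_ker, Matrix.toLin'_apply]
  constructor
  · intro h
    ext j
    have := h (Pi.single j 1)
    rw [e] at this
    simpa [Pi.single_apply, ite_pow, zero_pow D.q_ne] using this
  · intro h y
    rw [e, h]; simp

/-- Matrix of a Hermitian form. -/
theorem exists_matrix (D : FD F p q) {H : (Fin n → F) → (Fin n → F) → F} (hH : IsHerm F q H) :
    ∃ A : Matrix (Fin n) (Fin n) F, Aᵀ = A.map (fun a => a ^ q) ∧ ∀ x y, H x y = Hf q A x y := by
  refine ⟨Matrix.of fun i j => H (Pi.single i 1) (Pi.single j 1), ?_, ?_⟩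
  · ext i j
    simp only [Matrix.transpose_apply, Matrix.map_apply, Matrix.of_apply]
    exact hH.symm _ _
  · intro x y
    have sumL : ∀ (s : Finset (Fin n)) (f : Fin n → (Fin n → F)) z, H (∑ i ∈ s, f i) z = ∑ i ∈ s, H (f i) z := by
      intro s f z
      induction s using Finset.induction_on with
      | empty => simp [hH.zero_left]
      | insert a s ha ih => rw [Finset.sum_insert ha, Finset.sum_insert ha, hH.add, ih]
    have sumR : ∀ (s : Finset (Fin n)) (f : Fin n → (Fin n → F)) z, H z (∑ i ∈ s, f i) = ∑ i ∈ s, H z (f i) := by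
      intro s f z
      induction s using Finset.induction_on with
      | empty => simp [hH.zero_right D]
      | insert a s ha ih => rw [Finset.sum_insert ha, Finset.sum_insert ha, hH.add_right D, ih]
    have ex : ∀ x : Fin n → F, x = ∑ i, x i • Pi.single i (1 : F) := by
      intro x
      ext j
      simp [Finset.sum_apply, Pi.single_apply]
    conv_lhs => rw [ex x, ex y, sumL]
    unfold Hf
    refine Finset.sum_congr rfl fun i _ => ?_
    rw [sumR]
    refine Finset.sum_congr rfl fun j _ => ?_
    rw [hH.smul, hH.smul_right, Matrix.of_apply]; ring

end Transl

open Module Matrix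

section Transl2
open scoped Classical
open Finset

variable {F : Type} [Field F] [Fintype F] {p q n : ℕ}

theorem IsHerm.rad_hyp {V : Type} [AddCommGroup V] [Module F V] [Fintype V] (D : FD F p q)
    {H : V → V → F} (h : IsHerm F q H) {U : Submodule F V}
    (hU : finrank F U + 1 = finrank F V) :
    finrank F (h.rad ⊤) ≤ finrank F (h.rad U) + 1 ∧ finrank F (h.rad U) ≤ finrank F (h.rad ⊤) + 1 := by
  let K := h.rad ⊤ ⊓ U
  have h1 : K ≤ h.rad U := by
    rintro x ⟨hx, hxU⟩
    exact ⟨hxU, fun y _ => hx.2 y trivial⟩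
  have h2 := Submodule.finrank_sup_add_finrank_inf_eq (h.rad ⊤) U
  have h3 := Submodule.finrank_le (h.rad ⊤ ⊔ U)
  have h4 := Submodule.finrank_mono h1
  have h5 : finrank F K ≤ finrank F (h.rad ⊤) := Submodule.finrank_mono inf_le_left
  have hne : U ≠ ⊤ := by
    rintro rfl
    rw [finrank_top] at hU; omega
  obtain ⟨w, hw⟩ : ∃ w, w ∉ U := by
    by_contra hc
    push Not at hc
    exact hne (by ext x; simp [hc x])
  have hsup : U ⊔ Submodule.span F {w} = ⊤ := by
    apply Submodule.eq_top_of_finrank_eq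
    apply le_antisymm (Submodule.finrank_le _)
    have : U < U ⊔ Submodule.span F {w} := by
      apply lt_of_le_of_ne le_sup_left
      intro he
      apply hw
      rw [he]
      exact Submodule.mem_sup_right (Submodule.mem_span_singleton_self w)
    have := Submodule.finrank_lt_finrank_of_lt this
    omega
  let g : h.rad U →ₗ[F] F :=
    { toFun := fun x => H x.1 w
      map_add' := fun x y => h.add _ _ _
      map_smul' := fun c x => h.smul _ _ _ }
  have h6 := LinearMap.finrank_range_add_finrank_ker g
  have h7 : finrank F (LinearMap.range g) ≤ 1 := by
    have := Submodule.finrank_le (LinearMap.range g)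
    simpa using this
  have h8 : (LinearMap.ker g).map (h.rad U).subtype ≤ K := by
    rintro x ⟨y, hy, rfl⟩
    have hy' : H y.1 w = 0 := hy
    refine ⟨⟨trivial, fun z _ => ?_⟩, y.2.1⟩
    have hz : z ∈ U ⊔ Submodule.span F {w} := by rw [hsup]; trivial
    obtain ⟨u, hu, s, hs, rfl⟩ := Submodule.mem_sup.1 hz
    obtain ⟨c, rfl⟩ := Submodule.mem_span_singleton.1 hs
    rw [h.add_right D, h.smul_right]
    simp only [Submodule.subtype_apply]
    rw [hy', y.2.2 u hu]; simp
  have h9 := Submodule.finrank_mono h8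
  rw [Submodule.finrank_map_subtype_eq] at h9
  have hKK : finrank F K = finrank F ↥(h.rad ⊤ ⊓ U) := rfl
  constructor <;> omega

/-- dot product as a linear map -/
def dotL (a : Fin n → F) : (Fin n → F) →ₗ[F] F where
  toFun x := a ⬝ᵥ x
  map_add' x y := dotProduct_add a x y
  map_smul' c x := dotProduct_smul c a x

theorem dotL_ne {a : Fin n → F} (ha : a ≠ 0) : dotL a ≠ 0 := by
  intro h
  apply ha
  ext i
  have := LinearMap.congr_fun h (Pi.single i 1)
  simpa [dotL] using this

theorem finrank_ker_dotL {a : Fin n → F} (ha : a ≠ 0) : finrank F (LinearMap.ker (dotL a)) + 1 = n := by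
  have := Module.Dual.finrank_ker_add_one_of_ne_zero (dotL_ne ha)
  simpa using this

theorem exists_dotL {W : Submodule F (Fin n → F)} (hn : 1 ≤ n) (hW : finrank F W = n - 1) :
    ∃ a : Fin n → F, a ≠ 0 ∧ W = LinearMap.ker (dotL a) := by
  have hlt : W < ⊤ := by
    rw [lt_top_iff_ne_top]
    rintro rfl
    rw [finrank_top] at hW
    simp at hW; omega
  obtain ⟨f, hf, hle⟩ := Submodule.exists_le_ker_of_lt_top W hlt
  have hfa : f = dotL (fun i => f (Pi.single i 1)) := by
    apply LinearMap.pi_ext'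
    intro i
    ext
    simp [dotL]
  have ha : (fun i => f (Pi.single i 1)) ≠ 0 := by
    intro h0
    apply hf
    rw [hfa, h0]
    ext; simp [dotL]
  refine ⟨_, ha, ?_⟩
  rw [← hfa]
  apply Submodule.eq_of_le_of_finrank_eq hle
  have := Module.Dual.finrank_ker_add_one_of_ne_zero hf
  simp at this
  omega

/-- All numerical data we need about the cone over a quasi-Hermitian variety. -/
structure QData (F : Type) [Field F] [Fintype F] (q r d : ℕ) (X : Finset (Fin (r + 1) → F)) : Prop where
  cone : IsCone F X
  card : (q : ℤ) * X.card = (q : ℤ) ^ (2 * (r + 1)) + (-1) ^ (r + d) * ((q : ℤ) - 1) * q ^ (r + d + 2)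
  sec : ∀ a : Fin (r + 1) → F, a ≠ 0 → ∃ e : ℕ, e ≤ 2 ∧
    (q : ℤ) * (X.filter (fun x => a ⬝ᵥ x = 0)).card
      = (q : ℤ) ^ (2 * r) + (-1) ^ (r + d + e) * ((q : ℤ) - 1) * q ^ (r + d + e)

theorem QData.of_herm (D : FD F p q) {r d : ℕ} {H : (Fin (r + 1) → F) → (Fin (r + 1) → F) → F}
    (h : IsHerm F q H) (hd : finrank F (h.rad ⊤) = d + 1) :
    QData F q r d (univ.filter (fun x => H x x = 0)) := by
  refine ⟨h.isCone, ?_, ?_⟩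
  · have := h.count D (r + 1) ⊤ (by simp)
    simp only [Submodule.mem_top, true_and] at this
    rw [this, hd]
    ring
  · intro a ha
    have h1 := finrank_ker_dotL ha
    have h2 := h.rad_hyp D (U := LinearMap.ker (dotL a)) (by simpa using h1)
    rw [hd] at h2
    have h3 := h.count D r (LinearMap.ker (dotL a)) (by omega)
    refine ⟨finrank F (h.rad (LinearMap.ker (dotL a))) - d, by omega, ?_⟩
    have e : r + d + (finrank F (h.rad (LinearMap.ker (dotL a))) - d) = r + finrank F (h.rad (LinearMap.ker (dotL a))) := by
      omega
    rw [e, ← h3, Finset.filter_filter]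
    congr 4
    ext x
    rw [and_comm]; rfl

theorem QData.of_quasi (D : FD F p q) {r d : ℕ} {S : Set (ProjPoint F (r + 1))}
    (hS : IsSingularQuasiHermitian F q r d S) : QData F q r d (coneOf S) := by
  obtain ⟨S₀, ⟨A, hA, hd, hS₀⟩, hc, hs⟩ := hS
  rw [← Hf_rad D hA] at hd
  have h0 := QData.of_herm D (Hf_herm D hA) hd
  have hX0 : coneOf S₀ = univ.filter (fun x => Hf q A x x = 0) := by
    ext x
    rw [(Hf_eq_cone D hA S₀).1 hS₀]; simp
  rw [← hX0] at h0
  refine ⟨coneOf_isCone S, ?_, ?_⟩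
  · rw [← h0.card, card_coneOf_univ D, card_coneOf_univ D, hc]
  · intro a ha
    have hr : finrank F (LinearMap.ker (dotL a)) = r := by have := finrank_ker_dotL ha; omega
    obtain ⟨W, hW, he⟩ := hs (LinearMap.ker (dotL a)) hr
    obtain ⟨b, hb, rfl⟩ := exists_dotL (by omega) (W := W) (by simpa using hW)
    obtain ⟨e, he2, h⟩ := h0.sec b hb
    refine ⟨e, he2, ?_⟩
    rw [← h]
    have h1 := card_coneOf D S (LinearMap.ker (dotL a))
    have h2 := card_coneOf D S₀ (LinearMap.ker (dotL b))
    rw [he, ← h2] at h1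
    congr 2

theorem QData.Tcount_eq' (D : FD F p q) {r d : ℕ} {X Y : Finset (Fin (r + 1) → F)}
    (hX : QData F q r d X) (hY : QData F q r d Y) : Zsum F q X = Zsum F q Y := by
  have hq0 : (q : ℤ) ≠ 0 := by exact_mod_cast D.q_ne
  have hc : X.card = Y.card := by
    have := hX.card.trans hY.card.symm
    have := mul_left_cancel₀ hq0 this
    exact_mod_cast this
  have hb : ∀ Z : Finset (Fin (r + 1) → F), QData F q r d Z → ∀ a : Fin (r + 1) → F, a ≠ 0 →
      ∃ i : Fin 3, (Z.filter (fun x => a ⬝ᵥ x = 0)).card =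
        (((q : ℤ) ^ (2 * r) + (-1) ^ (r + d + i.1) * ((q : ℤ) - 1) * q ^ (r + d + i.1)) / q).toNat := by
    intro Z hZ a ha
    obtain ⟨e, he, h⟩ := hZ.sec a ha
    refine ⟨⟨e, by omega⟩, ?_⟩
    simp only
    rw [← h, Int.mul_ediv_cancel_left _ hq0, Int.toNat_natCast]
  rw [Zsum_eq D hX.cone, Zsum_eq D hY.cone, hc, Tcount_eq D hX.cone hY.cone hc _ (hb X hX) (hb Y hY)]

theorem QData.Zsum_zero (D : FD F p q) {r d : ℕ} {S : Set (ProjPoint F (r + 1))}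
    (hS : IsSingularQuasiHermitian F q r d S) : Zsum F q (coneOf S) = 0 := by
  have h1 := QData.of_quasi D hS
  obtain ⟨S₀, ⟨A, hA, hd, hS₀⟩, hc, hs⟩ := hS
  rw [← Hf_rad D hA] at hd
  have h0 := QData.of_herm D (Hf_herm D hA) hd
  rw [h1.Tcount_eq' D h0, (Hf_herm D hA).Zsum_zero D]

theorem QData.dvd_card (D : FD F p q) {r d : ℕ} {X : Finset (Fin (r + 1) → F)}
    (hX : QData F q r d X) : q ∣ X.card := by
  have hq0 : (q : ℤ) ≠ 0 := by exact_mod_cast D.q_ne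
  have h1 : (q : ℤ) * X.card = q * (q * ((q : ℤ) ^ (2 * r) + (-1) ^ (r + d) * ((q : ℤ) - 1) * q ^ (r + d))) := by
    rw [hX.card]; ring
  have h2 := mul_left_cancel₀ hq0 h1
  have : (q : ℤ) ∣ X.card := ⟨_, h2⟩
  exact_mod_cast this

/-- From the code to a representation. -/
theorem exists_CRep (D : FD F p q) {r d : ℕ} (hr : 1 ≤ r) {S : Set (ProjPoint F (r + 1))}
    (hX : QData F q r d (coneOf S))
    (hc : charVec F p (r + 1) S ∈ hypCode F p (r + 1)) : Nonempty (CRep F q (coneOf S)) := by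
  haveI := D.charP
  haveI : Fact p.Prime := ⟨D.hp⟩
  have h1 : ∃ α : (Fin (r + 1) → F) → ZMod p, ∀ P : ProjPoint F (r + 1), ∀ x ∈ P.1, x ≠ 0 →
      charVec F p (r + 1) S P = ∑ a, α a * if a ⬝ᵥ x = 0 then 1 else 0 := by
    unfold hypCode at hc
    generalize charVec F p (r + 1) S = f0 at hc
    induction hc using Submodule.span_induction with
    | mem f hf =>
      obtain ⟨W, hW, rfl⟩ := hf
      obtain ⟨b, hb, rfl⟩ := exists_dotL (by omega) (W := W) hW
      refine ⟨Pi.single b 1, ?_⟩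
      intro P x hx hx0
      rw [Finset.sum_eq_single b]
      · have : P ∈ pointsIn F (r + 1) (LinearMap.ker (dotL b)) ↔ b ⬝ᵥ x = 0 := by
          rw [eq_ptOf hx0 hx]
          change Submodule.span F {x} ≤ _ ↔ _
          rw [Submodule.span_singleton_le_iff_mem]; rfl
        simp [charVec, Set.indicator_apply, this]
      · intro c _ hcb; simp [Pi.single_apply, hcb]
      · simp
    | zero => exact ⟨0, by intro P x _ _; simp⟩
    | add f g _ _ hf hg =>
      obtain ⟨α, hα⟩ := hf
      obtain ⟨β, hβ⟩ := hg
      refine ⟨α + β, ?_⟩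
      intro P x hx hx0
      rw [Pi.add_apply, hα P x hx hx0, hβ P x hx hx0, ← Finset.sum_add_distrib]
      refine Finset.sum_congr rfl fun a _ => ?_
      rw [Pi.add_apply]; ring
    | smul c f _ hf =>
      obtain ⟨α, hα⟩ := hf
      refine ⟨c • α, ?_⟩
      intro P x hx hx0
      rw [Pi.smul_apply, hα P x hx hx0, smul_eq_mul, Finset.mul_sum]
      refine Finset.sum_congr rfl fun a _ => ?_
      rw [Pi.smul_apply, smul_eq_mul]; ring
  obtain ⟨α, hα⟩ := h1
  let κ := ZMod.castHom (dvd_refl p) F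
  have hne : ∀ x : Fin (r + 1) → F, x ≠ 0 → (if x ∈ coneOf S then (1 : F) else 0)
      = ∑ a, κ (α a) * if dotL a x = 0 then 1 else 0 := by
    intro x hx
    have h2 := congrArg κ (hα (ptOf hx) x (mem_ptOf hx) hx)
    rw [map_sum] at h2
    simp only [mem_coneOf hx]
    have h3 : κ (charVec F p (r + 1) S (ptOf hx)) = if ptOf hx ∈ S then (1 : F) else 0 := by
      simp only [charVec, Set.indicator_apply, Pi.one_apply]
      split_ifs <;> simp
    rw [← h3, h2]
    refine Finset.sum_congr rfl fun a _ => ?_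
    rw [map_mul]
    congr 1
    change κ (if a ⬝ᵥ x = 0 then 1 else 0) = if a ⬝ᵥ x = 0 then 1 else 0
    split_ifs <;> simp
  have hall : ∑ x : Fin (r + 1) → F, ((if x ∈ coneOf S then (1 : F) else 0)
      - ∑ a, κ (α a) * if dotL a x = 0 then 1 else 0) = 0 := by
    rw [Finset.sum_sub_distrib, Finset.sum_comm]
    simp_rw [← Finset.mul_sum]
    have h4 : ∀ a : Fin (r + 1) → F, ∑ x : Fin (r + 1) → F, (if dotL a x = 0 then (1 : F) else 0) = 0 := by
      intro a
      rw [Finset.sum_boole]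
      have : (univ.filter (fun x : Fin (r + 1) → F => dotL a x = 0)).card
          = q ^ (2 * finrank F (LinearMap.ker (dotL a))) := by
        rw [← D.card_sub]; congr 1
      rw [this, Nat.cast_pow, D.cast_q, zero_pow]
      by_cases ha : a = 0
      · have : dotL a = 0 := by ext; simp [ha, dotL]
        rw [this, LinearMap.ker_zero, finrank_top]; simp
      · have := finrank_ker_dotL ha
        omega
    simp_rw [h4]
    rw [Finset.sum_boole]
    simp only [mul_zero, Finset.sum_const_zero, sub_zero]
    have : univ.filter (fun x => x ∈ coneOf S) = coneOf S := by ext; simp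
    rw [this]
    obtain ⟨m, hm⟩ := hX.dvd_card D
    rw [hm, Nat.cast_mul, D.cast_q, zero_mul]
  have hzero : (if (0 : Fin (r + 1) → F) ∈ coneOf S then (1 : F) else 0)
      = ∑ a, κ (α a) * if dotL a (0 : Fin (r + 1) → F) = 0 then 1 else 0 := by
    rw [Finset.sum_eq_single 0] at hall
    · exact sub_eq_zero.1 hall
    · intro x _ hx; rw [hne x hx, sub_self]
    · simp
  refine ⟨⟨Fin (r + 1) → F, inferInstance, fun a => dotL a, fun a => κ (α a), ?_, ?_⟩⟩
  · intro a
    obtain ⟨m, hm⟩ := D.hq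
    rw [← map_pow, hm, ZMod.pow_card_pow]
  · intro x
    by_cases hx : x = 0
    · subst hx
      convert hzero
    · convert hne x hx

end Transl2

open Module Matrix

section HermCode
open scoped Classical
open Finset

variable {F : Type} [Field F] [Fintype F] {p q n : ℕ}

theorem lemma_M (D : FD F p q) {T : Type} [Fintype T] (ω : T → F) (Y : T → Fin n → F) {m : ℕ}
    (hm : m ≤ q ^ 2 - 1) (h : ∀ ε : Fin n → F, ∑ P, ω P * (∑ j, ε j * Y P j) ^ m = 0)
    (e : Fin n → ℕ) (he : e ∈ piAntidiag univ m) :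
    (Nat.multinomial univ e : F) * ∑ P, ω P * ∏ j, Y P j ^ e j = 0 := by
  let c : (Fin n → ℕ) → F := fun e => (Nat.multinomial univ e : F) * ∑ P, ω P * ∏ j, Y P j ^ e j
  let G : MvPolynomial (Fin n) F := ∑ e ∈ piAntidiag univ m,
    MvPolynomial.monomial (Finsupp.equivFunOnFinite.symm e) (c e)
  have hG : G = 0 := by
    apply MvPolynomial.eq_zero_of_eval_eq_zero
    · intro ε
      rw [← h ε]
      simp only [G, map_sum, MvPolynomial.eval_monomial, Finset.sum_pow_eq_sum_piAntidiag, Finset.mul_sum]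
      rw [Finset.sum_comm]
      refine Finset.sum_congr rfl fun e he => ?_
      simp only [c, Finset.mul_sum, Finset.sum_mul]
      refine Finset.sum_congr rfl fun P _ => ?_
      rw [Finsupp.prod_fintype _ _ (by simp)]
      simp only [Finsupp.equivFunOnFinite_symm_apply_apply, mul_pow, Finset.prod_mul_distrib]
      ring
    · rw [D.hF]
      apply Submodule.sum_mem
      intro e he
      rw [MvPolynomial.mem_restrictDegree]
      intro s hs i
      have := MvPolynomial.support_monomial_subset hs
      rw [Finset.mem_singleton] at this
      subst this
      rw [Finset.mem_piAntidiag] at he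
      simp only [Finsupp.equivFunOnFinite_symm_apply_apply]
      have := Finset.single_le_sum (f := e) (fun i _ => Nat.zero_le _) (mem_univ i)
      have h' : univ.sum e = ∑ x, e x := rfl
      omega
  have h1 : MvPolynomial.coeff (Finsupp.equivFunOnFinite.symm e) G = c e := by
    simp only [G, MvPolynomial.coeff_sum, MvPolynomial.coeff_monomial]
    simp only [EmbeddingLike.apply_eq_iff_eq]
    rw [Finset.sum_ite_eq' (piAntidiag univ m) e, if_pos he]
  rw [hG] at h1
  exact h1.symm.trans (MvPolynomial.coeff_zero _)

theorem choose_Q_sub_one (D : FD F p q) {N : ℕ} (hN : ∃ h, N = p ^ h) :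
    ∀ k, k < N → ((N - 1).choose k : F) ≠ 0 := by
  haveI := D.charP
  haveI : Fact p.Prime := ⟨D.hp⟩
  intro k
  have : ∀ k, k < N → ((N - 1).choose k : F) = (-1) ^ k := by
    intro k
    induction k with
    | zero => simp
    | succ k ih =>
      intro hk
      have ih := ih (by omega)
      obtain ⟨h, hh⟩ := hN
      have h1 : p ∣ N.choose (k + 1) := by
        rw [hh]; exact D.hp.dvd_choose_pow (by omega) (by omega)
      have h2 : N.choose (k + 1) = (N - 1).choose k + (N - 1).choose (k + 1) := by
        have : N = (N - 1) + 1 := by omega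
        conv_lhs => rw [this]
        exact Nat.choose_succ_succ _ _
      have h3 : ((N.choose (k + 1) : ℕ) : F) = 0 := (CharP.cast_eq_zero_iff F p _).2 h1
      rw [h2] at h3
      push_cast at h3
      rw [ih] at h3
      rw [pow_succ]
      linear_combination h3
  intro hk
  rw [this k hk]
  simp

theorem lemma_S (D : FD F p q) {T : Type} [Fintype T] (ω A B : T → F)
    (h : ∀ s : F, ∑ P, ω P * (s * A P + B P) ^ (q ^ 2 - 1) = 0) (k : ℕ) (hk : k ≤ q ^ 2 - 1) :
    ∑ P, ω P * (A P ^ k * B P ^ (q ^ 2 - 1 - k)) = 0 := by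
  have hQ := D.one_lt_Q
  let G : Polynomial F := ∑ m ∈ range (q ^ 2), Polynomial.monomial m
    (∑ P, ω P * (A P ^ m * B P ^ (q ^ 2 - 1 - m) * ((q ^ 2 - 1).choose m : F)))
  have hG : G = 0 := by
    apply Polynomial.eq_zero_of_natDegree_lt_card_of_eval_eq_zero' _ univ
    · intro s _
      rw [← h s]
      simp only [G, Polynomial.eval_finset_sum, Polynomial.eval_monomial]
      simp_rw [add_pow, Finset.mul_sum, Finset.sum_mul]
      rw [Finset.sum_comm]
      refine Finset.sum_congr rfl fun P _ => ?_
      have : q ^ 2 - 1 + 1 = q ^ 2 := by omega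
      rw [this]
      refine Finset.sum_congr rfl fun m _ => ?_
      rw [mul_pow]; ring
    · rw [Finset.card_univ, D.hF]
      have : G.natDegree ≤ q ^ 2 - 1 := by
        apply Polynomial.natDegree_sum_le_of_forall_le
        intro m hm
        refine (Polynomial.natDegree_monomial_le _).trans ?_
        simp at hm; omega
      omega
  have h1 : G.coeff k = ∑ P, ω P * (A P ^ k * B P ^ (q ^ 2 - 1 - k) * ((q ^ 2 - 1).choose k : F)) := by
    simp only [G, Polynomial.finset_sum_coeff, Polynomial.coeff_monomial]
    rw [Finset.sum_ite_eq' (range (q ^ 2)) k, if_pos (by simp; omega)]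
  rw [hG] at h1
  have h2 : ∑ P, ω P * (A P ^ k * B P ^ (q ^ 2 - 1 - k) * ((q ^ 2 - 1).choose k : F))
      = (∑ P, ω P * (A P ^ k * B P ^ (q ^ 2 - 1 - k))) * ((q ^ 2 - 1).choose k : F) := by
    rw [Finset.sum_mul]
    refine Finset.sum_congr rfl fun P _ => by ring
  rw [h2] at h1
  rw [Polynomial.coeff_zero] at h1
  rcases mul_eq_zero.1 h1.symm with h3 | h3
  · exact h3
  · exfalso
    obtain ⟨m, hm⟩ := D.hq
    exact choose_Q_sub_one D (N := q ^ 2) ⟨m * 2, by rw [hm, pow_mul]⟩ k (by omega) h3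

theorem herm_pow_sum (D : FD F p q) {T : Type} [Fintype T] (ω : T → F) (x : T → Fin n → F)
    (h : ∀ a : Fin n → F, ∑ P, ω P * (a ⬝ᵥ x P) ^ (q ^ 2 - 1) = 0) (A : Matrix (Fin n) (Fin n) F) :
    ∑ P, ω P * (Hf q A (x P) (x P)) ^ (q - 1) = 0 := by
  have h2 := D.two_le
  have hqQ : q ≤ q ^ 2 := by nlinarith
  let Xf : T → Fin n → F := fun P j => ∑ i, x P i * A i j
  have step1 : ∀ ε θ : Fin n → F,
      ∑ P, ω P * ((∑ j, ε j * Xf P j) ^ (q - 1) * (∑ j, θ j * (x P j) ^ q) ^ (q - 1)) = 0 := by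
    intro ε θ
    have := lemma_S D ω (fun P => ∑ j, ε j * Xf P j) (fun P => ∑ j, (θ j) ^ q * x P j) (by
      intro s
      have := h (fun i => s * (∑ j, A i j * ε j) + (θ i) ^ q)
      rw [← this]
      refine Finset.sum_congr rfl fun P _ => ?_
      congr 2
      simp only [dotProduct, add_mul, Finset.sum_add_distrib, Xf, Finset.mul_sum, Finset.sum_mul]
      congr 1
      rw [Finset.sum_comm]
      refine Finset.sum_congr rfl fun i _ => Finset.sum_congr rfl fun j _ => by ring) (q - 1) (by omega)
    rw [← this]
    refine Finset.sum_congr rfl fun P _ => ?_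
    have e : q ^ 2 - 1 - (q - 1) = q * (q - 1) := by
      rw [Nat.mul_sub, mul_one, ← pow_two]; omega
    rw [e, pow_mul, D.sum_pow]
    congr 4
    ext j
    rw [mul_pow, D.pow_pow]
  have step2 : ∀ e ∈ piAntidiag (univ : Finset (Fin n)) (q - 1), (Nat.multinomial univ e : F) *
      ∑ P, ω P * ∏ j, (Xf P j * (x P j) ^ q) ^ e j = 0 := by
    intro e he
    by_cases h0 : (Nat.multinomial univ e : F) = 0
    · rw [h0, zero_mul]
    have h3 : ∀ θ : Fin n → F, ∑ P, (ω P * ∏ j, Xf P j ^ e j) * (∑ j, θ j * (x P j) ^ q) ^ (q - 1) = 0 := by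
      intro θ
      have := lemma_M D (fun P => ω P * (∑ j, θ j * (x P j) ^ q) ^ (q - 1)) Xf (m := q - 1) (by omega) (by
        intro ε
        rw [← step1 ε θ]
        refine Finset.sum_congr rfl fun P _ => by ring) e he
      rw [← (mul_eq_zero.1 this).resolve_left h0]
      refine Finset.sum_congr rfl fun P _ => by ring
    have := lemma_M D (fun P => ω P * ∏ j, Xf P j ^ e j) (fun P j => (x P j) ^ q) (m := q - 1) (by omega) h3 e he
    rw [← this]
    congr 1
    refine Finset.sum_congr rfl fun P _ => ?_
    simp_rw [mul_pow]
    rw [Finset.prod_mul_distrib]; ring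
  have e1 : ∀ P, Hf q A (x P) (x P) = ∑ j, Xf P j * (x P j) ^ q := by
    intro P
    simp only [Hf, Xf, Finset.sum_mul]
    rw [Finset.sum_comm]
  simp_rw [e1, Finset.sum_pow_eq_sum_piAntidiag, Finset.mul_sum]
  rw [Finset.sum_comm]
  apply Finset.sum_eq_zero
  intro e he
  rw [← step2 e he, Finset.mul_sum]
  refine Finset.sum_congr rfl fun P _ => by ring

theorem mem_pointsIn_ker (a : Fin n → F) {y : Fin n → F} {P : ProjPoint F n} (hy : y ≠ 0)
    (hP : y ∈ P.1) : P ∈ pointsIn F n (LinearMap.ker (dotL a)) ↔ a ⬝ᵥ y = 0 := by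
  rw [eq_ptOf hy hP]
  change Submodule.span F {y} ≤ _ ↔ _
  rw [Submodule.span_singleton_le_iff_mem]; rfl

theorem herm_mem_code (D : FD F p q) {r : ℕ} (hr : 1 ≤ r) {A : Matrix (Fin (r + 1)) (Fin (r + 1)) F}
    (hA : Aᵀ = A.map (fun a => a ^ q)) :
    charVec F p (r + 1) (hermSet F q (r + 1) A) ∈ hypCode F p (r + 1) := by
  haveI := D.charP
  haveI : Fact p.Prime := ⟨D.hp⟩
  have h2 := D.two_le
  by_contra hno
  obtain ⟨f, hf, hfb⟩ := Submodule.exists_dual_map_eq_bot_of_notMem hno inferInstance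
  let κ := ZMod.castHom (dvd_refl p) F
  have hκ : Function.Injective κ := κ.injective
  choose x hx0 hxP using fun P : ProjPoint F (r + 1) => exists_rep P
  let ω : ProjPoint F (r + 1) → F := fun P => κ (f (Pi.single P 1))
  have hfω : ∀ S : Set (ProjPoint F (r + 1)), κ (f (charVec F p (r + 1) S))
      = ∑ P, ω P * if P ∈ S then 1 else 0 := by
    intro S
    have e : charVec F p (r + 1) S = ∑ P, (if P ∈ S then (1 : ZMod p) else 0) • Pi.single P (1 : ZMod p) := by
      ext P
      rw [Finset.sum_apply, Finset.sum_eq_single P]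
      · simp [charVec, Set.indicator_apply]
      · intro b _ hb
        rw [Pi.smul_apply, Pi.single_eq_of_ne (Ne.symm hb), smul_zero]
      · simp
    rw [e, map_sum, map_sum]
    refine Finset.sum_congr rfl fun P _ => ?_
    rw [map_smul, smul_eq_mul, map_mul, mul_comm]
    congr 1
    split_ifs <;> simp
  have hhyp : ∀ a : Fin (r + 1) → F, a ≠ 0 → ∑ P, ω P * (if a ⬝ᵥ x P = 0 then 1 else 0) = 0 := by
    intro a ha
    have hmem : charVec F p (r + 1) (pointsIn F (r + 1) (LinearMap.ker (dotL a))) ∈ hypCode F p (r + 1) := by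
      apply Submodule.subset_span
      refine ⟨_, ?_, rfl⟩
      have := finrank_ker_dotL ha
      omega
    have h3 : f (charVec F p (r + 1) (pointsIn F (r + 1) (LinearMap.ker (dotL a)))) = 0 := by
      have := Submodule.mem_map_of_mem (f := f) hmem
      rw [hfb] at this
      exact (Submodule.mem_bot _).1 this
    have h4 := hfω (pointsIn F (r + 1) (LinearMap.ker (dotL a)))
    rw [h3, map_zero] at h4
    refine Eq.trans ?_ h4.symm
    refine Finset.sum_congr rfl fun P _ => ?_
    congr 1
    have : P ∈ pointsIn F (r + 1) (LinearMap.ker (dotL a)) ↔ a ⬝ᵥ x P = 0 := by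
      exact mem_pointsIn_ker a (hx0 P) (hxP P)
    simp only [this]
  have hsum : ∑ P, ω P = 0 := by
    have h3 : ∑ a : Fin (r + 1) → F, ∑ P, ω P * (if a ⬝ᵥ x P = 0 then (1 : F) else 0) = ∑ P, ω P := by
      rw [Finset.sum_eq_single 0]
      · simp
      · intro a _ ha; exact hhyp a ha
      · simp
    rw [← h3, Finset.sum_comm]
    apply Finset.sum_eq_zero
    intro P _
    rw [← Finset.mul_sum, Finset.sum_boole]
    have : (univ.filter (fun a : Fin (r + 1) → F => a ⬝ᵥ x P = 0)).card
        = q ^ (2 * finrank F (LinearMap.ker (dotL (x P)))) := by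
      rw [← D.card_sub]; congr 1; ext a
      simp only [mem_filter, mem_univ, true_and, LinearMap.mem_ker]
      change _ ↔ x P ⬝ᵥ a = 0
      rw [dotProduct_comm]
    rw [this, Nat.cast_pow, D.cast_q, zero_pow, mul_zero]
    have := finrank_ker_dotL (hx0 P)
    omega
  have hpow : ∀ a : Fin (r + 1) → F, ∑ P, ω P * (a ⬝ᵥ x P) ^ (q ^ 2 - 1) = 0 := by
    intro a
    by_cases ha : a = 0
    · subst ha
      have : q ^ 2 - 1 ≠ 0 := by have := D.one_lt_Q; omega
      simp [zero_pow this]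
    have e : ∀ P, ω P * (a ⬝ᵥ x P) ^ (q ^ 2 - 1) = ω P - ω P * (if a ⬝ᵥ x P = 0 then 1 else 0) := by
      intro P
      rw [D.pow_Q_sub']
      split_ifs <;> simp
    simp_rw [e]
    rw [Finset.sum_sub_distrib, hsum, hhyp a ha, sub_zero]
  have hfin := herm_pow_sum D ω x hpow A
  have hH := Hf_herm D hA
  have h5 : κ (f (charVec F p (r + 1) (hermSet F q (r + 1) A))) = 0 := by
    rw [hfω]
    have e : ∀ P, ω P * (if P ∈ hermSet F q (r + 1) A then (1 : F) else 0)
        = ω P - ω P * (Hf q A (x P) (x P)) ^ (q - 1) := by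
      intro P
      have h6 := (Hf_eq_cone D hA (hermSet F q (r + 1) A)).1 rfl (x P)
      rw [mem_coneOf' (hx0 P) (hxP P)] at h6
      by_cases h7 : Hf q A (x P) (x P) = 0
      · rw [if_pos (h6.2 h7), h7, zero_pow (by omega)]; ring
      · rw [if_neg (fun h => h7 (h6.1 h))]
        have h8 := (hH.symm (x P) (x P)).symm
        have h9 : (Hf q A (x P) (x P)) ^ (q - 1) = 1 := by
          have h10 : (Hf q A (x P) (x P)) ^ (q - 1) * Hf q A (x P) (x P) = Hf q A (x P) (x P) := by
            rw [← pow_succ, Nat.sub_add_cancel (by omega)]; exact h8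
          exact mul_right_cancel₀ h7 (by rw [h10, one_mul])
        rw [h9]; ring
    simp_rw [e]
    rw [Finset.sum_sub_distrib, hsum, hfin, sub_zero]
  exact hf (hκ (by rw [h5, map_zero]))

end HermCode

open Module Matrix

section GG
open scoped Classical
open Finset

variable {F : Type} [Field F] [Fintype F] {p q n : ℕ}

theorem star_of_terms {V : Type} [AddCommGroup V] [Module F V] [Fintype V]
    {X : Finset V} (hZ : Zsum F q X = 0)
    (h : ∀ v, v ∉ X → ∀ x, nv F X v x = 1 ∨ q + 1 ≤ nv F X v x) :
    ∀ v, v ∉ X → ∀ x, nv F X v x = 1 ∨ nv F X v x = q + 1 := by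
  have hterm : ∀ v, v ∉ X → ∀ x, 0 ≤ ((nv F X v x : ℤ) - 1) * ((nv F X v x : ℤ) - q - 1) := by
    intro v hv x
    rcases h v hv x with h1 | h1
    · rw [h1]; simp
    · have : (q : ℤ) + 1 ≤ nv F X v x := by exact_mod_cast h1
      apply mul_nonneg
      · have : (0 : ℤ) ≤ q := by positivity
        linarith
      · linarith
  unfold Zsum at hZ
  rw [Finset.sum_eq_zero_iff_of_nonneg] at hZ
  · intro v hv x
    have h1 := hZ v (by simp [hv])
    rw [Finset.sum_eq_zero_iff_of_nonneg (fun x _ => hterm v hv x)] at h1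
    rcases mul_eq_zero.1 (h1 x (mem_univ x)) with h2 | h2
    · left; have : (nv F X v x : ℤ) = 1 := by linarith
      exact_mod_cast this
    · right; have : (nv F X v x : ℤ) = q + 1 := by linarith
      exact_mod_cast this
  · intro v hv
    simp at hv
    exact Finset.sum_nonneg fun x _ => hterm v hv x

theorem star_q_eq_p {V : Type} [AddCommGroup V] [Module F V] [Fintype V] (D : FD F p q) (hqp : q = p)
    {X : Finset V} (hX : IsCone F X) (R : CRep F q X) (hZ : Zsum F q X = 0) :
    ∀ v, v ∉ X → ∀ x, nv F X v x = 1 ∨ nv F X v x = q + 1 := by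
  apply star_of_terms hZ
  intro v hv x
  have h1 := R.nv_pos D hX hv x
  have h2 := R.nv_mod D hX hv x
  have h3 := (Nat.modEq_iff_dvd' h1).1 h2.symm
  obtain ⟨k, hk⟩ := h3
  rcases Nat.eq_zero_or_pos k with rfl | hk0
  · left; omega
  · right
    have : p * 1 ≤ p * k := Nat.mul_le_mul_left _ hk0
    omega

/-- number of vectors orthogonal to a subspace -/
theorem card_perp (D : FD F p q) (W : Submodule F (Fin n → F)) :
    (univ.filter (fun a : Fin n → F => ∀ u ∈ W, a ⬝ᵥ u = 0)).card = q ^ (2 * (n - finrank F W)) := by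
  let f : (Fin n → F) →ₗ[F] (W →ₗ[F] F) :=
    { toFun := fun a => (dotL a).comp W.subtype
      map_add' := by intro a b; ext u; simp [dotL, add_dotProduct]
      map_smul' := by intro c a; ext u; simp [dotL, smul_dotProduct] }
  have hs : Function.Surjective f := by
    intro g
    obtain ⟨g', hg'⟩ := LinearMap.exists_extend g
    refine ⟨fun i => g' (Pi.single i 1), ?_⟩
    have : dotL (fun i => g' (Pi.single i 1)) = g' := by
      apply LinearMap.pi_ext'
      intro i
      ext
      simp [dotL]
    change (dotL (fun i => g' (Pi.single i 1))).comp W.subtype = g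
    rw [this, hg']
  have h1 := LinearMap.finrank_range_add_finrank_ker f
  rw [LinearMap.range_eq_top.2 hs, finrank_top] at h1
  have h2 : finrank F (W →ₗ[F] F) = finrank F W := Subspace.dual_finrank_eq
  rw [h2] at h1
  simp only [Module.finrank_fin_fun] at h1
  have h3 := D.card_sub (LinearMap.ker f)
  have h4 : finrank F (LinearMap.ker f) = n - finrank F W := by omega
  rw [h4] at h3
  rw [← h3]
  congr 1
  ext a
  simp only [mem_filter, mem_univ, true_and, LinearMap.mem_ker]
  constructor
  · intro h; ext u; exact h u.1 u.2
  · intro h u hu; exact LinearMap.congr_fun h ⟨u, hu⟩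

theorem card_X_span {V : Type} [AddCommGroup V] [Module F V] [Fintype V] (D : FD F p q)
    {X : Finset V} (hX : IsCone F X) {v x : V} (hv : v ∉ X) (hi : LinearIndependent F ![v, x]) :
    (X.filter (fun y => y ∈ Submodule.span F {v, x})).card = 1 + (q ^ 2 - 1) * nv F X v x := by
  have h := gz_mem D hX hv (z := 0) (Submodule.zero_mem (Submodule.span F {v, x}))
  rw [gz_eq_sum] at h
  have h1 := sum_span_pair hi (fun y => if y ∈ X then 1 else 0)
  rw [← h]
  have h2 : (X.filter (fun y => y ∈ Submodule.span F {v, x})).card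
      = ∑ y ∈ univ.filter (fun y : V => y ∈ Submodule.span F {v, x}), if y ∈ X then 1 else 0 := by
    rw [← Finset.card_filter, Finset.filter_filter]
    congr 1; ext y; simp [and_comm]
  rw [h2, h1, Finset.sum_comm]
  refine Finset.sum_congr rfl fun b _ => Finset.sum_congr rfl fun a _ => ?_
  have : a • v + b • x = 0 + b • x + a • v := by abel
  rw [this]

theorem star_r3 (D : FD F p q) {X : Finset (Fin (3 + 1) → F)} (hQ : QData F q 3 0 X)
    (R : CRep F q X) (hZ : Zsum F q X = 0) :
    ∀ v, v ∉ X → ∀ x, nv F X v x = 1 ∨ nv F X v x = q + 1 := by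
  have hX := hQ.cone
  have h2 := D.two_le
  have hq0 : (q : ℤ) ≠ 0 := by exact_mod_cast D.q_ne
  apply star_of_terms hZ
  intro v hv x
  have hv0 : v ≠ 0 := by rintro rfl; exact hv hX.zero
  by_cases hi : LinearIndependent F ![v, x]
  swap
  · left
    rw [LinearIndependent.pair_iff' hv0] at hi
    push Not at hi
    obtain ⟨a, rfl⟩ := hi
    have := nv_shift X v 0 a
    rw [zero_add] at this
    rw [this, nv_zero hX hv]
  have hXc : (X.card : ℤ) = q ^ 7 - q ^ 5 + q ^ 4 := by
    apply mul_left_cancel₀ hq0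
    rw [hQ.card]; ring
  let N : (Fin (3 + 1) → F) → ℕ := fun a => (X.filter (fun y => a ⬝ᵥ y = 0)).card
  by_cases hex : ∃ a : Fin (3 + 1) → F, a ≠ 0 ∧ a ⬝ᵥ v = 0 ∧ a ⬝ᵥ x = 0 ∧ N a = q ^ 4
  · left
    obtain ⟨a, ha, hav, hax, hN⟩ := hex
    have hsum : ∑ y ∈ univ.filter (fun y : Fin (3 + 1) → F => a ⬝ᵥ y = 0), nv F X v y
        = ∑ y ∈ univ.filter (fun y : Fin (3 + 1) → F => a ⬝ᵥ y = 0), 1 := by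
      have hc : (univ.filter (fun y : Fin (3 + 1) → F => a ⬝ᵥ y = 0)).card = q ^ 6 := by
        have h3 := D.card_sub (LinearMap.ker (dotL a))
        have h4 : finrank F (LinearMap.ker (dotL a)) = 3 := by have := finrank_ker_dotL ha; omega
        rw [h4] at h3
        exact h3
      rw [← Finset.card_eq_sum_ones, hc]
      have e0 : ∀ y, nv F X v y = ∑ t : F, (if y + t • v ∈ X then 1 else 0) := by
        intro y; unfold nv; rw [Finset.card_filter]; exact Finset.sum_congr rfl (fun t _ => by congr)
      rw [Finset.sum_congr rfl (fun y _ => e0 y)]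
      rw [Finset.sum_comm]
      have : ∀ t : F, ∑ y ∈ univ.filter (fun y : Fin (3 + 1) → F => a ⬝ᵥ y = 0),
          (if y + t • v ∈ X then 1 else 0) = q ^ 4 := by
        intro t
        rw [← hN, ← Finset.card_filter, Finset.filter_filter]
        apply Finset.card_bij (fun y _ => y + t • v)
        · intro y hy
          simp only [mem_filter, mem_univ, true_and] at hy ⊢
          refine ⟨hy.2, ?_⟩
          rw [dotProduct_add, dotProduct_smul, hav, hy.1]; simp
        · intro a _ b _ h; simpa using h
        · intro y hy
          simp only [mem_filter] at hy
          refine ⟨y - t • v, ?_, by simp⟩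
          simp only [mem_filter, mem_univ, true_and, sub_add_cancel]
          refine ⟨?_, hy.1⟩
          rw [dotProduct_sub, dotProduct_smul, hav, hy.2]; simp
      rw [Finset.sum_congr rfl (fun t _ => this t)]
      rw [Finset.sum_const, Finset.card_univ, D.hF, smul_eq_mul]; ring
    have h5 := (Finset.sum_eq_sum_iff_of_le (fun y _ => R.nv_pos D hX hv y)).1 hsum.symm
    exact (h5 x (by simpa using hax)).symm
  · right
    push Not at hex
    -- all nonzero a have N a ≥ c0
    have hlow : ∀ a : Fin (3 + 1) → F, a ≠ 0 → a ⬝ᵥ v = 0 → a ⬝ᵥ x = 0 → (q : ℤ) ^ 5 - q ^ 3 + q ^ 2 ≤ N a := by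
      intro a ha hav hax
      obtain ⟨e, he, h⟩ := hQ.sec a ha
      change (q : ℤ) * (N a : ℤ) = _ at h
      have hne := hex a ha hav hax
      interval_cases e
      · have : (N a : ℤ) = q ^ 5 - q ^ 3 + q ^ 2 := by
          apply mul_left_cancel₀ hq0; rw [h]; ring
        rw [this]
      · have : (N a : ℤ) = q ^ 5 + q ^ 4 - q ^ 3 := by
          apply mul_left_cancel₀ hq0; rw [h]; ring
        rw [this]
        have : (q : ℤ) ^ 2 ≤ q ^ 4 := pow_le_pow_right₀ (by exact_mod_cast (by omega : 1 ≤ q)) (by norm_num)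
        linarith
      · exfalso
        apply hne
        have : (N a : ℤ) = q ^ 4 := by
          apply mul_left_cancel₀ hq0; rw [h]; ring
        exact_mod_cast this
    set U := Submodule.span F {v, x} with hU
    have hUf : finrank F U = 2 := by
      have h := finrank_span_eq_card hi
      have r1 : Set.range ![v, x] = {v, x} := by simp [Set.pair_comm]
      rw [r1] at h
      rw [hU, h]; simp
    have hperp : ∀ a : Fin (3 + 1) → F, (∀ u ∈ U, a ⬝ᵥ u = 0) ↔ a ⬝ᵥ v = 0 ∧ a ⬝ᵥ x = 0 := by
      intro a
      constructor
      · intro h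
        exact ⟨h v (Submodule.subset_span (by simp)), h x (Submodule.subset_span (by simp))⟩
      · rintro ⟨h1, h3⟩ u hu
        obtain ⟨s, t, rfl⟩ := Submodule.mem_span_pair.1 hu
        rw [dotProduct_add, dotProduct_smul, dotProduct_smul, h1, h3]; simp
    let P := univ.filter (fun a : Fin (3 + 1) → F => ∀ u ∈ U, a ⬝ᵥ u = 0)
    have hPc : P.card = q ^ 4 := by
      have := card_perp D U
      rw [hUf] at this
      exact this
    have hdc : ∑ a ∈ P, N a = q ^ 4 * (X.filter (fun y => y ∈ U)).card
        + q ^ 2 * (X.filter (fun y => y ∉ U)).card := by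
      have e1 : ∑ a ∈ P, N a = ∑ y ∈ X, (P.filter (fun a => a ⬝ᵥ y = 0)).card := by
        simp only [N, Finset.card_filter]
        rw [Finset.sum_comm]
      rw [e1, ← Finset.sum_filter_add_sum_filter_not X (fun y => y ∈ U)]
      congr 1
      · rw [Finset.sum_congr rfl (g := fun _ => q ^ 4), Finset.sum_const, smul_eq_mul, mul_comm]
        intro y hy
        rw [Finset.filter_true_of_mem, hPc]
        intro a ha
        exact (mem_filter.1 ha).2 y (mem_filter.1 hy).2
      · rw [Finset.sum_congr rfl (g := fun _ => q ^ 2), Finset.sum_const, smul_eq_mul, mul_comm]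
        intro y hy
        have hyU := (mem_filter.1 hy).2
        have h3 := card_perp D (U ⊔ Submodule.span F {y})
        have h4 : finrank F ↥(U ⊔ Submodule.span F {y}) = 3 := by
          have hy0 : y ≠ 0 := by rintro rfl; exact hyU (Submodule.zero_mem _)
          have h5 := Submodule.finrank_sup_add_finrank_inf_eq U (Submodule.span F {y})
          have h6 : U ⊓ Submodule.span F {y} = ⊥ := by
            rw [← disjoint_iff, Submodule.disjoint_span_singleton' hy0]
            exact hyU
          rw [h6, finrank_bot, hUf, finrank_span_singleton hy0] at h5
          omega
        rw [h4] at h3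
        refine Eq.trans ?_ h3
        congr 1
        ext a
        simp only [P, mem_filter, mem_univ, true_and]
        constructor
        · rintro ⟨h5, h6⟩ u hu
          obtain ⟨u1, hu1, u2, hu2, rfl⟩ := Submodule.mem_sup.1 hu
          obtain ⟨c, rfl⟩ := Submodule.mem_span_singleton.1 hu2
          rw [dotProduct_add, dotProduct_smul, h5 u1 hu1, h6]; simp
        · intro h5
          exact ⟨fun u hu => h5 u (Submodule.mem_sup_left hu),
            h5 y (Submodule.mem_sup_right (Submodule.mem_span_singleton_self y))⟩
    have h0P : (0 : Fin (3 + 1) → F) ∈ P := by simp [P]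
    have hN0 : N 0 = X.card := by simp [N]
    have hsumlow : (X.card : ℤ) + (q ^ 4 - 1) * ((q : ℤ) ^ 5 - q ^ 3 + q ^ 2) ≤ ∑ a ∈ P, (N a : ℤ) := by
      rw [← Finset.add_sum_erase _ _ h0P, hN0]
      have : ∑ a ∈ P.erase 0, ((q : ℤ) ^ 5 - q ^ 3 + q ^ 2) ≤ ∑ a ∈ P.erase 0, (N a : ℤ) := by
        apply Finset.sum_le_sum
        intro a ha
        rw [Finset.mem_erase] at ha
        have h3 := (hperp a).1 (mem_filter.1 ha.2).2
        exact hlow a ha.1 h3.1 h3.2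
      rw [Finset.sum_const, Finset.card_erase_of_mem h0P, hPc, nsmul_eq_mul] at this
      rw [Nat.cast_sub (Nat.one_le_pow _ _ (by omega))] at this
      push_cast at this
      linarith
    have hm := card_X_span D hX hv hi
    have hsplit := Finset.card_filter_add_card_filter_not (s := X) (fun y => y ∈ U)
    have hdcZ : ∑ a ∈ P, (N a : ℤ) = (q : ℤ) ^ 4 * (X.filter (fun y => y ∈ U)).card
        + q ^ 2 * (X.filter (fun y => y ∉ U)).card := by exact_mod_cast hdc
    have hmZ : ((X.filter (fun y => y ∈ U)).card : ℤ) = 1 + ((q : ℤ) ^ 2 - 1) * nv F X v x := by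
      rw [hm]
      rw [Nat.cast_add, Nat.cast_mul, Nat.cast_sub (by have := D.one_lt_Q; omega)]
      push_cast; ring
    have hsZ : ((X.filter (fun y => y ∉ U)).card : ℤ) = X.card - (X.filter (fun y => y ∈ U)).card := by
      have : ((X.filter (fun y => y ∈ U)).card : ℤ) + (X.filter (fun y => y ∉ U)).card = X.card := by
        exact_mod_cast hsplit
      linarith
    rw [hdcZ, hsZ, hmZ, hXc] at hsumlow
    have hk : 0 ≤ ((q : ℤ) ^ 2 * (q ^ 2 - 1) ^ 2) * (nv F X v x - q) := by linarith
    have hpos : 0 < (q : ℤ) ^ 2 * (q ^ 2 - 1) ^ 2 := by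
      have h3 : (2 : ℤ) ≤ q := by exact_mod_cast h2
      have : 0 < (q : ℤ) ^ 2 - 1 := by nlinarith
      positivity
    have hge : (q : ℤ) ≤ nv F X v x := by
      have := nonneg_of_mul_nonneg_right hk hpos
      linarith
    have hge' : q ≤ nv F X v x := by exact_mod_cast hge
    rcases Nat.lt_or_eq_of_le hge' with h3 | h3
    · exact h3
    · exfalso
      have h4 := R.nv_mod D hX hv x
      rw [← h3] at h4
      have h5 : q ≡ 0 [MOD p] := (Nat.modEq_zero_iff_dvd).2 D.p_dvd
      have h6 := (h5.symm.trans h4)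
      have h7 : p ∣ 1 := (Nat.modEq_zero_iff_dvd).1 h6.symm
      exact D.hp.one_lt.ne' (Nat.dvd_one.1 h7)

end GG

open Module Matrix

section Bd
open scoped Classical
open Finset

variable {F : Type} [Field F] [Fintype F] {p q : ℕ}

theorem QData.bounds (D : FD F p q) {r d : ℕ} (hr : 3 ≤ r) (hd : d ≤ r - 3)
    {X : Finset (Fin (r + 1) → F)} (hQ : QData F q r d X) :
    X.card ≤ q ^ (2 * r + 1) + q ^ (2 * r - 2) ∧ q ^ (2 * r + 1) ≤ X.card + q ^ (2 * r - 1) := by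
  have h2 := D.two_le
  have h2' : (2 : ℤ) ≤ q := by exact_mod_cast h2
  have hq0 : (0 : ℤ) < q := by linarith
  have hcard : (X.card : ℤ) = q ^ (2 * r + 1) + (-1) ^ (r + d) * ((q : ℤ) - 1) * q ^ (r + d + 1) := by
    apply mul_left_cancel₀ hq0.ne'
    rw [hQ.card]; ring
  have mono : ∀ {a b : ℕ}, a ≤ b → (q : ℤ) ^ a ≤ q ^ b := fun h => pow_le_pow_right₀ (by linarith) h
  constructor
  · suffices h : (X.card : ℤ) ≤ q ^ (2 * r + 1) + q ^ (2 * r - 2) by exact_mod_cast h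
    rw [hcard]
    rcases Nat.even_or_odd (r + d) with h | h
    · rw [h.neg_one_pow]
      have h3 : r + d + 2 ≤ 2 * r - 2 := by
        obtain ⟨k, hk⟩ := h; omega
      have h4 := mono h3
      have h5 : (q : ℤ) ^ (r + d + 2) = q * q ^ (r + d + 1) := by ring
      have : (0 : ℤ) < q ^ (r + d + 1) := by positivity
      linarith
    · rw [h.neg_one_pow]
      have : (0 : ℤ) ≤ (q - 1) * q ^ (r + d + 1) := mul_nonneg (by linarith) (by positivity)
      have : (0 : ℤ) < q ^ (2 * r - 2) := by positivity
      linarith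
  · suffices h : (q : ℤ) ^ (2 * r + 1) ≤ X.card + q ^ (2 * r - 1) by exact_mod_cast h
    rw [hcard]
    have h5 : (q : ℤ) ^ (r + d + 2) = q * q ^ (r + d + 1) := by ring
    have h4 : (q : ℤ) ^ (r + d + 2) ≤ q ^ (2 * r - 1) := mono (by omega)
    have h6 : (0 : ℤ) < q ^ (r + d + 1) := by positivity
    have h7 : (0 : ℤ) ≤ (q - 1) * q ^ (r + d + 1) := mul_nonneg (by linarith) (by positivity)
    rcases neg_one_pow_eq_or ℤ (r + d) with h | h <;> rw [h] <;> linarith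

theorem back_dir (D : FD F p q) (hq4 : 4 < q) {r d : ℕ} (hr : 3 ≤ r) (hd : d ≤ r - 3)
    {S : Set (ProjPoint F (r + 1))} (hQ : QData F q r d (coneOf S)) (R : CRep F q (coneOf S))
    (star : ∀ v, v ∉ coneOf S → ∀ x, nv F (coneOf S) v x = 1 ∨ nv F (coneOf S) v x = q + 1) :
    IsSingularHermitian F q (r + 1) d S := by
  obtain ⟨hb1, hb2⟩ := hQ.bounds D hr hd
  have hVc : Fintype.card (Fin (r + 1) → F) = q ^ (2 * r + 2) := by
    rw [Fintype.card_fun, D.hF, Fintype.card_fin, ← pow_mul]; ring_nf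
  have hlt : (coneOf S).card < Fintype.card (Fin (r + 1) → F) := by
    rw [hVc]
    have h3 : q ^ (2 * r + 2) = q * q ^ (2 * r + 1) := by ring
    have h4 : q ^ (2 * r - 2) ≤ q ^ (2 * r + 1) := Nat.pow_le_pow_right (by omega) (by omega)
    have h5 : 0 < q ^ (2 * r + 1) := pow_pos (by omega) _
    nlinarith
  have hne : ∃ v, v ∉ coneOf S := by
    by_contra hno
    push Not at hno
    have : coneOf S = univ := by ext x; simp [hno x]
    rw [this, Finset.card_univ] at hlt
    exact lt_irrefl _ hlt
  obtain ⟨k, rfl⟩ : ∃ k, r = k + 1 := ⟨r - 1, by omega⟩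
  obtain ⟨H, hH, hHX⟩ := final_E D hq4 hQ.cone R star (M := q ^ (2 * k)) (Nat.one_le_pow _ _ (by omega))
    (by rw [hVc]; ring) (by
      refine hb1.trans (le_of_eq ?_)
      have : 2 * (k + 1) - 2 = 2 * k := by omega
      rw [this]; ring) hne
  obtain ⟨A, hA, hAH⟩ := exists_matrix D hH
  have hSA : ∀ x, x ∈ coneOf S ↔ Hf q A x x = 0 := by
    intro x; rw [hHX, hAH]
  refine ⟨A, hA, ?_, (Hf_eq_cone D hA S).2 hSA⟩
  rw [← Hf_rad D hA]
  have hc := (Hf_herm D hA).count D (k + 1 + 1) ⊤ (by simp)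
  have e : (univ.filter (fun x : Fin (k + 1 + 1) → F => x ∈ (⊤ : Submodule F (Fin (k + 1 + 1) → F)) ∧ Hf q A x x = 0))
      = coneOf S := by
    ext x; simp [hSA x]
  rw [e, hQ.card] at hc
  have h2 := D.two_le
  have h2' : (2 : ℤ) ≤ q := by exact_mod_cast h2
  have h3 : (-1 : ℤ) ^ (k + 1 + d) * (q - 1) * q ^ (k + 1 + d + 2)
    = (-1) ^ (k + 1 + 1 + finrank F ((Hf_herm D hA).rad ⊤)) * ((q : ℤ) - 1)
        * (q : ℤ) ^ (k + 1 + 1 + finrank F ((Hf_herm D hA).rad ⊤)) := by linarith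
  have h4 := congrArg abs h3
  simp only [abs_mul, abs_pow, abs_neg, abs_one, one_pow, one_mul] at h4
  have h5 : |(q : ℤ) - 1| ≠ 0 := by rw [abs_ne_zero]; intro h; linarith
  have h6 := mul_left_cancel₀ h5 h4
  rw [abs_of_nonneg (by linarith : (0 : ℤ) ≤ q)] at h6
  have h7 := pow_right_injective₀ (by linarith : (0 : ℤ) < q) (by intro h; linarith : (q : ℤ) ≠ 1) h6
  omega

end Bd

open Module Matrix

section P1
open scoped Classical
open Finset

/-- a finite projective plane of order `Q` given by an incidence relation -/
structure PPl {P L : Type} [Fintype P] [Fintype L] (I : P → L → Prop) (Q : ℕ) : Prop where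
  hl : ∀ l, (univ.filter (fun x => I x l)).card = Q + 1
  hp : ∀ x, (univ.filter (fun l => I x l)).card = Q + 1
  h2p : ∀ x y, x ≠ y → (univ.filter (fun l => I x l ∧ I y l)).card = 1
  h2l : ∀ l m, l ≠ m → (univ.filter (fun x => I x l ∧ I x m)).card = 1
  hP : Fintype.card P = Q ^ 2 + Q + 1
  hL : Fintype.card L = Q ^ 2 + Q + 1

variable {P L : Type} [Fintype P] [Fintype L] {I : P → L → Prop} {Q : ℕ}

theorem PPl.dual (h : PPl I Q) : PPl (fun l x => I x l) Q :=
  ⟨h.hp, h.hl, h.h2l, h.h2p, h.hL, h.hP⟩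

/-- number of points of `T` on `l` -/
noncomputable def cnt (I : P → L → Prop) (T : Finset P) (l : L) : ℕ := (T.filter (fun x => I x l)).card

theorem PPl.sum_cnt_thru (h : PPl I Q) (T : Finset P) (u : P) :
    ∑ l ∈ univ.filter (fun l => I u l), cnt I T l = T.card + if u ∈ T then Q else 0 := by
  have e : ∑ l ∈ univ.filter (fun l => I u l), cnt I T l
      = ∑ x ∈ T, (univ.filter (fun l => I u l ∧ I x l)).card := by
    unfold cnt
    simp only [Finset.card_filter]
    rw [Finset.sum_comm]
    refine Finset.sum_congr rfl fun x _ => ?_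
    rw [Finset.sum_filter]
    refine Finset.sum_congr rfl fun l _ => ?_
    by_cases h1 : I u l <;> simp [h1]
  rw [e]
  have e2 : ∀ x ∈ T, (univ.filter (fun l => I u l ∧ I x l)).card = 1 + if u = x then Q else 0 := by
    intro x _
    by_cases hx : u = x
    · subst hx; simp only [and_self, h.hp, if_true]; omega
    · rw [h.h2p u x hx]; simp [hx]
  rw [Finset.sum_congr rfl e2, Finset.sum_add_distrib, Finset.sum_ite_eq]
  simp

theorem PPl.sum_cnt (h : PPl I Q) (T : Finset P) : ∑ l, cnt I T l = (Q + 1) * T.card := by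
  unfold cnt
  simp only [Finset.card_filter]
  rw [Finset.sum_comm]
  simp only [← Finset.card_filter, h.hp]
  simp [mul_comm]

theorem PPl.sum_cnt_sq (h : PPl I Q) (T : Finset P) :
    ∑ l, cnt I T l * cnt I T l = T.card * (T.card + Q) := by
  have e : ∀ l, cnt I T l * cnt I T l = ∑ x ∈ T, if I x l then cnt I T l else 0 := by
    intro l
    rw [← Finset.sum_filter, Finset.sum_const, smul_eq_mul]; rfl
  simp only [e]
  rw [Finset.sum_comm]
  have : ∀ x ∈ T, (∑ l, if I x l then cnt I T l else 0) = T.card + Q := by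
    intro x hx
    rw [← Finset.sum_filter, h.sum_cnt_thru T x, if_pos hx]
  rw [Finset.sum_congr rfl this, Finset.sum_const, smul_eq_mul]

/-- Hankel inequality for a function on points -/
def HKp {R : Type} [Zero R] (I : P → L → Prop) (Q : ℕ) (c : P → R) : Prop :=
  ∀ u m m', c u = 0 → I u m → I u m' → m ≠ m' →
    cnt I (univ.filter (fun x => c x ≠ 0)) m * (Q + 1) + cnt I (univ.filter (fun x => c x ≠ 0)) m'
      ≤ (univ.filter (fun x => c x ≠ 0)).card + (cnt I (univ.filter (fun x => c x ≠ 0)) m) ^ 2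

theorem PPl.exists_off (h : PPl I Q) (T : Finset P) (l : L) (hT : cnt I T l < Q + 1) :
    ∃ u, I u l ∧ u ∉ T := by
  by_contra hno
  push Not at hno
  have : univ.filter (fun x => I x l) ⊆ T.filter (fun x => I x l) := by
    intro x hx
    simp at hx
    simp [hx, hno x hx]
  have := Finset.card_le_card this
  rw [h.hl] at this
  unfold cnt at hT
  omega

theorem PPl.exists_line_thru (h : PPl I Q) (u : P) : ∃ l, I u l := by
  have := h.hp u
  have : (univ.filter (fun l => I u l)).Nonempty := by
    rw [← Finset.card_pos]; omega
  obtain ⟨l, hl⟩ := this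
  exact ⟨l, by simpa using hl⟩

theorem PPl.exists_other_line (h : PPl I Q) (hQ : 1 ≤ Q) (u : P) (m : L) : ∃ l, I u l ∧ l ≠ m := by
  have h1 := h.hp u
  have : ((univ.filter (fun l => I u l)).erase m).Nonempty := by
    rw [← Finset.card_pos]
    have := Finset.pred_card_le_card_erase (s := univ.filter (fun l => I u l)) (a := m)
    omega
  obtain ⟨l, hl⟩ := this
  simp at hl
  exact ⟨l, hl.2, hl.1⟩

theorem PPl.SW_core {R : Type} [Zero R] (h : PPl I Q) {q : ℕ} (hq : 2 ≤ q) (hQ : Q = q ^ 2) {c : P → R}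
    (hk : HKp I Q c) (hw : ∀ l, cnt I (univ.filter (fun x => c x ≠ 0)) l ≤ q) : ∀ x, c x = 0 := by
  set T := univ.filter (fun x => c x ≠ 0) with hT
  by_contra hno
  push Not at hno
  obtain ⟨x0, hx0⟩ := hno
  have hx0T : x0 ∈ T := by simp [hT, hx0]
  obtain ⟨l0, hl0⟩ := h.exists_line_thru x0
  obtain ⟨m, -, hm⟩ := Finset.exists_max_image (univ : Finset L) (fun l => cnt I T l) ⟨l0, mem_univ _⟩
  have hqQ : q < Q := by rw [hQ]; nlinarith
  have hk1 : 1 ≤ cnt I T m := by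
    refine le_trans ?_ (hm l0 (mem_univ _))
    unfold cnt
    exact Finset.card_pos.2 ⟨x0, by simp [hx0T, hl0]⟩
  obtain ⟨u, hum, huT⟩ := h.exists_off T m (by have := hw m; omega)
  have hcu : c u = 0 := by by_contra h1; exact huT (by simp [hT, h1])
  have h1 : T.card + Q ≤ cnt I T m * (Q + 1) := by
    have := h.sum_cnt_thru T x0
    rw [if_pos hx0T] at this
    rw [← this]
    have h2 := Finset.sum_le_card_nsmul (univ.filter (fun l => I x0 l)) (fun l => cnt I T l) (cnt I T m)
      (fun l _ => hm l (mem_univ _))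
    rw [h.hp] at h2
    simp only [smul_eq_mul] at h2
    linarith
  have hsq : cnt I T m ^ 2 ≤ Q := by rw [hQ]; exact Nat.pow_le_pow_left (hw m) 2
  have h3 : ∀ m', I u m' → m' ≠ m → cnt I T m' = 0 := by
    intro m' h4 h5
    have := hk u m m' hcu hum h4 h5.symm
    rw [← hT] at this
    omega
  have h4 := h.sum_cnt_thru T u
  rw [if_neg huT] at h4
  rw [Finset.sum_eq_single m (fun l hl hlm => h3 l (by simpa using hl) hlm) (by
    intro hh; exact absurd hum (by simpa using hh))] at h4
  obtain ⟨m', hm', hmm'⟩ := h.exists_other_line (by omega) u m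
  have h5 := hk u m m' hcu hum hm' hmm'.symm
  rw [← hT, ← add_zero T.card, ← h4, h3 m' hm' hmm'] at h5
  have h6 := hw m
  nlinarith

end P1

open Module Matrix

section P2
open scoped Classical
open Finset

variable {P L : Type} [Fintype P] [Fintype L] {I : P → L → Prop} {Q p q : ℕ}

/-- number of lines of `K` through `x` -/
noncomputable def mlt (I : P → L → Prop) (K : Finset L) (x : P) : ℕ := (K.filter (fun l => I x l)).card

theorem mlt_eq (I : P → L → Prop) (K : Finset L) (x : P) : mlt I K x = cnt (fun l x => I x l) K x := rfl

theorem sum_mlt (I : P → L → Prop) (K : Finset L) (S : Finset P) :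
    ∑ x ∈ S, mlt I K x = ∑ l ∈ K, cnt I S l := by
  unfold mlt cnt
  simp only [Finset.card_filter]
  rw [Finset.sum_comm]

theorem PPl.sum_mlt_univ (h : PPl I Q) (K : Finset L) : ∑ x, mlt I K x = (Q + 1) * K.card :=
  h.dual.sum_cnt K

theorem PPl.sum_mlt_sq (h : PPl I Q) (K : Finset L) :
    ∑ x, mlt I K x * mlt I K x = K.card * (K.card + Q) := h.dual.sum_cnt_sq K

theorem PPl.sum_mlt_line (h : PPl I Q) (K : Finset L) (l : L) :
    ∑ x ∈ univ.filter (fun x => I x l), mlt I K x = K.card + if l ∈ K then Q else 0 :=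
  h.dual.sum_cnt_thru K l

theorem PPl.sum_mlt_pairs (h : PPl I Q) (K : Finset L) :
    ∑ x, ((mlt I K x : ℤ) * (mlt I K x - 1)) = K.card * (K.card - 1) := by
  have h1 : (∑ x, (mlt I K x : ℤ) * (mlt I K x : ℤ)) = K.card * (K.card + Q) := by
    exact_mod_cast h.sum_mlt_sq K
  have h2 : (∑ x, (mlt I K x : ℤ)) = (Q + 1) * K.card := by
    exact_mod_cast h.sum_mlt_univ K
  simp only [mul_sub, mul_one, Finset.sum_sub_distrib]
  rw [h1, h2]; ring

theorem PPl.union_bound (h : PPl I Q) (S : Finset P) (K : Finset L) :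
    2 * ∑ l ∈ K, (cnt I S l : ℤ) ≤ 2 * S.card + K.card * (K.card - 1) := by
  rw [← h.sum_mlt_pairs K]
  have h1 : ∑ l ∈ K, (cnt I S l : ℤ) = ∑ x, if x ∈ S then (mlt I K x : ℤ) else 0 := by
    rw [Finset.sum_ite_mem, Finset.univ_inter]
    exact_mod_cast (sum_mlt I K S).symm
  have h2 : (S.card : ℤ) = ∑ x, if x ∈ S then (1 : ℤ) else 0 := by simp
  rw [h1, h2, Finset.mul_sum, Finset.mul_sum, ← Finset.sum_add_distrib]
  apply Finset.sum_le_sum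
  intro x _
  have hm : (0 : ℤ) ≤ mlt I K x := by positivity
  by_cases hx : x ∈ S
  · simp only [hx, if_true]
    generalize (mlt I K x : ℤ) = m at hm
    rcases le_or_gt m 1 with h3 | h3
    · nlinarith
    · nlinarith
  · simp only [hx, if_false]
    rcases Nat.eq_zero_or_pos (mlt I K x) with h3 | h3
    · rw [h3]; simp
    · have : (1 : ℤ) ≤ mlt I K x := by exact_mod_cast h3
      nlinarith

/-- the difference between the indicator of `S` and the sum of the lines in `K` -/
noncomputable def dif (R : Type) [Ring R] (I : P → L → Prop) (S : Finset P) (K : Finset L) (x : P) : R :=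
  (if x ∈ S then (1 : R) else 0) - (mlt I K x : R)

noncomputable def sdif (R : Type) [Ring R] (I : P → L → Prop) (S : Finset P) (K : Finset L) : Finset P :=
  univ.filter (fun x => dif R I S K x ≠ 0)

theorem mem_sdif {R : Type} [Ring R] {S : Finset P} {K : Finset L} {x : P} :
    x ∈ sdif R I S K ↔ dif R I S K x ≠ 0 := by simp [sdif]

theorem PPl.W_bound (R : Type) [Ring R] (h : PPl I Q) (S : Finset P) (K : Finset L) :
    ((sdif R I S K).card : ℤ) ≤ S.card - K.card * (Q + 1) + 2 * ∑ l ∈ K, ((Q : ℤ) + 1 - cnt I S l)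
      + K.card * (K.card - 1) := by
  rw [← h.sum_mlt_pairs K]
  have h1 : ∑ l ∈ K, (cnt I S l : ℤ) = ∑ x, if x ∈ S then (mlt I K x : ℤ) else 0 := by
    rw [Finset.sum_ite_mem, Finset.univ_inter]
    exact_mod_cast (sum_mlt I K S).symm
  have h2 : (S.card : ℤ) = ∑ x, if x ∈ S then (1 : ℤ) else 0 := by simp
  have h3 : ((sdif R I S K).card : ℤ) = ∑ x, if dif R I S K x ≠ 0 then (1 : ℤ) else 0 := by
    unfold sdif; rw [Finset.card_filter]; push_cast; rfl
  have h4 : (∑ x, (mlt I K x : ℤ)) = (Q + 1) * K.card := by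
    exact_mod_cast h.sum_mlt_univ K
  have h5 : ∑ l ∈ K, ((Q : ℤ) + 1 - cnt I S l) = ∑ x, (mlt I K x : ℤ) - ∑ x, if x ∈ S then (mlt I K x : ℤ) else 0 := by
    rw [Finset.sum_sub_distrib, h1, h4]; simp; ring
  have h6 : (K.card : ℤ) * (Q + 1) = ∑ x, (mlt I K x : ℤ) := by rw [h4]; ring
  rw [h5, h6, h2, h3, ← Finset.sum_sub_distrib, ← Finset.sum_sub_distrib, Finset.mul_sum,
    ← Finset.sum_add_distrib, ← Finset.sum_add_distrib]
  apply Finset.sum_le_sum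
  intro x _
  unfold dif
  by_cases hx : x ∈ S
  · simp only [hx, if_true]
    rcases (by omega : mlt I K x = 0 ∨ mlt I K x = 1 ∨ 2 ≤ mlt I K x) with h7 | h7 | h7
    · rw [h7]; simp; split <;> norm_num
    · rw [h7]; simp
    · have h8 : (2 : ℤ) ≤ mlt I K x := by exact_mod_cast h7
      have h9 : (if (1 : R) - (mlt I K x : R) ≠ 0 then (1 : ℤ) else 0) ≤ 1 := by split <;> norm_num
      nlinarith
  · simp only [hx, if_false]
    rcases Nat.eq_zero_or_pos (mlt I K x) with h7 | h7
    · rw [h7]; simp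
    · have h8 : (1 : ℤ) ≤ mlt I K x := by exact_mod_cast h7
      have h9 : (if (0 : R) - (mlt I K x : R) ≠ 0 then (1 : ℤ) else 0) ≤ 1 := by split <;> norm_num
      nlinarith

theorem PPl.lw_notin (R : Type) [Ring R] (h : PPl I Q) (S : Finset P) (K : Finset L) {l : L} (hl : l ∉ K) :
    cnt I (sdif R I S K) l ≤ cnt I S l + K.card := by
  have h1 := h.sum_mlt_line K l
  rw [if_neg hl, add_zero] at h1
  have h2 : ((univ.filter (fun x => I x l)).filter (fun x => mlt I K x ≠ 0)).card ≤ K.card := by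
    rw [← h1, Finset.card_filter]
    apply Finset.sum_le_sum
    intro x _
    split <;> omega
  refine le_trans ?_ (Nat.add_le_add_left h2 _)
  unfold cnt
  refine le_trans (Finset.card_le_card ?_) (Finset.card_union_le _ _)
  intro x hx
  simp only [mem_filter, mem_sdif, mem_union, mem_univ, true_and] at hx ⊢
  by_cases hS : x ∈ S
  · left; exact ⟨hS, hx.2⟩
  · right
    refine ⟨hx.2, fun h3 => hx.1 ?_⟩
    simp [dif, hS, h3]

theorem PPl.holes (h : PPl I Q) (S : Finset P) (l : L) :
    cnt I S l + ((univ.filter (fun x => I x l)).filter (fun x => x ∉ S)).card = Q + 1 := by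
  rw [← h.hl l, ← Finset.card_filter_add_card_filter_not (s := univ.filter (fun x => I x l)) (fun x => x ∈ S)]
  congr 1
  unfold cnt
  congr 1
  ext x; simp [and_comm]

theorem PPl.lw_in (R : Type) [Ring R] (h : PPl I Q) (S : Finset P) (K : Finset L) {l : L} (hl : l ∈ K) :
    cnt I (sdif R I S K) l + cnt I S l + 1 ≤ Q + 1 + K.card := by
  have h1 := h.sum_mlt_line K l
  rw [if_pos hl] at h1
  have h2 : ((univ.filter (fun x => I x l)).filter (fun x => 2 ≤ mlt I K x)).card + (Q + 1) ≤ K.card + Q := by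
    rw [← h1, ← h.hl l, Finset.card_filter, Finset.card_eq_sum_ones, ← Finset.sum_add_distrib]
    apply Finset.sum_le_sum
    intro x hx
    have : 1 ≤ mlt I K x := Finset.card_pos.2 ⟨l, by simp at hx; simp [hx, hl]⟩
    split <;> omega
  have h3 := h.holes S l
  have h4 : cnt I (sdif R I S K) l ≤ ((univ.filter (fun x => I x l)).filter (fun x => x ∉ S)).card
      + ((univ.filter (fun x => I x l)).filter (fun x => 2 ≤ mlt I K x)).card := by
    unfold cnt
    refine le_trans (Finset.card_le_card ?_) (Finset.card_union_le _ _)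
    intro x hx
    simp only [mem_filter, mem_sdif, mem_union, mem_univ, true_and] at hx ⊢
    by_cases hS : x ∈ S
    · right
      refine ⟨hx.2, ?_⟩
      by_contra h5
      have : 1 ≤ mlt I K x := Finset.card_pos.2 ⟨l, by simp [hx.2, hl]⟩
      have : mlt I K x = 1 := by omega
      apply hx.1
      simp [dif, hS, this]
    · left; exact ⟨hx.2, hS⟩
  omega

theorem sdif_empty (R : Type) [Ring R] [Nontrivial R] (S : Finset P) : sdif R I S ∅ = S := by
  ext x
  rw [mem_sdif]
  by_cases hx : x ∈ S <;> simp [dif, hx, mlt]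

/-- second moment identity -/
theorem PPl.second_moment (h : PPl I Q) (hQ : Q = q ^ 2) (S : Finset P) :
    ∑ l, ((cnt I S l : ℤ) - 1) * (cnt I S l - q - 1)
      = ((S.card : ℤ) - q ^ 3 - 1) * (S.card - Q - q - 1) := by
  have h1 : ∑ l, (cnt I S l : ℤ) * cnt I S l = S.card * (S.card + Q) := by exact_mod_cast h.sum_cnt_sq S
  have h2 : ∑ l, (cnt I S l : ℤ) = (Q + 1) * S.card := by exact_mod_cast h.sum_cnt S
  have h3 : ∀ l : L, ((cnt I S l : ℤ) - 1) * (cnt I S l - q - 1)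
      = (cnt I S l : ℤ) * cnt I S l - (q + 2) * cnt I S l + (q + 1) := by intro l; ring
  simp only [h3]
  rw [Finset.sum_add_distrib, Finset.sum_sub_distrib, ← Finset.mul_sum, h1, h2, Finset.sum_const,
    Finset.card_univ, h.hL, nsmul_eq_mul, hQ]
  push_cast
  ring

end P2

open Module Matrix

section P3
open scoped Classical
open Finset

variable {P L : Type} [Fintype P] [Fintype L] {I : P → L → Prop} {Q p q : ℕ}

/-- data of a plane section -/
structure PSec (R : Type) [Ring R] [Nontrivial R] (I : P → L → Prop) (p q Q : ℕ) (S : Finset P) : Prop where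
  pl : PPl I Q
  p5 : 5 ≤ p
  hq : q = p ^ 2
  hQ : Q = q ^ 2
  hmod : ∀ l, cnt I S l ≡ 1 [MOD p]
  hk : ∀ K : Finset L, HKp I Q (dif R I S K)
  hchar : CharP R p

variable {R : Type} [Ring R] [Nontrivial R] {S : Finset P}

theorem PSec.pos (h : PSec R I p q Q S) (l : L) : 1 ≤ cnt I S l := by
  by_contra h1
  have h2 : cnt I S l = 0 := by omega
  have h3 := h.hmod l
  rw [h2] at h3
  have h4 : p ∣ 1 := (Nat.modEq_zero_iff_dvd).1 h3.symm
  have := Nat.dvd_one.1 h4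
  have := h.p5
  omega

theorem PSec.form (h : PSec R I p q Q S) (l : L) : ∃ a, cnt I S l = 1 + p * a := by
  have h3 := (Nat.modEq_iff_dvd' (h.pos l)).1 (h.hmod l).symm
  obtain ⟨k, hk⟩ := h3
  exact ⟨k, by have := h.pos l; omega⟩

theorem PSec.hkK (h : PSec R I p q Q S) (K : Finset L) {u m m'} (hu : u ∉ sdif R I S K) (h1 : I u m) (h2 : I u m') (h3 : m ≠ m') :
    cnt I (sdif R I S K) m * (Q + 1) + cnt I (sdif R I S K) m' ≤ (sdif R I S K).card + (cnt I (sdif R I S K) m) ^ 2 := by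
  apply h.hk K u m m' _ h1 h2 h3
  by_contra h4
  exact hu (mem_sdif.2 h4)

theorem PSec.hkS (h : PSec R I p q Q S) {u m m'} (hu : u ∉ S) (h1 : I u m) (h2 : I u m') (h3 : m ≠ m') :
    cnt I S m * (Q + 1) + cnt I S m' ≤ S.card + (cnt I S m) ^ 2 := by
  have := h.hkK ∅ (u := u) (by rw [sdif_empty]; exact hu) h1 h2 h3
  rwa [sdif_empty] at this

theorem PSec.q25 (h : PSec R I p q Q S) : 5 * p ≤ q ∧ 25 ≤ q ∧ 25 * q ≤ Q := by
  have := h.p5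
  have h1 : 5 * p ≤ q := by rw [h.hq]; nlinarith
  refine ⟨h1, by omega, ?_⟩
  rw [h.hQ]; nlinarith

theorem PSec.dich (h : PSec R I p q Q S) (hN : S.card + p ≤ q ^ 3 + Q + 1) (l : L) :
    cnt I S l ≤ q + 1 ∨ Q + 1 ≤ cnt I S l + q := by
  obtain ⟨h5, h25, hQ25⟩ := h.q25
  have hp5 := h.p5
  by_contra hno
  push Not at hno
  obtain ⟨h1, h2⟩ := hno
  obtain ⟨a, ha⟩ := h.form l
  obtain ⟨u, hul, huS⟩ := h.pl.exists_off S l (by omega)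
  obtain ⟨m', hm', hne⟩ := h.pl.exists_other_line (by omega) u l
  have h3 := h.hkS huS hul hm' hne.symm
  have h4 := h.pos m'
  have ha1 : p + 1 ≤ a := by
    by_contra h6
    have : a ≤ p := by omega
    have : p * a ≤ p * p := Nat.mul_le_mul_left _ this
    have : q = p * p := by rw [h.hq]; ring
    omega
  -- upper
  have hQp : Q = p * (p * q) := by rw [h.hQ, h.hq]; ring
  have ha2 : a + p + 1 ≤ p * q := by
    by_contra h6
    have h7 : p * q ≤ a + p := by omega
    have h8 : p * (p * q) ≤ p * (a + p) := Nat.mul_le_mul_left _ h7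
    have : q = p * p := by rw [h.hq]; ring
    have : p * (a + p) = p * a + p * p := by ring
    omega
  -- b := n - (q+1+p) ≥ 0, c := Q+1-q-p - n ≥ 0
  rw [ha] at h3
  have hq' : (q : ℤ) = p * p := by rw [h.hq]; push_cast; ring
  have hQ' : (Q : ℤ) = q * q := by rw [h.hQ]; push_cast; ring
  zify at h3 h4 ha1 ha2 hN hp5 h5
  have e1 : (0 : ℤ) ≤ p * (a - (p + 1)) := mul_nonneg (by linarith) (by linarith)
  have e2 : (0 : ℤ) ≤ p * (p * q - a - p - 1) := mul_nonneg (by linarith) (by linarith)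
  have e2' : (p : ℤ) * (p * q - a - p - 1) = Q - p * a - q - p := by rw [hQ', hq']; ring
  have e1' : (p : ℤ) * (a - (p + 1)) = p * a - q - p := by rw [hq']; ring
  rw [e1'] at e1
  rw [e2'] at e2
  have e3 := mul_nonneg e1 e2
  have e4 : (q : ℤ) ^ 3 = q * Q := by rw [hQ']; ring
  have e5 : (p - 2 : ℤ) * Q ≥ 3 * Q := by
    have : (0 : ℤ) ≤ Q := by positivity
    nlinarith
  have e6 : (25 : ℤ) * q ≤ Q := by exact_mod_cast hQ25
  have e7 : (p : ℤ) * (5 * q) ≤ p * Q := by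
    apply mul_le_mul_of_nonneg_left _ (by linarith)
    linarith
  have e8 : (5 : ℤ) * (p * q) ≤ Q := by rw [hQ']; nlinarith
  -- n = 1 + pa ; n (Q+1-n) >= ...
  have e9 : (p : ℤ) * p = q := hq'.symm
  nlinarith

end P3

open Module Matrix

section P4
open scoped Classical
open Finset

variable {P L : Type} [Fintype P] [Fintype L] {I : P → L → Prop} {Q p q : ℕ}
variable {R : Type} [Ring R] [Nontrivial R] {S : Finset P}

theorem PSec.SW (h : PSec R I p q Q S) (K : Finset L) (hw : ∀ l, cnt I (sdif R I S K) l ≤ q) :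
    sdif R I S K = ∅ := by
  have := h.pl.SW_core (by have := h.q25; omega) h.hQ (h.hk K) hw
  ext x
  simp [mem_sdif, this x]

theorem PSec.k0 (h : PSec R I p q Q S) (hs : ∀ l, cnt I S l ≤ q + 1)
    (bad : ∃ l, cnt I S l ≠ 1 ∧ cnt I S l ≠ q + 1) : False := by
  obtain ⟨h5, h25, hQ25⟩ := h.q25
  have hp5 := h.p5
  obtain ⟨lb, hb1, hb2⟩ := bad
  have hQ' : (Q : ℤ) = q * q := by rw [h.hQ]; push_cast; ring
  -- exists a q+1 line
  have hex : ∃ l, cnt I S l = q + 1 := by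
    by_contra hno
    push Not at hno
    have h1 := h.SW ∅ (by
      intro l; rw [sdif_empty]; have := hs l; have := hno l; omega)
    rw [sdif_empty] at h1
    have := h.pos lb
    rw [h1] at this
    simp [cnt] at this
  obtain ⟨l, hl⟩ := hex
  obtain ⟨u, hul, huS⟩ := h.pl.exists_off S l (by omega)
  have hex2 : ∃ m', I u m' ∧ m' ≠ l ∧ cnt I S m' = q + 1 := by
    by_contra hno
    push Not at hno
    obtain ⟨m', hm', hne⟩ := h.pl.exists_other_line (by omega) u l
    have h3 := h.hkS huS hul hm' hne.symm
    have h4 := h.pl.sum_cnt_thru S u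
    rw [if_neg huS, add_zero] at h4
    have hlm : l ∈ univ.filter (fun l => I u l) := by simp [hul]
    rw [← Finset.add_sum_erase _ _ hlm, hl] at h4
    have h5 : ∑ x ∈ (univ.filter (fun l => I u l)).erase l, cnt I S x ≤ Q * (q + 1 - p) := by
      have h6 := Finset.sum_le_card_nsmul ((univ.filter (fun l => I u l)).erase l) (fun l => cnt I S l) (q + 1 - p) (by
        intro x hx
        simp only [mem_erase, mem_filter, mem_univ, true_and] at hx
        have h7 := hno x hx.2 hx.1
        have h8 := hs x
        obtain ⟨a, ha⟩ := h.form x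
        have hap : a < p := by
          by_contra h9
          have : p * p ≤ p * a := Nat.mul_le_mul_left _ (by omega)
          have : q = p * p := by rw [h.hq]; ring
          omega
        have : p * (a + 1) ≤ p * p := Nat.mul_le_mul_left _ hap
        have : q = p * p := by rw [h.hq]; ring
        have : p * (a + 1) = p * a + p := by ring
        omega)
      rw [Finset.card_erase_of_mem hlm, h.pl.hp, smul_eq_mul] at h6
      simpa using h6
    rw [hl] at h3
    have h6 : Q * (q + 1 - p) + Q * p = Q * (q + 1) := by
      rw [← Nat.mul_add]; congr 1; omega
    have h7 : Q * 5 ≤ Q * p := Nat.mul_le_mul_left _ hp5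
    have h8 : (q + 1) ^ 2 = Q + 2 * q + 1 := by rw [h.hQ]; ring
    have h9 : (q + 1) * (Q + 1) = Q * (q + 1) + q + 1 := by ring
    omega
  obtain ⟨m', hm', hne, hmc⟩ := hex2
  have h3 := h.hkS huS hul hm' hne.symm
  rw [hl, hmc] at h3
  have hN : (q : ℤ) ^ 3 + 1 ≤ S.card := by
    zify at h3
    rw [hQ'] at h3
    nlinarith
  have h6 := h.pl.second_moment h.hQ S
  have h7 : (0 : ℤ) ≤ ((S.card : ℤ) - q ^ 3 - 1) * (S.card - Q - q - 1) := by
    have : (25 : ℤ) ≤ q := by exact_mod_cast h25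
    apply mul_nonneg (by linarith)
    rw [hQ']
    nlinarith
  have h8 : ∑ l, ((cnt I S l : ℤ) - 1) * (cnt I S l - q - 1) < 0 := by
    have hle : ∀ l, ((cnt I S l : ℤ) - 1) * (cnt I S l - q - 1) ≤ 0 := by
      intro l
      have h1 : (1 : ℤ) ≤ cnt I S l := by exact_mod_cast h.pos l
      have h2 : (cnt I S l : ℤ) ≤ q + 1 := by exact_mod_cast hs l
      nlinarith
    rw [← Finset.sum_const_zero (s := (univ : Finset L))]
    apply Finset.sum_lt_sum (fun l _ => hle l)
    refine ⟨lb, mem_univ _, ?_⟩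
    have h1 : (1 : ℤ) < cnt I S lb := by
      have := h.pos lb
      exact_mod_cast (by omega : 1 < cnt I S lb)
    have h2 : (cnt I S lb : ℤ) < q + 1 := by
      have := hs lb
      exact_mod_cast (by omega : cnt I S lb < q + 1)
    nlinarith
  linarith

theorem PSec.w_small (h : PSec R I p q Q S) (K : Finset L) {B : ℕ} (hB1 : q ≤ B) (hB2 : B + 1 + (2 * q + 3) ≤ Q + 1)
    (hw : ∀ l, cnt I (sdif R I S K) l ≤ 2 * q + 3)
    (hW : (sdif R I S K).card < (B + 1) * (Q - B)) : ∀ l, cnt I (sdif R I S K) l ≤ B := by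
  intro l
  by_contra hno
  obtain ⟨h5, h25, hQ25⟩ := h.q25
  have h1 := hw l
  obtain ⟨u, hul, huS⟩ := h.pl.exists_off (sdif R I S K) l (by omega)
  obtain ⟨m', hm', hne⟩ := h.pl.exists_other_line (by omega) u l
  have h3 := h.hkK K huS hul hm' hne.symm
  have hle : B + 1 ≤ cnt I (sdif R I S K) l := by omega
  generalize cnt I (sdif R I S K) l = w at *
  have hBQ : B ≤ Q := by omega
  zify [hBQ] at *
  nlinarith [mul_nonneg (sub_nonneg.2 hle) (by linarith : (0 : ℤ) ≤ Q - B - w)]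

theorem PSec.PL (h : PSec R I p q Q S) (hN : S.card + p ≤ q ^ 3 + Q + 1)
    (bad : ∃ l, cnt I S l ≠ 1 ∧ cnt I S l ≠ q + 1 ∧ cnt I S l ≠ Q + 1) :
    ∃ K : Finset L, (∀ l, l ∈ K ↔ Q + 1 ≤ cnt I S l + q) ∧ sdif R I S K = ∅ ∧ K.card ≤ q + 2 ∧ 1 ≤ K.card := by
  obtain ⟨h5, h25, hQ25⟩ := h.q25
  have hp5 := h.p5
  have hQ' : (Q : ℤ) = q * q := by rw [h.hQ]; push_cast; ring
  have hq' : (q : ℤ) = p * p := by rw [h.hq]; push_cast; ring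
  obtain ⟨K, hKdef⟩ : ∃ K : Finset L, ∀ l, l ∈ K ↔ Q + 1 ≤ cnt I S l + q :=
    ⟨univ.filter (fun l => Q + 1 ≤ cnt I S l + q), fun l => by simp⟩
  have h25' : (25 : ℤ) ≤ q := by exact_mod_cast h25
  have hp5' : (5 : ℤ) ≤ p := by exact_mod_cast hp5
  have hQ25' : (25 : ℤ) * q ≤ Q := by exact_mod_cast hQ25
  have hN' : (S.card : ℤ) + p ≤ q ^ 3 + Q + 1 := by exact_mod_cast hN
  have hk : K.card ≤ q + 2 := by
    by_contra hno
    obtain ⟨T, hT, hTc⟩ := Finset.exists_subset_card_eq (by omega : q + 3 ≤ K.card)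
    have h1 := h.pl.union_bound S T
    have h2 : (T.card : ℤ) * (Q + 1 - q) ≤ ∑ l ∈ T, (cnt I S l : ℤ) := by
      have := Finset.card_nsmul_le_sum T (fun l => (cnt I S l : ℤ)) (Q + 1 - q) (by
        intro l hl
        have := (hKdef l).1 (hT hl)
        zify at this
        linarith)
      simpa using this
    rw [hTc] at h1 h2
    push_cast at h1 h2
    rw [hQ'] at *
    nlinarith
  have hk1 : 1 ≤ K.card := by
    by_contra hno
    have hK0 : K = ∅ := by rw [← Finset.card_eq_zero]; omega
    have hs : ∀ l, cnt I S l ≤ q + 1 := by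
      intro l
      rcases h.dich hN l with h1 | h1
      · exact h1
      · have := (hKdef l).2 h1
        rw [hK0] at this; simp at this
    obtain ⟨l, h1, h2, h3⟩ := bad
    exact h.k0 hs ⟨l, h1, h2⟩
  refine ⟨K, hKdef, ?_, hk, hk1⟩
  have hw : ∀ l, cnt I (sdif R I S K) l ≤ 2 * q + 3 := by
    intro l
    by_cases hl : l ∈ K
    · have h1 := h.pl.lw_in R S K hl
      have h2 := (hKdef l).1 hl
      omega
    · have h1 := h.pl.lw_notin R S K hl
      have h2 : cnt I S l ≤ q + 1 := by
        rcases h.dich hN l with h3 | h3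
        · exact h3
        · exact absurd ((hKdef l).2 h3) hl
      omega
  have hWb := h.pl.W_bound R S K
  have hsum : ∑ l ∈ K, ((Q : ℤ) + 1 - cnt I S l) ≤ K.card * q := by
    have := Finset.sum_le_card_nsmul K (fun l => (Q : ℤ) + 1 - cnt I S l) q (by
        intro l hl
        have := (hKdef l).1 hl
        zify at this
        linarith)
    simpa using this
  have hqQ : q ≤ Q := by omega
  rcases (by omega : K.card = 1 ∨ 2 ≤ K.card) with hc | hc
  · -- one long line
    rw [hc] at hWb hsum
    have hw1 : ∀ l, cnt I (sdif R I S K) l ≤ q + 1 := by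
      apply h.w_small K (by omega) (by omega) hw
      zify [(by omega : q + 1 ≤ Q)]
      push_cast at hWb hsum
      rw [hQ'] at *
      nlinarith
    apply h.SW
    intro l
    obtain ⟨l0, hl0⟩ := Finset.card_eq_one.1 hc
    by_cases hl : l = l0
    · subst hl
      have hlK : l ∈ K := by rw [hl0]; simp
      have h1 := h.pl.lw_in R S K hlK
      have h2 := (hKdef l).1 hlK
      omega
    · have h1 := hw1 l
      by_contra h2
      have h3 : cnt I (sdif R I S K) l = q + 1 := by omega
      -- the intersection point
      obtain ⟨z, hz⟩ := Finset.card_eq_one.1 (h.pl.h2l l l0 hl)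
      have hz' : I z l ∧ I z l0 := by
        have : z ∈ univ.filter (fun x => I x l ∧ I x l0) := by rw [hz]; simp
        simpa using this
      have hzu : ∀ x, I x l → x ≠ z → ¬ I x l0 := by
        intro x hx hxz hx0
        have : x ∈ univ.filter (fun x => I x l ∧ I x l0) := by simp [hx, hx0]
        rw [hz] at this
        exact hxz (by simpa using this)
      have hm : ∀ x, mlt I K x = if I x l0 then 1 else 0 := by
        intro x
        unfold mlt
        rw [hl0, Finset.filter_singleton]
        split <;> simp
      haveI := h.hchar
      obtain ⟨a, ha⟩ := h.form l
      have hpq : q = p * p := by rw [h.hq]; ring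
      by_cases hzS : z ∈ S
      · have h4 : (sdif R I S K).filter (fun x => I x l) = (S.filter (fun x => I x l)).erase z := by
          ext x
          simp only [mem_filter, mem_sdif, mem_erase, dif, hm]
          by_cases hxz : x = z
          · subst hxz; simp [hz'.2, hzS]
          · by_cases hx : I x l
            · simp [hx, hzu x hx hxz, hxz]
            · simp [hx]
        have h5 := congrArg Finset.card h4
        rw [Finset.card_erase_of_mem (by simp [hzS, hz'.1])] at h5
        change cnt I (sdif R I S K) l = cnt I S l - 1 at h5
        rw [h3, ha] at h5
        have h6 : p * p + 1 = p * a := by omega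
        have h7 : p ∣ 1 := (Nat.dvd_add_right (dvd_mul_right p p)).1 (h6 ▸ dvd_mul_right p a)
        have := Nat.dvd_one.1 h7
        omega
      · have h4 : (sdif R I S K).filter (fun x => I x l) = insert z (S.filter (fun x => I x l)) := by
          ext x
          simp only [mem_filter, mem_sdif, mem_insert, dif, hm]
          by_cases hxz : x = z
          · subst hxz; simp [hz'.2, hzS, hz'.1]
          · by_cases hx : I x l
            · simp [hx, hzu x hx hxz, hxz]
            · simp [hx, hxz]
        have h5 := congrArg Finset.card h4
        rw [Finset.card_insert_of_notMem (by simp [hzS])] at h5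
        change cnt I (sdif R I S K) l = cnt I S l + 1 at h5
        rw [h3, ha] at h5
        have h6 : p * p = p * a + 1 := by omega
        have h7 : p ∣ 1 := (Nat.dvd_add_right (dvd_mul_right p a)).1 (h6 ▸ dvd_mul_right p p)
        have := Nat.dvd_one.1 h7
        omega
  · apply h.SW
    apply h.w_small K le_rfl (by omega) hw
    zify [hqQ]
    have h1 : (2 : ℤ) ≤ K.card := by exact_mod_cast hc
    have h2 : (K.card : ℤ) ≤ q + 2 := by exact_mod_cast hk
    generalize (K.card : ℤ) = k at *
    rw [hQ'] at *
    nlinarith [mul_nonneg (sub_nonneg.2 h1) (sub_nonneg.2 h2)]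

end P4

open Module Matrix

section P6
open scoped Classical
open Finset Polynomial

variable {F : Type} [Field F] [Fintype F]

theorem hankel_det_deg (w : ℕ) (P : ℕ → F[X]) (hP : ∀ k, (P k).natDegree ≤ k) :
    (Matrix.det (Matrix.of (fun i j : Fin w => P (i + j)))).natDegree ≤ w * (w - 1) := by
  rw [Matrix.det_apply]
  apply Polynomial.natDegree_sum_le_of_forall_le
  intro σ _
  have h1 : (Equiv.Perm.sign σ • ∏ i, (Matrix.of (fun i j : Fin w => P (i + j))) (σ i) i).natDegree
      ≤ (∏ i, (Matrix.of (fun i j : Fin w => P (i + j))) (σ i) i).natDegree := by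
    rcases Int.units_eq_one_or (Equiv.Perm.sign σ) with h | h <;> rw [h] <;> simp
  refine h1.trans ((Polynomial.natDegree_prod_le _ _).trans ?_)
  calc ∑ i, ((Matrix.of (fun i j : Fin w => P (i + j))) (σ i) i).natDegree
      ≤ ∑ i, ((σ i : ℕ) + (i : ℕ)) := Finset.sum_le_sum fun i _ => hP _
    _ = ∑ i : Fin w, (i : ℕ) + ∑ i : Fin w, (i : ℕ) := by
        rw [Finset.sum_add_distrib, Equiv.sum_comp σ (fun i => (i : ℕ))]
    _ = w * (w - 1) := by
        rw [Fin.sum_univ_eq_sum_range (fun i => i), ← two_mul, mul_comm, Finset.sum_range_id_mul_two]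

theorem hankel_dvd (w : ℕ) (P : ℕ → F[X]) (B : F → F) (s : F)
    (hB : ∀ k, ∑ t, t ^ k * B t = (P k).eval s) :
    (X - C s) ^ (w - (univ.filter (fun t => B t ≠ 0)).card) ∣
      Matrix.det (Matrix.of (fun i j : Fin w => P (i + j))) := by
  set ρ := (univ.filter (fun t => B t ≠ 0)).card with hρ
  set φ : F[X] := ∏ a ∈ univ.filter (fun t => B t ≠ 0), (X - C a) with hφ
  have hφm : φ.Monic := Polynomial.monic_prod_of_monic _ _ fun a _ => Polynomial.monic_X_sub_C a
  have hφd : φ.natDegree = ρ := by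
    rw [hφ, Polynomial.natDegree_prod_of_monic _ _ fun a _ => Polynomial.monic_X_sub_C a]
    simp [hρ]
  set g : ℕ → F[X] := fun j => if j < ρ then X ^ j else φ * X ^ (j - ρ) with hg
  have hgm : ∀ j, (g j).Monic := by
    intro j; simp only [hg]; split_ifs
    · exact Polynomial.monic_X_pow j
    · exact hφm.mul (Polynomial.monic_X_pow _)
  have hgd : ∀ j, (g j).natDegree = j := by
    intro j; simp only [hg]; split_ifs with h
    · simp
    · rw [Polynomial.Monic.natDegree_mul hφm (Polynomial.monic_X_pow _), hφd]; simp; omega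
  set T : Matrix (Fin w) (Fin w) F[X] := Matrix.of fun l j => C ((g j).coeff l) with hT
  have hdT : T.det = 1 := by
    rw [Matrix.det_of_upperTriangular]
    · apply Finset.prod_eq_one
      intro i _
      have := hgm i
      unfold Polynomial.Monic Polynomial.leadingCoeff at this
      rw [hgd] at this
      simp [hT, this]
    · intro i j hij
      have hij' : j < i := hij
      simp only [hT, Matrix.of_apply]
      rw [Polynomial.coeff_eq_zero_of_natDegree_lt (by rw [hgd]; exact hij')]
      simp
  set M := Matrix.of (fun i j : Fin w => P (i + j)) with hM
  have e : M.det = (M * T).det := by rw [Matrix.det_mul, hdT, mul_one]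
  rw [e, Matrix.det_apply]
  apply Finset.dvd_sum
  intro σ _
  apply Dvd.dvd.trans _ (by
    rcases Int.units_eq_one_or (Equiv.Perm.sign σ) with h | h <;> rw [h] <;> simp :
      (∏ i, (M * T) (σ i) i) ∣ Equiv.Perm.sign σ • ∏ i, (M * T) (σ i) i)
  have e2 : (X - C s) ^ (w - ρ) ∣ ∏ j : Fin w, (if (j : ℕ) < ρ then (1 : F[X]) else X - C s) := by
    rw [Finset.prod_ite]
    simp only [Finset.prod_const, one_pow, one_mul]
    apply pow_dvd_pow
    have h1 := Finset.card_filter_add_card_filter_not (s := (univ : Finset (Fin w))) (fun j => (j : ℕ) < ρ)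
    have h2 : (univ.filter (fun j : Fin w => (j : ℕ) < ρ)).card ≤ ρ := by
      have := Finset.card_le_card_of_injOn (s := univ.filter (fun j : Fin w => (j : ℕ) < ρ)) (t := range ρ)
        (fun j => (j : ℕ)) (fun j hj => by simpa using hj) (fun a _ b _ hab => Fin.ext hab)
      simpa using this
    simp only [Finset.card_univ, Fintype.card_fin] at h1
    omega
  refine e2.trans (Finset.prod_dvd_prod_of_dvd _ _ ?_)
  intro j _
  split_ifs with hj
  · exact one_dvd _
  · rw [Polynomial.dvd_iff_isRoot, Polynomial.IsRoot]
    simp only [Matrix.mul_apply, hM, hT, Matrix.of_apply, Polynomial.eval_finset_sum, Polynomial.eval_mul,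
      Polynomial.eval_C, ← hB]
    simp only [Finset.sum_mul]
    rw [Finset.sum_comm]
    apply Finset.sum_eq_zero
    intro t _
    have e3 : ∑ l : Fin w, t ^ ((σ j : ℕ) + (l : ℕ)) * B t * (g j).coeff l
        = t ^ (σ j : ℕ) * B t * (g j).eval t := by
      rw [Polynomial.eval_eq_sum_range' (n := w) (by rw [hgd]; exact j.2),
        ← Fin.sum_univ_eq_sum_range (fun l => (g j).coeff l * t ^ l), Finset.mul_sum]
      refine Finset.sum_congr rfl fun l _ => ?_
      rw [pow_add]; ring
    rw [e3]
    by_cases hb : B t = 0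
    · simp [hb]
    · have : (g j).eval t = 0 := by
        simp only [hg, if_neg hj, Polynomial.eval_mul, hφ, Polynomial.eval_prod]
        rw [Finset.prod_eq_zero (i := t) (by simp [hb]) (by simp)]
        simp
      rw [this, mul_zero]

theorem hankel_ne (w : ℕ) (P : ℕ → F[X]) (B : F → F) (s : F)
    (hB : ∀ k, ∑ t, t ^ k * B t = (P k).eval s) (hw : (univ.filter (fun t => B t ≠ 0)).card = w) :
    Matrix.det (Matrix.of (fun i j : Fin w => P (i + j))) ≠ 0 := by
  intro h0
  have h1 : (Matrix.of (fun i j : Fin w => (P (i + j)).eval s)).det = 0 := by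
    have := congrArg (Polynomial.evalRingHom s) h0
    rw [RingHom.map_det, map_zero] at this
    convert this using 2
    ext i j
    simp
  obtain ⟨v, hv, hv0⟩ := Matrix.exists_mulVec_eq_zero_iff.2 h1
  set g : F[X] := ∑ i : Fin w, C (v i) * X ^ (i : ℕ) with hg
  have hge : ∀ t, g.eval t = ∑ i : Fin w, v i * t ^ (i : ℕ) := by
    intro t; simp [hg, Polynomial.eval_finset_sum]
  have hz : ∀ t, B t * g.eval t = 0 := by
    apply vandermonde_zero (K := w)
    · rw [← hw]
      apply Finset.card_le_card
      intro t ht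
      simp only [Finset.mem_filter, Finset.mem_univ, true_and] at ht ⊢
      exact left_ne_zero_of_mul ht
    · intro k hk
      have := congrFun hv0 ⟨k, hk⟩
      simp only [Matrix.mulVec, dotProduct, Matrix.of_apply, Pi.zero_apply, ← hB] at this
      rw [← this]
      simp only [Finset.sum_mul, hge, Finset.mul_sum]
      rw [Finset.sum_comm]
      refine Finset.sum_congr rfl fun l _ => Finset.sum_congr rfl fun t _ => ?_
      rw [pow_add]; ring
  have hgz : g = 0 := by
    by_contra hne
    have hw0 : 0 < w := by
      by_contra hw0
      have : w = 0 := by omega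
      subst this
      exact hne (by simp [hg])
    have hd : g.natDegree < w := by
      have : g.natDegree ≤ w - 1 := by
        apply Polynomial.natDegree_sum_le_of_forall_le
        intro i _
        refine (Polynomial.natDegree_C_mul_X_pow_le _ _).trans ?_
        have := i.2; omega
      omega
    have : (univ.filter (fun t => B t ≠ 0)).card ≤ g.natDegree := by
      apply Polynomial.card_le_degree_of_subset_roots
      intro t ht
      rw [Polynomial.mem_roots hne]
      have : t ∈ univ.filter (fun t => B t ≠ 0) := ht
      simp only [Finset.mem_filter, Finset.mem_univ, true_and] at this
      exact (mul_eq_zero.1 (hz t)).resolve_left this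
    omega
  apply hv
  funext i
  have : g.coeff i = v i := by
    simp only [hg, Polynomial.finset_sum_coeff, Polynomial.coeff_C_mul, Polynomial.coeff_X_pow]
    rw [Finset.sum_eq_single i]
    · simp
    · intro b _ hb
      rw [if_neg (fun h => hb (Fin.ext h.symm))]; simp
    · simp
  rw [← this, hgz]; simp

theorem hankel (A : F → F → F) (P : ℕ → F[X]) (hP : ∀ k, (P k).natDegree ≤ k)
    (hA : ∀ s k, ∑ t, t ^ k * A s t = (P k).eval s) (s0 : F) :
    (univ.filter (fun t => A s0 t ≠ 0)).card * (Fintype.card F + 1) ≤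
      ∑ s, (univ.filter (fun t => A s t ≠ 0)).card + (univ.filter (fun t => A s0 t ≠ 0)).card ^ 2 := by
  set w := (univ.filter (fun t => A s0 t ≠ 0)).card with hw
  set W : F → ℕ := fun s => (univ.filter (fun t => A s t ≠ 0)).card with hW
  have hne := hankel_ne w P (A s0) s0 (hA s0) hw.symm
  have hdeg := hankel_det_deg w P hP
  have hdvd : ∏ s : F, (X - C s) ^ (w - W s) ∣ Matrix.det (Matrix.of (fun i j : Fin w => P (i + j))) := by
    apply Finset.prod_dvd_of_coprime
    · intro a _ b _ hab
      exact (Polynomial.isCoprime_X_sub_C_of_isUnit_sub (sub_ne_zero.2 hab).isUnit).pow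
    · intro s _
      exact hankel_dvd w P (A s) s (hA s)
  have h1 := (Polynomial.natDegree_le_of_dvd hdvd hne).trans hdeg
  rw [Polynomial.natDegree_prod_of_monic _ _ fun s _ => (Polynomial.monic_X_sub_C s).pow _] at h1
  simp only [Polynomial.natDegree_pow, Polynomial.natDegree_X_sub_C, mul_one] at h1
  have h2 : Fintype.card F * w ≤ ∑ s, W s + ∑ s, (w - W s) := by
    rw [← Finset.sum_add_distrib, ← Finset.card_univ, ← smul_eq_mul, ← Finset.sum_const]
    apply Finset.sum_le_sum; intro s _; omega
  have h3 : w * (w - 1) + w = w ^ 2 := by cases w <;> simp; ring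
  have : w * (Fintype.card F + 1) = Fintype.card F * w + w := by ring
  change _ ≤ ∑ s, W s + w ^ 2
  omega

end P6

open Module Matrix

section P7
open scoped Classical
open Finset

variable {F : Type} [Field F] [Fintype F] {p q : ℕ}

/-- points (and lines) of the plane -/
abbrev Pt (F : Type) [Field F] : Type := Projectivization F (Fin 3 → F)

noncomputable instance ptFintype : Fintype (Pt F) := Fintype.ofFinite _

/-- incidence -/
def inc (x l : Pt F) : Prop := x.orthogonal l

theorem inc_mk {y l : Fin 3 → F} (hy : y ≠ 0) (hl : l ≠ 0) :
    inc (Projectivization.mk F y hy) (Projectivization.mk F l hl) ↔ y ⬝ᵥ l = 0 :=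
  Projectivization.orthogonal_mk hy hl

theorem inc_mk_rep {y : Fin 3 → F} (hy : y ≠ 0) (l : Pt F) :
    inc (Projectivization.mk F y hy) l ↔ y ⬝ᵥ l.rep = 0 := by
  conv_lhs => rw [← Projectivization.mk_rep l]
  exact inc_mk hy l.rep_nonzero

theorem card_pt (D : FD F p q) : Fintype.card (Pt F) = (q ^ 2) ^ 2 + q ^ 2 + 1 := by
  rw [← Nat.card_eq_fintype_card, Projectivization.card_of_finrank (k := F) (V := Fin 3 → F) (n := 3) (by simp)]
  rw [Nat.card_eq_fintype_card, D.hF, Finset.sum_range_succ, Finset.sum_range_succ, Finset.sum_range_succ]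
  simp; ring

theorem inc_PPl (D : FD F p q) : PPl (inc (F := F)) (q ^ 2) := by
  have ho : Configuration.ProjectivePlane.order (Pt F) (Pt F) = q ^ 2 := by
    have h := Configuration.ProjectivePlane.card_points (Pt F) (Pt F)
    rw [card_pt D] at h
    nlinarith
  have key : ∀ x y : Pt F, x ≠ y → (univ.filter (fun l : Pt F => inc x l ∧ inc y l)).card = 1 := by
    intro x y hxy
    rw [Finset.card_eq_one]
    refine ⟨Projectivization.cross x y, ?_⟩
    ext l
    simp only [Finset.mem_filter, Finset.mem_univ, true_and, Finset.mem_singleton]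
    constructor
    · rintro ⟨h1, h2⟩
      have h3 := Projectivization.orthogonal_cross_left hxy
      have h4 := Projectivization.orthogonal_cross_right hxy
      rcases Configuration.ofField.eq_or_eq_of_orthogonal h1 h2 h3 h4 with h | h
      · exact absurd h hxy
      · exact h
    · rintro rfl
      exact ⟨Projectivization.orthogonal_cross_left hxy, Projectivization.orthogonal_cross_right hxy⟩
  have symm : ∀ x l : Pt F, inc x l ↔ inc l x := fun x l => Projectivization.orthogonal_comm
  have hp : ∀ x : Pt F, (univ.filter (fun l => inc x l)).card = q ^ 2 + 1 := by
    intro x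
    have := Configuration.ProjectivePlane.lineCount_eq (P := Pt F) (L := Pt F) x
    rw [ho] at this
    rw [← this]
    unfold Configuration.lineCount
    rw [Nat.card_eq_fintype_card, Fintype.card_subtype]
    rfl
  refine ⟨?_, hp, key, ?_, card_pt D, card_pt D⟩
  · intro l
    rw [← hp l]; congr 1; ext x; simp [symm x l]
  · intro l m h
    rw [← key l m h]; congr 1; ext x; simp [symm x l, symm x m]

/-- independence of three vectors -/
def Ind3 (F : Type) [Field F] {V : Type} [AddCommGroup V] [Module F V] (u x z : V) : Prop :=
  ∀ a b c : F, a • u + b • x + c • z = 0 → a = 0 ∧ b = 0 ∧ c = 0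

section
variable {V : Type} [AddCommGroup V] [Module F V] {u x z : V}

theorem Ind3.n1 (h : Ind3 F u x z) : u ≠ 0 := by
  rintro rfl
  have := (h 1 0 0 (by simp)).1
  exact one_ne_zero this

theorem Ind3.n2 (h : Ind3 F u x z) (t : F) : x + t • u ≠ 0 := by
  intro h0
  have := (h t 1 0 (by rw [← h0]; module)).2.1
  exact one_ne_zero this

theorem Ind3.n3 (h : Ind3 F u x z) (s t : F) : z + s • x + t • u ≠ 0 := by
  intro h0
  have := (h t s 1 (by rw [← h0]; module)).2.2
  exact one_ne_zero this

end

/-- parametrisation of a line -/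
theorem sum_line (D : FD F p q) {u x z : Fin 3 → F} (h : Ind3 F u x z) {l : Pt F}
    (h1 : inc (.mk F u h.n1) l) (h2 : inc (.mk F (x + (0 : F) • u) (h.n2 0)) l) (f : Pt F → ℕ) :
    ∑ y ∈ univ.filter (fun y => inc y l), f y
      = f (.mk F u h.n1) + ∑ t : F, f (.mk F (x + t • u) (h.n2 t)) := by
  set g : Option F → Pt F := fun o => match o with
    | none => .mk F u h.n1
    | some t => .mk F (x + t • u) (h.n2 t) with hg
  have hinj : Function.Injective g := by
    rintro (_ | t) (_ | t') hh
    · rfl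
    · exfalso
      simp only [hg, Projectivization.mk_eq_mk_iff'] at hh
      obtain ⟨a, ha⟩ := hh
      have := h (a * t' - 1) a 0 (by rw [← sub_eq_zero] at ha; rw [← ha]; module)
      rw [this.2.1] at this; simp at this
    · exfalso
      simp only [hg, Projectivization.mk_eq_mk_iff'] at hh
      obtain ⟨a, ha⟩ := hh
      have := h (a - t) (-1) 0 (by rw [← sub_eq_zero] at ha; rw [← ha]; module)
      simp at this
    · simp only [hg, Projectivization.mk_eq_mk_iff'] at hh
      obtain ⟨a, ha⟩ := hh
      have := h (a * t' - t) (a - 1) 0 (by rw [← sub_eq_zero] at ha; rw [← ha]; module)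
      have h1 : a = 1 := sub_eq_zero.1 this.2.1
      have h2 := sub_eq_zero.1 this.1
      rw [h1, one_mul] at h2
      rw [h2]
  have himg : Finset.univ.image g = univ.filter (fun y => inc y l) := by
    apply Finset.eq_of_subset_of_card_le
    · intro y hy
      simp only [Finset.mem_image, Finset.mem_univ, true_and] at hy
      obtain ⟨o, rfl⟩ := hy
      simp only [Finset.mem_filter, Finset.mem_univ, true_and]
      rw [inc_mk_rep] at h1 h2
      rcases o with _ | t
      · simp only [hg]; rwa [inc_mk_rep]
      · simp only [hg]; rw [inc_mk_rep]
        simp only [add_dotProduct, smul_dotProduct, zero_smul, h1, smul_zero, add_zero] at h2 ⊢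
        exact h2
    · rw [(inc_PPl D).hl, Finset.card_image_of_injective _ hinj, Finset.card_univ, Fintype.card_option, D.hF]
  rw [← himg, Finset.sum_image (fun a _ b _ hab => hinj hab), Fintype.sum_option]

/-- parametrisation of the plane -/
theorem sum_plane (D : FD F p q) {u x z : Fin 3 → F} (h : Ind3 F u x z) (f : Pt F → ℕ) :
    ∑ y, f y = f (.mk F u h.n1) + ∑ t : F, f (.mk F (x + t • u) (h.n2 t))
      + ∑ s : F, ∑ t : F, f (.mk F (z + s • x + t • u) (h.n3 s t)) := by
  set g : Option F ⊕ (F × F) → Pt F := fun o => match o with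
    | .inl none => .mk F u h.n1
    | .inl (some t) => .mk F (x + t • u) (h.n2 t)
    | .inr (s, t) => .mk F (z + s • x + t • u) (h.n3 s t) with hg
  have hinj : Function.Injective g := by
    rintro ((_ | t) | ⟨s, t⟩) ((_ | t') | ⟨s', t'⟩) hh
    · rfl
    · exfalso
      simp only [hg, Projectivization.mk_eq_mk_iff'] at hh
      obtain ⟨a, ha⟩ := hh
      have := h (a * t' - 1) a 0 (by rw [← sub_eq_zero] at ha; rw [← ha]; module)
      rw [this.2.1] at this; simp at this
    · exfalso
      simp only [hg, Projectivization.mk_eq_mk_iff'] at hh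
      obtain ⟨a, ha⟩ := hh
      have := h (a * t' - 1) (a * s') a (by rw [← sub_eq_zero] at ha; rw [← ha]; module)
      rw [this.2.2] at this; simp at this
    · exfalso
      simp only [hg, Projectivization.mk_eq_mk_iff'] at hh
      obtain ⟨a, ha⟩ := hh
      have := h (a - t) (-1) 0 (by rw [← sub_eq_zero] at ha; rw [← ha]; module)
      simp at this
    · simp only [hg, Projectivization.mk_eq_mk_iff'] at hh
      obtain ⟨a, ha⟩ := hh
      have := h (a * t' - t) (a - 1) 0 (by rw [← sub_eq_zero] at ha; rw [← ha]; module)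
      have h1 : a = 1 := sub_eq_zero.1 this.2.1
      have h2 := sub_eq_zero.1 this.1
      rw [h1, one_mul] at h2
      rw [h2]
    · exfalso
      simp only [hg, Projectivization.mk_eq_mk_iff'] at hh
      obtain ⟨a, ha⟩ := hh
      have := h (a * t' - t) (a * s' - 1) a (by rw [← sub_eq_zero] at ha; rw [← ha]; module)
      rw [this.2.2] at this; simp at this
    · exfalso
      simp only [hg, Projectivization.mk_eq_mk_iff'] at hh
      obtain ⟨a, ha⟩ := hh
      have := h (a - t) (-s) (-1) (by rw [← sub_eq_zero] at ha; rw [← ha]; module)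
      simp at this
    · exfalso
      simp only [hg, Projectivization.mk_eq_mk_iff'] at hh
      obtain ⟨a, ha⟩ := hh
      have := h (a * t' - t) (a - s) (-1) (by rw [← sub_eq_zero] at ha; rw [← ha]; module)
      simp at this
    · simp only [hg, Projectivization.mk_eq_mk_iff'] at hh
      obtain ⟨a, ha⟩ := hh
      have := h (a * t' - t) (a * s' - s) (a - 1) (by rw [← sub_eq_zero] at ha; rw [← ha]; module)
      have h1 : a = 1 := sub_eq_zero.1 this.2.2
      have h2 := sub_eq_zero.1 this.1
      have h3 := sub_eq_zero.1 this.2.1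
      rw [h1, one_mul] at h2 h3
      rw [h2, h3]
  have hbij : Function.Bijective g := by
    rw [Fintype.bijective_iff_injective_and_card]
    refine ⟨hinj, ?_⟩
    rw [card_pt D, Fintype.card_sum, Fintype.card_option, Fintype.card_prod, D.hF]; ring
  rw [← hbij.sum_comp, Fintype.sum_sum_type, Fintype.sum_option, Fintype.sum_prod_type]

/-- codewords -/
def IsCode (c : Pt F → F) : Prop :=
  ∃ (ι : Type) (_ : Fintype ι) (β : ι → F) (φ : ι → (Fin 3 → F) →ₗ[F] F),
    ∀ y (hy : y ≠ 0), c (.mk F y hy) = ∑ i, β i * if φ i y = 0 then 1 else 0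

open Polynomial in
theorem poly_fun (D : FD F p q) (a b d : F) (k : ℕ) : ∃ P : F[X], P.natDegree ≤ k ∧
    ∀ s, ∑ t : F, t ^ k * (if a + s * b + t * d = 0 then 1 else 0) = P.eval s := by
  by_cases hd : d = 0
  · subst hd
    by_cases hk : k < q ^ 2 - 1
    · refine ⟨0, by simp, fun s => ?_⟩
      simp only [mul_zero, add_zero, eval_zero]
      rw [← Finset.sum_mul, D.psum hk, zero_mul]
    · refine ⟨C (∑ t : F, t ^ k) * (1 - (C a + C b * X) ^ (q ^ 2 - 1)), ?_, fun s => ?_⟩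
      · refine (natDegree_C_mul_le _ _).trans ?_
        refine (natDegree_sub_le _ _).trans ?_
        simp only [natDegree_one]
        refine max_le (by omega) (natDegree_pow_le.trans ?_)
        have : (C a + C b * X : F[X]).natDegree ≤ 1 := by
          refine (natDegree_add_le _ _).trans (max_le (by simp) ((natDegree_C_mul_le _ _).trans (by simp)))
        nlinarith
      · simp only [mul_zero, add_zero]
        rw [← Finset.sum_mul]
        simp only [eval_mul, eval_C, eval_sub, eval_one, eval_pow, eval_add, eval_X]
        congr 1
        by_cases h0 : a + s * b = 0
        · have h1 : a + b * s = 0 := by rw [← h0]; ring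
          have := D.one_lt_Q
          rw [if_pos h0, h1, zero_pow (by omega), sub_zero]
        · have h1 : a + b * s ≠ 0 := by intro h; apply h0; rw [← h]; ring
          rw [if_neg h0, ← D.hF, FiniteField.pow_card_sub_one_eq_one _ h1, sub_self]
  · refine ⟨(C (-a / d) + C (-b / d) * X) ^ k, ?_, fun s => ?_⟩
    · refine natDegree_pow_le.trans ?_
      have : (C (-a / d) + C (-b / d) * X : F[X]).natDegree ≤ 1 := by
        refine (natDegree_add_le _ _).trans (max_le (by simp) ((natDegree_C_mul_le _ _).trans (by simp)))
      nlinarith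
    · rw [Finset.sum_eq_single (-(a + s * b) / d)]
      · rw [if_pos (by field_simp; ring)]
        simp only [eval_add, eval_pow, eval_mul, eval_C, eval_X, mul_one]
        congr 1
        field_simp; ring
      · intro t _ ht
        rw [if_neg, mul_zero]
        intro h0; apply ht
        field_simp
        linear_combination h0
      · simp

theorem IsCode.sub {c c' : Pt F → F} (h : IsCode c) (h' : IsCode c') : IsCode (fun x => c x - c' x) := by
  obtain ⟨ι, i1, β, φ, h⟩ := h
  obtain ⟨ι', i1', β', φ', h'⟩ := h'
  refine ⟨ι ⊕ ι', inferInstance, Sum.elim β (fun i => - β' i), Sum.elim φ φ', fun y hy => ?_⟩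
  beta_reduce
  rw [h y hy, h' y hy, Fintype.sum_sum_type]
  simp only [Sum.elim_inl, Sum.elim_inr, neg_mul, Finset.sum_neg_distrib]
  rw [← sub_eq_add_neg]
  congr 1

theorem isCode_mlt (K : Finset (Pt F)) : IsCode (fun x => ((mlt inc K x : ℕ) : F)) := by
  refine ⟨K, inferInstance, fun _ => 1,
    fun l => ∑ j, (l.1.rep j) • LinearMap.proj j, fun y hy => ?_⟩
  unfold mlt
  beta_reduce
  rw [Finset.card_filter]
  rw [Nat.cast_sum]
  simp only [Nat.cast_ite, Nat.cast_one, Nat.cast_zero]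
  rw [← Finset.sum_coe_sort K]
  refine Finset.sum_congr rfl fun l _ => ?_
  rw [one_mul]
  have : inc (.mk F y hy) l.1 ↔ (∑ j, (l.1.rep j) • LinearMap.proj (R := F) (φ := fun _ : Fin 3 => F) j) y = 0 := by
    rw [inc_mk_rep]
    simp only [LinearMap.sum_apply, LinearMap.smul_apply, LinearMap.proj_apply, smul_eq_mul, dotProduct]
    simp only [mul_comm]
  by_cases h : inc (.mk F y hy) l.1
  · rw [if_pos h, if_pos (this.1 h)]
  · rw [if_neg h, if_neg (fun h2 => h (this.2 h2))]

theorem IsCode.HK (D : FD F p q) {c : Pt F → F} (hc : IsCode c) : HKp inc (q ^ 2) c := by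
  obtain ⟨ι, i1, β, φ, h⟩ := hc
  intro u m m' hu hum hum' hne
  have pl := inc_PPl (F := F) D
  have hQ := D.one_lt_Q
  have get : ∀ l : Pt F, ∃ x, x ≠ u ∧ inc x l := by
    intro l
    by_contra hno
    push Not at hno
    have h1 := pl.hl l
    have h2 : (univ.filter (fun x => inc x l)).card ≤ 1 := by
      rw [Finset.card_le_one]
      intro a ha b hb
      simp only [Finset.mem_filter, Finset.mem_univ, true_and] at ha hb
      rw [by_contra fun h => hno a h ha, by_contra fun h => hno b h hb]
    omega
  obtain ⟨x, hxu, hxm⟩ := get m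
  obtain ⟨z, hzu, hzm⟩ := get m'
  have hzm' : ¬ inc z m := by
    intro hz
    have := pl.h2p z u hzu
    rw [Finset.card_eq_one] at this
    obtain ⟨a, ha⟩ := this
    have h1 : m ∈ ({a} : Finset (Pt F)) := by rw [← ha]; simp [hz, hum]
    have h2 : m' ∈ ({a} : Finset (Pt F)) := by rw [← ha]; simp [hzm, hum']
    simp only [Finset.mem_singleton] at h1 h2
    exact hne (h1.trans h2.symm)
  induction u using Projectivization.ind with | h u0 hu0 => ?_
  induction x using Projectivization.ind with | h x0 hx0 => ?_
  induction z using Projectivization.ind with | h z0 hz0 => ?_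
  have hum0 := hum
  have hum0' := hum'
  rw [inc_mk_rep] at hum hum' hxm hzm hzm'
  have hI : Ind3 F u0 z0 x0 := by
    intro a b d h0
    have h1 := congrArg (fun y => y ⬝ᵥ m.rep) h0
    simp only [add_dotProduct, smul_dotProduct, hum, hxm, smul_zero, zero_add, add_zero, zero_dotProduct, smul_eq_mul, mul_zero] at h1
    have hb := (mul_eq_zero.1 h1).resolve_right hzm'
    subst hb
    simp only [zero_smul, add_zero] at h0
    have hd : d = 0 := by
      by_contra hd
      apply hxu
      rw [Projectivization.mk_eq_mk_iff']
      refine ⟨-(d⁻¹ * a), ?_⟩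
      have : x0 = d⁻¹ • (d • x0) := by rw [smul_smul, inv_mul_cancel₀ hd, one_smul]
      rw [this, eq_neg_iff_add_eq_zero.2 ((add_comm _ _).trans h0)]
      module
    subst hd
    simp only [zero_smul, add_zero] at h0
    exact ⟨(smul_eq_zero.1 h0).resolve_right hu0, rfl, rfl⟩
  have hI' : Ind3 F u0 x0 z0 := by
    intro a b d h0
    have := hI a d b (by rw [← h0]; module)
    tauto
  set T := univ.filter (fun y => c y ≠ 0) with hT
  have cT : ∀ l, cnt inc T l = ∑ y ∈ univ.filter (fun y => inc y l), if c y ≠ 0 then 1 else 0 := by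
    intro l
    unfold cnt
    rw [← Finset.card_filter, hT, Finset.filter_filter, Finset.filter_filter]
    congr 1; ext y; simp [and_comm]
  have cm := sum_line D hI' (l := m) hum0 (by rw [inc_mk_rep]; simpa using hxm) (fun y => if c y ≠ 0 then 1 else 0)
  have cm' := sum_line D hI (l := m') hum0' (by rw [inc_mk_rep]; simpa using hzm) (fun y => if c y ≠ 0 then 1 else 0)
  have cp := sum_plane D hI (fun y => if c y ≠ 0 then 1 else 0)
  rw [← cT] at cm cm'
  rw [if_neg (by simpa using hu), zero_add] at cm cm'
  rw [if_neg (by simpa using hu), zero_add, ← cm', ← Finset.card_filter] at cp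
  set A : F → F → F := fun s t => ∑ i, β i * if φ i x0 + s * φ i z0 + t * φ i u0 = 0 then 1 else 0 with hA
  have eA : ∀ s t, c (.mk F (x0 + s • z0 + t • u0) (hI.n3 s t)) = A s t := by
    intro s t
    rw [h _ (hI.n3 s t)]
    simp only [map_add, map_smul, smul_eq_mul, hA]
  have eA0 : ∀ t, c (.mk F (x0 + t • u0) (hI'.n2 t)) = A 0 t := by
    intro t
    rw [h _ (hI'.n2 t)]
    simp only [map_add, map_smul, smul_eq_mul, hA, zero_mul, add_zero]
  simp only [eA, eA0] at cm cp
  choose P hP1 hP2 using fun i k => poly_fun D (φ i x0) (φ i z0) (φ i u0) k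
  have := hankel A (fun k => ∑ i, Polynomial.C (β i) * P i k) (by
    intro k
    apply Polynomial.natDegree_sum_le_of_forall_le
    intro i _
    exact (Polynomial.natDegree_C_mul_le _ _).trans (hP1 i k)) (by
    intro s k
    simp only [Polynomial.eval_finset_sum, Polynomial.eval_mul, Polynomial.eval_C, ← hP2, hA, Finset.mul_sum]
    rw [Finset.sum_comm]
    refine Finset.sum_congr rfl fun i _ => Finset.sum_congr rfl fun t _ => ?_
    ring) 0
  rw [D.hF] at this
  simp only [Finset.card_filter] at this
  rw [← cm] at this
  change cnt inc T m * (q ^ 2 + 1) + cnt inc T m' ≤ T.card + cnt inc T m ^ 2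
  have e : T.card = cnt inc T m' + ∑ s : F, ∑ t : F, if A s t ≠ 0 then 1 else 0 := cp
  omega

end P7

open Module Matrix

section P5
open scoped Classical
open Finset

variable {P L : Type} [Fintype P] [Fintype L] {I : P → L → Prop} {Q p q : ℕ}
  {R : Type} [Ring R] [Nontrivial R] {S : Finset P} {K : Finset L}

/-- the line set attached to a plane section -/
structure KS (R : Type) [Ring R] [Nontrivial R] (I : P → L → Prop) (p q Q : ℕ) (S : Finset P) (K : Finset L) : Prop where
  ps : PSec R I p q Q S
  hK : ∀ l, l ∈ K ↔ Q + 1 ≤ cnt I S l + q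
  h0 : sdif R I S K = ∅
  k1 : 1 ≤ K.card
  k2 : K.card ≤ q + 2

theorem KS.mR (h : KS R I p q Q S K) (x : P) : (mlt I K x : R) = if x ∈ S then 1 else 0 := by
  have h1 : x ∉ sdif R I S K := by rw [h.h0]; simp
  rw [mem_sdif, not_not] at h1
  unfold dif at h1
  exact (sub_eq_zero.1 h1).symm

theorem KS.m_in (h : KS R I p q Q S K) {x : P} (hx : x ∈ S) : mlt I K x ≡ 1 [MOD p] := by
  haveI := h.ps.hchar
  have := h.mR x
  rw [if_pos hx] at this
  unfold Nat.ModEq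
  rw [← CharP.cast_eq_iff_mod_eq R]
  simpa using this

theorem KS.m_out (h : KS R I p q Q S K) {x : P} (hx : x ∉ S) : p ∣ mlt I K x := by
  haveI := h.ps.hchar
  have := h.mR x
  rw [if_neg hx] at this
  exact (CharP.cast_eq_zero_iff R p _).1 this

theorem KS.m_ge (h : KS R I p q Q S K) {x : P} (hx : 2 ≤ mlt I K x) : p ≤ mlt I K x := by
  by_cases hS : x ∈ S
  · have h1 := (Nat.modEq_iff_dvd' (by omega)).1 (h.m_in hS).symm
    have := Nat.le_of_dvd (by omega) h1
    omega
  · exact Nat.le_of_dvd (by omega) (h.m_out hS)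

theorem KS.m_one (h : KS R I p q Q S K) {x : P} (hx : mlt I K x = 1) : x ∈ S := by
  by_contra hS
  have := h.m_out hS
  rw [hx] at this
  have := Nat.dvd_one.1 this
  have := h.ps.p5
  omega

theorem KS.k_mod (h : KS R I p q Q S K) : K.card ≡ 1 [MOD p] := by
  haveI := h.ps.hchar
  have : ∃ l, l ∉ K := by
    by_contra hno
    push Not at hno
    have h1 := h.ps.pl.hL
    rw [← Finset.card_univ] at h1
    have h2 := Finset.card_le_card (fun l _ => hno l : (univ : Finset L) ⊆ K)
    have := h.k2
    have := h.ps.q25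
    omega
  obtain ⟨l, hl⟩ := this
  have h1 := h.ps.pl.sum_mlt_line K l
  rw [if_neg hl, add_zero] at h1
  have h2 := h.ps.hmod l
  refine Nat.ModEq.trans ?_ h2
  unfold Nat.ModEq
  rw [← CharP.cast_eq_iff_mod_eq R, ← h1]
  push_cast
  simp only [h.mR]
  unfold cnt
  rw [← Finset.sum_filter, Finset.sum_const, Finset.filter_filter, nsmul_eq_mul, mul_one]
  congr 2
  ext x; simp [and_comm]

theorem KS.k_le (h : KS R I p q Q S K) : K.card ≤ q + 1 := by
  by_contra hno
  have h1 := h.k2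
  have h2 : K.card = q + 2 := by omega
  have h3 := h.k_mod
  rw [h2] at h3
  have h4 : q + 1 ≡ 0 [MOD p] := Nat.ModEq.add_right_cancel' 1 h3
  have h5 : p ∣ q + 1 := (Nat.modEq_zero_iff_dvd).1 h4
  have h6 : p ∣ q := by rw [h.ps.hq]; exact dvd_pow_self p (by norm_num)
  have := Nat.dvd_one.1 ((Nat.dvd_add_right h6).1 h5)
  have := h.ps.p5
  omega

theorem PPl.uniq_line (h : PPl I Q) {x y : P} (hxy : x ≠ y) {l m : L} (h1 : I x l) (h2 : I y l)
    (h3 : I x m) (h4 : I y m) : l = m := by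
  have := h.h2p x y hxy
  rw [Finset.card_eq_one] at this
  obtain ⟨a, ha⟩ := this
  have h5 : l ∈ ({a} : Finset L) := by rw [← ha]; simp [h1, h2]
  have h6 : m ∈ ({a} : Finset L) := by rw [← ha]; simp [h3, h4]
  simp only [Finset.mem_singleton] at h5 h6
  exact h5.trans h6.symm

theorem PPl.meet (h : PPl I Q) {l m : L} (hlm : l ≠ m) : ∃ x, I x l ∧ I x m := by
  have := h.h2l l m hlm
  rw [Finset.card_eq_one] at this
  obtain ⟨a, ha⟩ := this
  have : a ∈ univ.filter (fun x => I x l ∧ I x m) := by rw [ha]; simp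
  exact ⟨a, by simpa using this⟩

theorem PPl.join (h : PPl I Q) {x y : P} (hlm : x ≠ y) : ∃ l, I x l ∧ I y l := h.dual.meet hlm

/-- points of multiplicity at least two on `l` -/
noncomputable def multPts (I : P → L → Prop) (K : Finset L) (l : L) : Finset P :=
  univ.filter (fun x => I x l ∧ 2 ≤ mlt I K x)

theorem KS.mult_bound (h : KS R I p q Q S K) {l : L} (hl : l ∈ K) :
    (p - 1) * (multPts I K l).card ≤ K.card - 1 := by
  have h1 := h.ps.pl.sum_mlt_line K l
  rw [if_pos hl] at h1
  have h2 : ∑ x ∈ univ.filter (fun x => I x l), (1 + if 2 ≤ mlt I K x then p - 1 else 0)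
      ≤ ∑ x ∈ univ.filter (fun x => I x l), mlt I K x := by
    apply Finset.sum_le_sum
    intro x hx
    simp only [Finset.mem_filter, Finset.mem_univ, true_and] at hx
    split_ifs with h3
    · have := h.m_ge h3; omega
    · have : 1 ≤ mlt I K x := Finset.card_pos.2 ⟨l, by simp [hl, hx]⟩
      omega
  rw [Finset.sum_add_distrib, ← Finset.card_eq_sum_ones, h.ps.pl.hl, h1, ← Finset.sum_filter,
    Finset.sum_const, Finset.filter_filter] at h2
  have h3 : (multPts I K l).card = (univ.filter (fun x => I x l ∧ 2 ≤ mlt I K x)).card := rfl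
  rw [h3, mul_comm]
  simp only [smul_eq_mul] at h2
  have := h.k1
  omega

theorem KS.mult_ge (h : KS R I p q Q S K) {l : L} (hl : l ∈ K) {x0 : P} (hx : ¬ I x0 l) :
    mlt I K x0 ≤ (multPts I K l).card := by
  unfold mlt
  have hex : ∀ m : L, ∃ x, m ∈ K → I x0 m → (I x m ∧ I x l) := by
    intro m
    by_cases hm : I x0 m
    · have : m ≠ l := by rintro rfl; exact hx hm
      obtain ⟨x, h1⟩ := h.ps.pl.meet this
      exact ⟨x, fun _ _ => h1⟩
    · exact ⟨x0, fun _ h2 => absurd h2 hm⟩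
  choose f hf using hex
  apply Finset.card_le_card_of_injOn f
  · intro m hm
    simp only [Finset.coe_filter, Set.mem_setOf_eq] at hm
    have h1 := hf m hm.1 hm.2
    simp only [multPts, Finset.coe_filter, Finset.mem_univ, true_and, Set.mem_setOf_eq]
    refine ⟨h1.2, ?_⟩
    have hml : m ≠ l := by rintro rfl; exact hx hm.2
    have : ({m, l} : Finset L) ⊆ K.filter (fun l => I (f m) l) := by
      intro a ha
      simp only [Finset.mem_insert, Finset.mem_singleton] at ha
      rcases ha with rfl | rfl
      · simp [hm.1, h1.1]
      · simp [hl, h1.2]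
    have := Finset.card_le_card this
    rwa [Finset.card_pair hml] at this
  · intro a ha b hb hab
    simp only [Finset.coe_filter, Set.mem_setOf_eq] at ha hb
    have h1 := hf a ha.1 ha.2
    have h2 := hf b hb.1 hb.2
    have hne : x0 ≠ f a := by
      intro h3; rw [← h3] at h1; exact hx h1.2
    have hab' : f a = f b := hab
    exact h.ps.pl.uniq_line hne ha.2 h1.1 hb.2 (by rw [hab']; exact h2.1)

/-- not a pencil -/
def NP (I : P → L → Prop) (K : Finset L) : Prop := ∀ x, mlt I K x ≠ K.card

theorem NP.off (h : NP I K) (x : P) : ∃ l ∈ K, ¬ I x l := by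
  by_contra hno
  push Not at hno
  apply h x
  unfold mlt
  rw [Finset.filter_true_of_mem hno]

theorem KS.np_bound (h : KS R I p q Q S K) (hn : NP I K) (x : P) : (p - 1) * mlt I K x ≤ K.card - 1 := by
  obtain ⟨l, hl, hx⟩ := hn.off x
  exact (Nat.mul_le_mul_left _ (h.mult_ge hl hx)).trans (h.mult_bound hl)

theorem KS.np_le (h : KS R I p q Q S K) (hn : NP I K) (x : P) : mlt I K x ≤ p + 1 := by
  have h1 := h.np_bound hn x
  have h2 := h.k_le
  have h3 := h.ps.hq
  have h5 := h.ps.p5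
  by_contra hno
  have h4 : (p - 1) * (p + 2) ≤ (p - 1) * mlt I K x := Nat.mul_le_mul_left _ (by omega)
  have h6 : (p - 1) * (p + 2) ≤ p ^ 2 := by omega
  obtain ⟨m, rfl⟩ : ∃ m, p = m + 1 := ⟨p - 1, by omega⟩
  simp only [Nat.add_sub_cancel] at h6
  nlinarith

theorem KS.np_k (h : KS R I p q Q S K) (hn : NP I K) :
    K.card + p = q + 1 ∨ K.card = q + 1 := by
  have hk1 := h.k1
  have h5 := h.ps.p5
  -- two lines
  obtain ⟨l, hl⟩ := Finset.card_pos.1 hk1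
  have hQ := h.ps.q25
  obtain ⟨x, hx⟩ : ∃ x, I x l := by
    have := h.ps.pl.hl l
    have : (univ.filter (fun x => I x l)).Nonempty := by rw [← Finset.card_pos]; omega
    obtain ⟨x, hx⟩ := this
    exact ⟨x, by simpa using hx⟩
  obtain ⟨l', hl', hx'⟩ := hn.off x
  have hne : l ≠ l' := by rintro rfl; exact hx' hx
  obtain ⟨y, hy⟩ := h.ps.pl.meet hne
  have h2 : 2 ≤ mlt I K y := by
    have : ({l, l'} : Finset L) ⊆ K.filter (fun l => I y l) := by
      intro a ha
      simp only [Finset.mem_insert, Finset.mem_singleton] at ha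
      rcases ha with rfl | rfl
      · simp [hl, hy.1]
      · simp [hl', hy.2]
    have := Finset.card_le_card this
    rwa [Finset.card_pair hne] at this
  have h3 := h.m_ge h2
  have h4 := h.np_bound hn y
  have h6 := h.k_le
  obtain ⟨a, ha⟩ := (Nat.modEq_iff_dvd' hk1).1 h.k_mod.symm
  have h7 : (p - 1) * p ≤ K.card - 1 := (Nat.mul_le_mul_left _ h3).trans h4
  rw [ha, mul_comm] at h7
  have h8 : p - 1 ≤ a := Nat.le_of_mul_le_mul_left h7 (by omega)
  have h9 : p * a ≤ p * p := by rw [← ha, ← sq, ← h.ps.hq]; omega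
  have h10 : a ≤ p := Nat.le_of_mul_le_mul_left h9 (by omega)
  have h11 : q = p * p := by rw [h.ps.hq, sq]
  rcases (by omega : a = p - 1 ∨ a = p) with h12 | h12
  · left
    subst h12
    have : p * (p - 1) + p = p * p := by
      obtain ⟨m, rfl⟩ : ∃ m, p = m + 1 := ⟨p - 1, by omega⟩
      simp; ring
    omega
  · right; subst h12; omega

theorem KS.np_card (h : KS R I p q Q S K) (hk : K.card = q + 1) :
    (q + 1) * (Q - p) ≤ S.card := by
  have h5 := h.ps.p5
  have h1 : ∀ l ∈ K, Q - p ≤ cnt I (univ.filter (fun x => mlt I K x = 1)) l := by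
    intro l hl
    have h2 := h.mult_bound hl
    have h3 : (multPts I K l).card ≤ p + 1 := by
      by_contra hno
      have h4 : (p - 1) * (p + 2) ≤ (p - 1) * (multPts I K l).card := Nat.mul_le_mul_left _ (by omega)
      have h6 : (p - 1) * (p + 2) ≤ p ^ 2 := by rw [← h.ps.hq]; omega
      obtain ⟨m, rfl⟩ : ∃ m, p = m + 1 := ⟨p - 1, by omega⟩
      simp only [Nat.add_sub_cancel] at h6
      nlinarith
    have h4 := h.ps.pl.hl l
    have h6 : univ.filter (fun x => I x l) ⊆
        (univ.filter (fun x => mlt I K x = 1)).filter (fun x => I x l) ∪ multPts I K l := by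
      intro x hx
      simp only [Finset.mem_filter, Finset.mem_univ, true_and] at hx
      have : 1 ≤ mlt I K x := Finset.card_pos.2 ⟨l, by simp [hl, hx]⟩
      simp only [Finset.mem_union, Finset.mem_filter, Finset.mem_univ, true_and, multPts, hx, and_true]
      omega
    have h7 := (Finset.card_le_card h6).trans (Finset.card_union_le _ _)
    unfold cnt
    omega
  have h2 := Finset.card_nsmul_le_sum K _ _ h1
  rw [← sum_mlt, smul_eq_mul, hk] at h2
  refine h2.trans ?_
  rw [Finset.sum_congr rfl (fun x hx => by simpa using hx : ∀ x ∈ univ.filter (fun x => mlt I K x = 1), mlt I K x = 1),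
    ← Finset.card_eq_sum_ones]
  apply Finset.card_le_card
  intro x hx
  simp only [Finset.mem_filter, Finset.mem_univ, true_and] at hx
  exact h.m_one hx

/-- a hole on a long line is not compatible with a pencil -/
theorem KS.hole_np (h : KS R I p q Q S K) {v : P} (hv : v ∉ S) {l : L} (hl : l ∈ K) (hvl : I v l) : NP I K := by
  intro x hx
  have h5 := h.ps.p5
  have h1 := h.m_out hv
  have h2 : 1 ≤ mlt I K v := Finset.card_pos.2 ⟨l, by simp [hl, hvl]⟩
  have h3 := Nat.le_of_dvd (by omega) h1
  have hall : ∀ m ∈ K, I x m := by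
    unfold mlt at hx
    exact fun m hm => (Finset.card_filter_eq_iff.1 hx) m hm
  have hvx : v ≠ x := by
    rintro rfl
    rw [hx] at h1
    have h4 := (Nat.modEq_zero_iff_dvd).2 h1
    have := (h.k_mod.symm.trans h4).symm
    have := Nat.dvd_one.1 ((Nat.modEq_zero_iff_dvd).1 this.symm)
    omega
  have h4 : mlt I K v ≤ 1 := by
    unfold mlt
    rw [Finset.card_le_one]
    intro a ha b hb
    simp only [Finset.mem_filter] at ha hb
    exact h.ps.pl.uniq_line hvx ha.2 (hall a ha.1) hb.2 (hall b hb.1)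
  omega

/-- choosing a generic line through the hole -/
theorem KS.generic_line (h : KS R I p q Q S K) (hn : NP I K) (hk : K.card = q + 1) {v : P} (hv : v ∉ S)
    {l : L} (hl : l ∈ K) (hvl : I v l) : ∃ m, I v m ∧ cnt I S m + p = q + 1 := by
  have h5 := h.ps.p5
  obtain ⟨hq5, hq25, hQ25⟩ := h.ps.q25
  have h1 := h.m_out hv
  have h2 : 1 ≤ mlt I K v := Finset.card_pos.2 ⟨l, by simp [hl, hvl]⟩
  have h3 := Nat.le_of_dvd (by omega) h1
  have h4 := h.np_le hn v
  have hmv : mlt I K v = p := by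
    obtain ⟨a, ha⟩ := h1
    rw [ha] at h3 h4 ⊢
    have : a ≤ 1 := by
      by_contra hh
      have : p * 2 ≤ p * a := Nat.mul_le_mul_left _ (by omega)
      omega
    interval_cases a <;> omega
  set T := univ.filter (fun x => 2 ≤ mlt I K x) with hT
  have hTc : T.card ≤ 2 * (q + 1) := by
    have e := h.ps.pl.sum_mlt_pairs K
    have e2 : (T.card : ℤ) * (p * (p - 1)) ≤ ∑ x, ((mlt I K x : ℤ) * (mlt I K x - 1)) := by
      rw [← nsmul_eq_mul, ← Finset.sum_const, hT, Finset.sum_filter]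
      apply Finset.sum_le_sum
      intro x _
      split_ifs with h6
      · have h7 : (p : ℤ) ≤ mlt I K x := by exact_mod_cast h.m_ge h6
        have h8 : (5 : ℤ) ≤ p := by exact_mod_cast h5
        nlinarith
      · rcases (by omega : mlt I K x = 0 ∨ mlt I K x = 1) with h7 | h7 <;> simp [h7]
    rw [e, hk] at e2
    have hq' : (q : ℤ) = p * p := by rw [h.ps.hq]; push_cast; ring
    have h8 : (5 : ℤ) ≤ p := by exact_mod_cast h5
    by_contra hno
    have h9 : (2 * (q + 1) : ℤ) ≤ T.card := by exact_mod_cast (by omega : 2 * (q + 1) ≤ T.card)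
    have h10 : (2 * (q + 1) : ℤ) * (p * (p - 1)) ≤ T.card * (p * (p - 1)) :=
      mul_le_mul_of_nonneg_right h9 (by nlinarith)
    push_cast at e2
    rw [hq'] at e2 h10
    have h11 : (0 : ℤ) < p * p + 1 := by nlinarith
    have h12 : (p * p + 1 : ℤ) * (2 * (p * (p - 1))) ≤ (p * p + 1) * (p * p) := by nlinarith
    have := le_of_mul_le_mul_left h12 h11
    nlinarith
  -- bad lines
  have hex : ∃ m, I v m ∧ m ∉ K ∧ ∀ x, I x m → x ≠ v → mlt I K x ≤ 1 := by
    by_contra hno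
    push Not at hno
    have hj : ∀ x, ∃ m, x ≠ v → I v m ∧ I x m := by
      intro x
      by_cases hx : x = v
      · exact ⟨l, fun h => absurd hx h⟩
      · obtain ⟨m, hm⟩ := h.ps.pl.join hx
        exact ⟨m, fun _ => ⟨hm.2, hm.1⟩⟩
    choose f hf using hj
    have hsub : univ.filter (fun m => I v m) ⊆ K.filter (fun m => I v m) ∪ T.image f := by
      intro m hm
      simp only [Finset.mem_filter, Finset.mem_univ, true_and] at hm
      simp only [Finset.mem_union, Finset.mem_filter, hm, and_true, Finset.mem_image]
      by_cases hmK : m ∈ K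
      · exact Or.inl hmK
      · right
        obtain ⟨x, h6, h7, h8⟩ := hno m hm hmK
        refine ⟨x, by simp only [hT, Finset.mem_filter, Finset.mem_univ, true_and]; omega, ?_⟩
        have h9 := hf x h7
        exact h.ps.pl.uniq_line h7 h9.2 h9.1 h6 hm
    have h6 := (Finset.card_le_card hsub).trans (Finset.card_union_le _ _)
    rw [h.ps.pl.hp] at h6
    have h7 : (T.image f).card ≤ T.card := Finset.card_image_le
    have h8 : (K.filter (fun m => I v m)).card = p := hmv
    omega
  obtain ⟨m, hm, hmK, hall⟩ := hex
  refine ⟨m, hm, ?_⟩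
  have h6 := h.ps.pl.sum_mlt_line K m
  rw [if_neg hmK, add_zero, hk] at h6
  rw [← h6, ← Finset.add_sum_erase _ _ (by simp [hm] : v ∈ univ.filter (fun x => I x m)), hmv, add_comm]
  congr 1
  have : ∀ x ∈ (univ.filter (fun x => I x m)).erase v, mlt I K x = if x ∈ S then 1 else 0 := by
    intro x hx
    simp only [Finset.mem_erase, Finset.mem_filter, Finset.mem_univ, true_and] at hx
    have h7 := hall x hx.2 hx.1
    split_ifs with hS
    · rcases (by omega : mlt I K x = 0 ∨ mlt I K x = 1) with h8 | h8
      · have h9 := h.m_in hS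
        rw [h8] at h9
        have := Nat.dvd_one.1 ((Nat.modEq_zero_iff_dvd).1 h9.symm)
        omega
      · exact h8
    · have h8 := h.m_out hS
      by_contra h9
      have := Nat.le_of_dvd (by omega) h8
      omega
  rw [Finset.sum_congr rfl this, ← Finset.card_filter]
  unfold cnt
  congr 1
  ext x
  simp only [Finset.mem_filter, Finset.mem_erase, Finset.mem_univ, true_and]
  constructor
  · rintro ⟨h7, h8⟩; exact ⟨⟨fun h9 => hv (h9 ▸ h7), h8⟩, h7⟩
  · rintro ⟨⟨_, h7⟩, h8⟩; exact ⟨h8, h7⟩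

/-- the pencil case -/
theorem KS.pencil (h : KS R I p q Q S K) {x0 : P} (hx : mlt I K x0 = K.card) {m : L} (hm : cnt I S m + p = q + 1)
    : ¬ I x0 m ∧ K.card + p = q + 1 ∧ x0 ∈ S ∧ S.card = K.card * Q + 1 ∧
      (∀ x ∈ S, ∀ y l, x ≠ x0 → I x l → I x0 l → I y l → y ∈ S) := by
  have h5 := h.ps.p5
  obtain ⟨hq5, hq25, hQ25⟩ := h.ps.q25
  have hall : ∀ m ∈ K, I x0 m := by
    unfold mlt at hx
    exact fun m hm => (Finset.card_filter_eq_iff.1 hx) m hm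
  have hx0 : x0 ∈ S := by
    by_contra hv
    have h1 := h.m_out hv
    rw [hx] at h1
    have h4 := (Nat.modEq_zero_iff_dvd).2 h1
    have := (h.k_mod.symm.trans h4).symm
    have := Nat.dvd_one.1 ((Nat.modEq_zero_iff_dvd).1 this.symm)
    omega
  have hle : ∀ x, x ≠ x0 → mlt I K x ≤ 1 := by
    intro x hxx
    unfold mlt
    rw [Finset.card_le_one]
    intro a ha b hb
    simp only [Finset.mem_filter] at ha hb
    exact h.ps.pl.uniq_line hxx ha.2 (hall a ha.1) hb.2 (hall b hb.1)
  have hiff : ∀ x, x ≠ x0 → mlt I K x = if x ∈ S then 1 else 0 := by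
    intro x hxx
    have h7 := hle x hxx
    split_ifs with hS
    · rcases (by omega : mlt I K x = 0 ∨ mlt I K x = 1) with h8 | h8
      · have h9 := h.m_in hS
        rw [h8] at h9
        have := Nat.dvd_one.1 ((Nat.modEq_zero_iff_dvd).1 h9.symm)
        omega
      · exact h8
    · have h8 := h.m_out hS
      by_contra h9
      have := Nat.le_of_dvd (by omega) h8
      omega
  have hmK : m ∉ K := by
    rw [h.hK]; omega
  have hline := h.ps.pl.sum_mlt_line K m
  rw [if_neg hmK, add_zero] at hline
  have hnot : ¬ I x0 m := by
    intro hxm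
    rw [← Finset.add_sum_erase _ _ (by simp [hxm] : x0 ∈ univ.filter (fun x => I x m)), hx] at hline
    have hz : ∑ x ∈ (univ.filter (fun x => I x m)).erase x0, mlt I K x = 0 := by omega
    rw [Finset.sum_eq_zero_iff] at hz
    have h1 : cnt I S m ≤ 1 := by
      unfold cnt
      rw [Finset.card_le_one]
      have : ∀ a ∈ S.filter (fun x => I x m), a = x0 := by
        intro a ha
        simp only [Finset.mem_filter] at ha
        by_contra hax
        have h2 := hz a (by simp [hax, ha.2])
        rw [hiff a hax, if_pos ha.1] at h2
        omega
      intro a ha b hb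
      rw [this a ha, this b hb]
    omega
  refine ⟨hnot, ?_, hx0, ?_, ?_⟩
  · rw [← hm, ← hline]
    congr 1
    rw [Finset.sum_congr rfl (fun x hxm => hiff x (by
      intro hh; rw [hh] at hxm; exact hnot (by simpa using hxm))), ← Finset.card_filter, Finset.filter_filter]
    unfold cnt
    congr 1; ext x; simp [and_comm]
  · have e := h.ps.pl.sum_mlt_univ K
    rw [← Finset.add_sum_erase _ _ (mem_univ x0), hx,
      Finset.sum_congr rfl (fun x hx => hiff x (Finset.ne_of_mem_erase hx)), ← Finset.card_filter] at e
    have e2 : (univ.erase x0).filter (fun x => x ∈ S) = S.erase x0 := by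
      ext x; simp
    rw [e2, Finset.card_erase_of_mem hx0] at e
    have : 1 ≤ S.card := Finset.card_pos.2 ⟨x0, hx0⟩
    have e3 : (Q + 1) * K.card = K.card * Q + K.card := by ring
    omega
  · intro x hxS y l hxx hxl hx0l hyl
    have h1 := hiff x hxx
    rw [if_pos hxS] at h1
    unfold mlt at h1
    rw [Finset.card_eq_one] at h1
    obtain ⟨a, ha⟩ := h1
    have : a ∈ K.filter (fun l => I x l) := by rw [ha]; simp
    simp only [Finset.mem_filter] at this
    have hal : a = l := h.ps.pl.uniq_line hxx this.2 (hall a this.1) hxl hx0l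
    subst hal
    by_cases hy : y = x0
    · rw [hy]; exact hx0
    · apply h.m_one
      have h2 : 1 ≤ mlt I K y := Finset.card_pos.2 ⟨a, by simp [this.1, hyl]⟩
      have := hle y hy
      omega

end P5

open Module Matrix

section P5b
open scoped Classical
open Finset

variable {F : Type} [Field F] [Fintype F] {p q : ℕ}

theorem grid {ι : Type} (T : Finset ι) (f g : ι → F) {n : ℕ} (hn : 2 ≤ n) (hnF : (n : F) ≠ 0)
    (hT : T.card = n * n)
    (hinj : ∀ a ∈ T, ∀ b ∈ T, f a = f b → g a = g b → a = b)
    (hf : ∀ x, (T.filter (fun a => f a = x)).card = 0 ∨ (T.filter (fun a => f a = x)).card = n)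
    (hg : ∀ x, (T.filter (fun a => g a = x)).card = 0 ∨ (T.filter (fun a => g a = x)).card = n)
    (hfg : ∀ x, (T.filter (fun a => f a + g a = x)).card = 0 ∨ (T.filter (fun a => f a + g a = x)).card = n) :
    False := by
  have himg : ∀ f : ι → F, (∀ x, (T.filter (fun a => f a = x)).card = 0 ∨ (T.filter (fun a => f a = x)).card = n) →
      (T.image f).card = n := by
    intro f hf
    have h1 := Finset.card_eq_sum_card_image f T
    have h2 : ∀ b ∈ T.image f, (T.filter (fun a => f a = b)).card = n := by
      intro b hb
      rcases hf b with h3 | h3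
      · rw [Finset.card_eq_zero] at h3
        simp only [Finset.mem_image] at hb
        obtain ⟨a, ha, hab⟩ := hb
        have : a ∈ T.filter (fun a => f a = b) := by simp [ha, hab]
        rw [h3] at this; simp at this
      · exact h3
    rw [Finset.sum_congr rfl h2, Finset.sum_const, hT, smul_eq_mul] at h1
    exact (Nat.eq_of_mul_eq_mul_right (by omega) h1).symm
  have key : ∀ x, (T.filter (fun a => f a + g a = x)).card = n →
      (n : F) * x = ∑ s ∈ T.image f, s + ∑ s ∈ T.image g, s := by
    intro x hx
    set U := T.filter (fun a => f a + g a = x) with hU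
    have hUm : ∀ a ∈ U, a ∈ T ∧ f a + g a = x := by intro a ha; simpa [hU] using ha
    have i1 : ∀ a ∈ U, ∀ b ∈ U, f a = f b → a = b := by
      intro a ha b hb hab
      have h1 := hUm a ha
      have h2 := hUm b hb
      refine hinj a h1.1 b h2.1 hab ?_
      have := h1.2.trans h2.2.symm
      rw [hab] at this
      exact add_left_cancel this
    have i2 : ∀ a ∈ U, ∀ b ∈ U, g a = g b → a = b := by
      intro a ha b hb hab
      have h1 := hUm a ha
      have h2 := hUm b hb
      refine hinj a h1.1 b h2.1 ?_ hab
      have := h1.2.trans h2.2.symm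
      rw [hab] at this
      exact add_right_cancel this
    have e1 : U.image f = T.image f := by
      apply Finset.eq_of_subset_of_card_le (Finset.image_subset_image (Finset.filter_subset _ _))
      rw [himg f hf, Finset.card_image_of_injOn (fun a ha b hb hab => i1 a ha b hb hab), hx]
    have e2 : U.image g = T.image g := by
      apply Finset.eq_of_subset_of_card_le (Finset.image_subset_image (Finset.filter_subset _ _))
      rw [himg g hg, Finset.card_image_of_injOn (fun a ha b hb hab => i2 a ha b hb hab), hx]
    rw [← e1, ← e2, Finset.sum_image (fun a ha b hb hab => i1 a ha b hb hab),
      Finset.sum_image (fun a ha b hb hab => i2 a ha b hb hab), ← Finset.sum_add_distrib,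
      Finset.sum_congr rfl (fun a ha => (hUm a ha).2), Finset.sum_const, hx, nsmul_eq_mul]
  have hI := himg (fun a => f a + g a) hfg
  obtain ⟨x, hx, y, hy, hxy⟩ := Finset.one_lt_card.1 (by omega : 1 < (T.image (fun a => f a + g a)).card)
  have hne : ∀ x ∈ T.image (fun a => f a + g a), (T.filter (fun a => f a + g a = x)).card = n := by
    intro b hb
    rcases hfg b with h3 | h3
    · rw [Finset.card_eq_zero] at h3
      simp only [Finset.mem_image] at hb
      obtain ⟨a, ha, hab⟩ := hb
      have : a ∈ T.filter (fun a => f a + g a = b) := by simp [ha, hab]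
      rw [h3] at this; simp at this
    · exact h3
  exact hxy (mul_left_cancel₀ hnF ((key x (hne x hx)).trans (key y (hne y hy)).symm))

theorem KS.small_np (D : FD F p q) {S K : Finset (Pt F)} (h : KS F (inc (F := F)) p q (q ^ 2) S K)
    (hn : NP inc K) (hk : K.card + p = q + 1) : False := by
  have h5 := h.ps.p5
  have hq := h.ps.hq
  have pl := h.ps.pl
  obtain ⟨hq5, hq25, hQ25⟩ := h.ps.q25
  have hm : ∀ x, mlt inc K x = 0 ∨ mlt inc K x = 1 ∨ mlt inc K x = p := by
    intro x
    by_cases h2 : 2 ≤ mlt inc K x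
    · have h3 := h.m_ge h2
      have h4 := h.np_bound hn x
      have h6 : K.card - 1 = (p - 1) * p := by
        obtain ⟨m, rfl⟩ : ∃ m, p = m + 1 := ⟨p - 1, by omega⟩
        simp only [Nat.add_sub_cancel]
        have : (m + 1) ^ 2 = m * (m + 1) + (m + 1) := by ring
        omega
      rw [h6] at h4
      have := Nat.le_of_mul_le_mul_left h4 (by omega)
      omega
    · omega
  -- a multiple point
  obtain ⟨z, hz⟩ : ∃ z, mlt inc K z = p := by
    obtain ⟨l, hl⟩ := Finset.card_pos.1 h.k1
    obtain ⟨x, hx⟩ := pl.dual.exists_line_thru l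
    obtain ⟨l', hl', hx'⟩ := hn.off x
    have hne : l ≠ l' := by rintro rfl; exact hx' hx
    obtain ⟨y, hy⟩ := pl.meet hne
    refine ⟨y, ?_⟩
    have h2 : 2 ≤ mlt inc K y := by
      have : ({l, l'} : Finset (Pt F)) ⊆ K.filter (fun l => inc y l) := by
        intro a ha
        simp only [Finset.mem_insert, Finset.mem_singleton] at ha
        rcases ha with rfl | rfl
        · simp [hl, hy.1]
        · simp [hl', hy.2]
      have := Finset.card_le_card this
      rwa [Finset.card_pair hne] at this
    rcases hm y with h3 | h3 | h3 <;> omega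
  obtain ⟨d0, d1, d2, hd0, hd1, hd2, h01, h02, h12⟩ := Finset.two_lt_card_iff.1
    (by unfold mlt at hz; omega : 2 < (K.filter (fun l => inc z l)).card)
  simp only [Finset.mem_filter] at hd0 hd1 hd2
  induction z using Projectivization.ind with | h z0 hz0 => ?_
  set T := K.filter (fun l => ¬ inc (.mk F z0 hz0) l) with hT
  have hTc : T.card = (p - 1) * (p - 1) := by
    have h1 := Finset.card_filter_add_card_filter_not (s := K) (fun l => inc (.mk F z0 hz0) l)
    have h2 : (K.filter (fun l => inc (.mk F z0 hz0) l)).card = p := hz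
    obtain ⟨m, rfl⟩ : ∃ m, p = m + 1 := ⟨p - 1, by omega⟩
    simp only [Nat.add_sub_cancel]
    have : (m + 1) ^ 2 = m * m + 2 * m + 1 := by ring
    change _ + T.card = _ at h1
    omega
  set nn : Pt F → Fin 3 → F := fun a => (a.rep ⬝ᵥ z0)⁻¹ • a.rep with hnn
  have hTz : ∀ a ∈ T, a.rep ⬝ᵥ z0 ≠ 0 := by
    intro a ha
    simp only [hT, Finset.mem_filter, inc_mk_rep] at ha
    rw [dotProduct_comm]; exact ha.2
  -- fibre lemma
  have fib : ∀ d ∈ K, inc (.mk F z0 hz0) d → ∀ y, (∀ x : F, y - x • z0 ≠ 0) → y ⬝ᵥ d.rep = 0 →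
      ∀ x, (T.filter (fun a => nn a ⬝ᵥ y = x)).card = 0 ∨ (T.filter (fun a => nn a ⬝ᵥ y = x)).card = p - 1 := by
    intro d hd hzd y hy hyd x
    have e : K.filter (fun l => inc (.mk F (y - x • z0) (hy x)) l)
        = insert d (T.filter (fun a => nn a ⬝ᵥ y = x)) := by
      ext a
      simp only [Finset.mem_filter, Finset.mem_insert, hT]
      have hia : inc (.mk F (y - x • z0) (hy x)) a ↔ a.rep ⬝ᵥ y = x * (a.rep ⬝ᵥ z0) := by
        rw [inc_mk_rep, dotProduct_comm, dotProduct_sub, dotProduct_smul, smul_eq_mul, sub_eq_zero]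
      constructor
      · rintro ⟨haK, hay⟩
        by_cases haz : inc (.mk F z0 hz0) a
        · left
          refine pl.uniq_line (x := .mk F (y - x • z0) (hy x)) (y := .mk F z0 hz0) ?_ hay haz ?_ hzd
          · intro hh
            rw [Projectivization.mk_eq_mk_iff'] at hh
            obtain ⟨c, hc⟩ := hh
            apply hy (x + c)
            rw [add_smul, hc]; abel
          · rw [inc_mk_rep] at hzd ⊢
            rw [sub_dotProduct, smul_dotProduct, hzd, hyd]; simp
        · right
          refine ⟨⟨haK, haz⟩, ?_⟩
          rw [hia] at hay
          rw [inc_mk_rep, dotProduct_comm] at haz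
          simp only [hnn, smul_dotProduct, smul_eq_mul, hay]
          field_simp
      · rintro (rfl | ⟨⟨haK, haz⟩, hax⟩)
        · refine ⟨hd, ?_⟩
          rw [inc_mk_rep] at hzd ⊢
          rw [sub_dotProduct, smul_dotProduct, hzd, hyd]; simp
        · refine ⟨haK, ?_⟩
          rw [hia, ← hax]
          rw [inc_mk_rep, dotProduct_comm] at haz
          simp only [hnn, smul_dotProduct, smul_eq_mul]
          field_simp
    have hc := congrArg Finset.card e
    rw [Finset.card_insert_of_notMem (by simp [hT, hzd])] at hc
    change mlt inc K _ = _ at hc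
    rcases hm (.mk F (y - x • z0) (hy x)) with h1 | h1 | h1 <;> omega
  -- points on the lines
  have get : ∀ l : Pt F, inc (.mk F z0 hz0) l → ∃ y : Fin 3 → F, y ⬝ᵥ l.rep = 0 ∧ ∀ x : F, y - x • z0 ≠ 0 := by
    intro l hl
    have h1 := pl.hl l
    obtain ⟨a, ha, b, hb, hab⟩ := Finset.one_lt_card.1 (by omega : 1 < (univ.filter (fun x => inc x l)).card)
    simp only [Finset.mem_filter, Finset.mem_univ, true_and] at ha hb
    obtain ⟨c, hc, hcz⟩ : ∃ c, inc c l ∧ c ≠ .mk F z0 hz0 := by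
      by_cases h3 : a = .mk F z0 hz0
      · exact ⟨b, hb, fun h4 => hab (h3.trans h4.symm)⟩
      · exact ⟨a, ha, h3⟩
    induction c using Projectivization.ind with | h c0 hc0 => ?_
    refine ⟨c0, (inc_mk_rep hc0 l).1 hc, fun x hx => hcz ?_⟩
    rw [Projectivization.mk_eq_mk_iff']
    exact ⟨x, (sub_eq_zero.1 hx).symm⟩
  -- a vector on two lines through z is proportional to z
  have two : ∀ l m : Pt F, inc (.mk F z0 hz0) l → inc (.mk F z0 hz0) m → l ≠ m → ∀ y : Fin 3 → F, (∀ x : F, y - x • z0 ≠ 0) →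
      y ⬝ᵥ l.rep = 0 → y ⬝ᵥ m.rep ≠ 0 := by
    intro l m hl hm hlm y hy hyl hym
    have hy0 : y ≠ 0 := by have := hy 0; simpa using this
    apply hlm
    refine pl.uniq_line (x := .mk F y hy0) (y := .mk F z0 hz0) ?_ ((inc_mk_rep hy0 l).2 hyl) hl ((inc_mk_rep hy0 m).2 hym) hm
    intro hh
    rw [Projectivization.mk_eq_mk_iff'] at hh
    obtain ⟨c, hc⟩ := hh
    apply hy c; rw [hc, sub_self]
  obtain ⟨y0, hy0, hy0'⟩ := get d0 hd0.2
  obtain ⟨y1, hy1, hy1'⟩ := get d1 hd1.2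
  have a1 := two d0 d2 hd0.2 hd2.2 h02 y0 hy0' hy0
  have a2 := two d1 d2 hd1.2 hd2.2 h12 y1 hy1' hy1
  have a3 := two d1 d0 hd1.2 hd0.2 (Ne.symm h01) y1 hy1' hy1
  set c := -(y1 ⬝ᵥ d2.rep) / (y0 ⬝ᵥ d2.rep) with hc
  have hc0 : c ≠ 0 := div_ne_zero (neg_ne_zero.2 a2) a1
  have hw : ∀ x : F, c • y0 - x • z0 ≠ 0 := by
    intro x hx
    apply hy0' (c⁻¹ * x)
    have : c • (y0 - (c⁻¹ * x) • z0) = 0 := by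
      rw [smul_sub, smul_smul, mul_inv_cancel_left₀ hc0]; exact hx
    exact (smul_eq_zero.1 this).resolve_left hc0
  have hsum : (c • y0 + y1) ⬝ᵥ d2.rep = 0 := by
    rw [add_dotProduct, smul_dotProduct, smul_eq_mul, hc]; field_simp; ring
  have hsum' : ∀ x : F, c • y0 + y1 - x • z0 ≠ 0 := by
    intro x hx
    have h1 := congrArg (fun y => y ⬝ᵥ d0.rep) hx
    have h2 := (inc_mk_rep hz0 d0).1 hd0.2
    simp only [sub_dotProduct, add_dotProduct, smul_dotProduct, hy0, h2, smul_zero, zero_add, sub_zero, zero_dotProduct] at h1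
    exact a3 h1
  haveI := D.charP
  refine grid T (fun a => nn a ⬝ᵥ (c • y0)) (fun a => nn a ⬝ᵥ y1) (n := p - 1) (by omega) ?_ hTc ?_ ?_ ?_ ?_
  · intro h0
    have := Nat.le_of_dvd (by omega) ((CharP.cast_eq_zero_iff F p (p - 1)).1 h0)
    omega
  · intro a ha b hb hab1 hab2
    have hza := hTz a ha
    have hzb := hTz b hb
    simp only [dotProduct_smul, smul_eq_mul] at hab1
    have hab1 := mul_left_cancel₀ hc0 hab1
    have hzz : nn a ⬝ᵥ z0 = nn b ⬝ᵥ z0 := by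
      simp only [hnn, smul_dotProduct, smul_eq_mul]
      rw [inv_mul_cancel₀ hza, inv_mul_cancel₀ hzb]
    have heq : nn a = nn b := by
      by_contra hne
      have he : nn a - nn b ≠ 0 := sub_ne_zero.2 hne
      have i0 : inc (.mk F z0 hz0) (.mk F _ he) := by
        rw [inc_mk, dotProduct_comm, sub_dotProduct, hzz, sub_self]
      have y0n : y0 ≠ 0 := by have := hy0' 0; simpa using this
      have y1n : y1 ≠ 0 := by have := hy1' 0; simpa using this
      have i1 : inc (.mk F y0 y0n) (.mk F _ he) := by
        rw [inc_mk, dotProduct_comm, sub_dotProduct, hab1, sub_self]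
      have i2 : inc (.mk F y1 y1n) (.mk F _ he) := by
        rw [inc_mk, dotProduct_comm, sub_dotProduct, hab2, sub_self]
      have j0 : Projectivization.mk F y0 y0n ≠ .mk F z0 hz0 := by
        intro hh
        rw [Projectivization.mk_eq_mk_iff'] at hh
        obtain ⟨c, hc⟩ := hh
        apply hy0' c; rw [hc, sub_self]
      have j1 : Projectivization.mk F y1 y1n ≠ .mk F z0 hz0 := by
        intro hh
        rw [Projectivization.mk_eq_mk_iff'] at hh
        obtain ⟨c, hc⟩ := hh
        apply hy1' c; rw [hc, sub_self]
      have k0 := pl.uniq_line j0 i1 i0 ((inc_mk_rep y0n d0).2 hy0) hd0.2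
      have k1 := pl.uniq_line j1 i2 i0 ((inc_mk_rep y1n d1).2 hy1) hd1.2
      exact h01 (k0.symm.trans k1)
    rw [← Projectivization.mk_rep a, ← Projectivization.mk_rep b, Projectivization.mk_eq_mk_iff']
    refine ⟨(a.rep ⬝ᵥ z0) * (b.rep ⬝ᵥ z0)⁻¹, ?_⟩
    have : (a.rep ⬝ᵥ z0) • nn a = (a.rep ⬝ᵥ z0) • nn b := by rw [heq]
    simp only [hnn, smul_smul] at this
    rw [mul_inv_cancel₀ hza, one_smul] at this
    exact this.symm
  · exact fib d0 hd0.1 hd0.2 (c • y0) hw (by rw [smul_dotProduct, hy0, smul_zero])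
  · exact fib d1 hd1.1 hd1.2 y1 hy1' hy1
  · intro x
    have := fib d2 hd2.1 hd2.2 (c • y0 + y1) hsum' hsum x
    simp only [dotProduct_add] at this
    exact this

end P5b

open Module Matrix

section P8a
open scoped Classical
open Finset

variable {F : Type} [Field F] [Fintype F] {p q : ℕ}
variable {V : Type} [AddCommGroup V] [Module F V] [Fintype V]

/-- a parametrisation of a plane -/
noncomputable def e3 (F : Type) [Field F] {V : Type} [AddCommGroup V] [Module F V] (v x z : V) :
    (Fin 3 → F) →ₗ[F] V where
  toFun y := y 0 • v + y 1 • x + y 2 • z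
  map_add' a b := by simp only [Pi.add_apply]; module
  map_smul' a b := by simp only [Pi.smul_apply, smul_eq_mul, RingHom.id_apply]; module

theorem e3_apply (v x z : V) (y : Fin 3 → F) : e3 F v x z y = y 0 • v + y 1 • x + y 2 • z := rfl

/-- a plane section of a cone -/
noncomputable def psec (F : Type) [Field F] [Fintype F] {V : Type} [AddCommGroup V] [Module F V]
    (X : Finset V) (v x z : V) : Finset (Pt F) :=
  univ.filter (fun P => e3 F v x z P.rep ∈ X)

theorem mem_psec {X : Finset V} (hX : IsCone F X) {v x z : V} {y : Fin 3 → F} (hy : y ≠ 0) :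
    Projectivization.mk F y hy ∈ psec F X v x z ↔ e3 F v x z y ∈ X := by
  simp only [psec, mem_filter, mem_univ, true_and]
  obtain ⟨a, ha⟩ := Projectivization.exists_smul_eq_mk_rep F y hy
  rw [← ha]
  have : a • y = (a : F) • y := rfl
  rw [this, map_smul, hX.smul_iff a.ne_zero]

theorem line_basis (D : FD F p q) {u : Fin 3 → F} (hu : u ≠ 0) (l : Pt F) (hul : u ⬝ᵥ l.rep = 0) :
    ∃ x z, Ind3 F u x z ∧ x ⬝ᵥ l.rep = 0 := by
  have pl := inc_PPl (F := F) D
  have hQ := D.one_lt_Q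
  have h1 : ∃ y ∈ univ.filter (fun y => inc y l), y ≠ Projectivization.mk F u hu := by
    by_contra hc
    push Not at hc
    have := pl.hl l
    have h2 : univ.filter (fun y => inc y l) ⊆ {Projectivization.mk F u hu} := by
      intro y hy; simpa using hc y hy
    have := Finset.card_le_card h2
    simp at this
    omega
  obtain ⟨x, hx, hxu⟩ := h1
  simp only [mem_filter, mem_univ, true_and] at hx
  obtain ⟨z, hz⟩ : ∃ z, ¬ inc z l := by
    by_contra hc
    push Not at hc
    have := pl.hl l
    rw [Finset.filter_true_of_mem (fun y _ => hc y), Finset.card_univ, pl.hP] at this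
    nlinarith
  have hx' : x.rep ⬝ᵥ l.rep = 0 := by
    rw [← inc_mk_rep x.rep_nonzero, Projectivization.mk_rep]; exact hx
  have hz' : z.rep ⬝ᵥ l.rep ≠ 0 := by
    rw [Ne, ← inc_mk_rep z.rep_nonzero, Projectivization.mk_rep]; exact hz
  refine ⟨x.rep, z.rep, ?_, hx'⟩
  intro a b c h0
  have h1 := congrArg (fun y => y ⬝ᵥ l.rep) h0
  simp only [add_dotProduct, smul_dotProduct, hul, hx', smul_zero, zero_add, zero_dotProduct, smul_eq_mul, mul_zero] at h1
  have hc := (mul_eq_zero.1 h1).resolve_right hz'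
  subst hc
  simp only [zero_smul, add_zero] at h0
  have hb : b = 0 := by
    by_contra hb
    apply hxu
    rw [← Projectivization.mk_rep x, Projectivization.mk_eq_mk_iff']
    refine ⟨-(b⁻¹ * a), ?_⟩
    have : x.rep = b⁻¹ • (b • x.rep) := by rw [smul_smul, inv_mul_cancel₀ hb, one_smul]
    rw [this, eq_neg_iff_add_eq_zero.2 ((add_comm _ _).trans h0)]
    module
  subst hb
  simp only [zero_smul, add_zero] at h0
  exact ⟨(smul_eq_zero.1 h0).resolve_right hu, rfl, rfl⟩

theorem cnt_psec (D : FD F p q) {X : Finset V} (hX : IsCone F X) (v x z : V)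
    {u x' z' : Fin 3 → F} (h : Ind3 F u x' z') {l : Pt F} (hul : u ⬝ᵥ l.rep = 0) (hxl : x' ⬝ᵥ l.rep = 0)
    (hu : e3 F v x z u ∉ X) :
    cnt inc (psec F X v x z) l = nv F X (e3 F v x z u) (e3 F v x z x') := by
  have h1 := sum_line D h (l := l) (by rwa [inc_mk_rep]) (by rw [inc_mk_rep]; simpa using hxl)
    (fun y => if y ∈ psec F X v x z then 1 else 0)
  simp only [mem_psec hX] at h1
  rw [if_neg hu, zero_add, ← Finset.card_filter, ← Finset.card_filter] at h1
  have e1 : cnt inc (psec F X v x z) l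
      = ((univ.filter (fun y => inc y l)).filter (fun y => y ∈ psec F X v x z)).card := by
    unfold cnt
    congr 1
    ext y; simp [and_comm]
  rw [e1, h1]
  unfold nv
  congr 1
  ext t
  simp

theorem psec_PSec (D : FD F p q) (hq : q = p ^ 2) (h5 : 5 ≤ p) {X : Finset V} (hX : IsCone F X)
    (R : CRep F q X) (v x z : V) : PSec F (inc (F := F)) p q (q ^ 2) (psec F X v x z) where
  pl := inc_PPl D
  p5 := h5
  hq := hq
  hQ := rfl
  hmod := by
    intro l
    by_cases hf : ∀ y, inc y l → y ∈ psec F X v x z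
    · have : cnt inc (psec F X v x z) l = q ^ 2 + 1 := by
        rw [← (inc_PPl D).hl l]
        unfold cnt
        congr 1
        ext y
        simp only [mem_filter, mem_univ, true_and]
        exact ⟨fun h => h.2, fun h => ⟨hf y h, h⟩⟩
      rw [this]
      have hd : p ∣ q ^ 2 := (D.p_dvd).trans (dvd_pow_self q two_ne_zero)
      have := (Nat.modEq_zero_iff_dvd.2 hd).add_right 1
      simpa using this
    · push Not at hf
      obtain ⟨y, hy, hyS⟩ := hf
      have hyl : y.rep ⬝ᵥ l.rep = 0 := by
        rw [← inc_mk_rep y.rep_nonzero, Projectivization.mk_rep]; exact hy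
      obtain ⟨x', z', hI, hx'⟩ := line_basis D y.rep_nonzero l hyl
      have hu : e3 F v x z y.rep ∉ X := by
        rw [← mem_psec hX y.rep_nonzero, Projectivization.mk_rep]; exact hyS
      rw [cnt_psec D hX v x z hI hyl hx' hu]
      exact R.nv_mod D hX hu _
  hk := by
    intro K
    apply IsCode.HK D
    refine IsCode.sub ⟨R.ι, R.fin, R.α, fun i => (R.φ i).comp (e3 F v x z), fun y hy => ?_⟩ (isCode_mlt K)
    have := R.rep (e3 F v x z y)
    simp only [LinearMap.comp_apply]
    rw [← this]
    simp only [mem_psec hX]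
  hchar := D.charP

theorem ind3_std : Ind3 F (![1, 0, 0] : Fin 3 → F) ![0, 1, 0] ![0, 0, 1] := by
  intro a b c h
  have h0 := congrFun h 0
  have h1 := congrFun h 1
  have h2 := congrFun h 2
  simp at h0 h1 h2
  exact ⟨h0, h1, h2⟩

theorem card_psec (D : FD F p q) {X : Finset V} (hX : IsCone F X) {v : V} (hv : v ∉ X) (x z : V) :
    (psec F X v x z).card = nv F X v x + gz F X v x z := by
  have h1 := sum_plane D (ind3_std (F := F)) (fun y => if y ∈ psec F X v x z then 1 else 0)
  simp only [mem_psec hX] at h1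
  simp only [e3_apply] at h1
  simp [hv] at h1
  rw [h1, gz]
  congr 1
  · rw [nv]; congr 1; ext t; simp [add_comm]
  · refine Finset.sum_congr rfl fun s _ => ?_
    rw [nv]; congr 1; ext t
    simp only [mem_filter, mem_univ, true_and]
    rw [show t • v + s • x + z = z + s • x + t • v by module]

end P8a

open Module Matrix

section P8b
open scoped Classical
open Finset

variable {F : Type} [Field F] [Fintype F] {p q : ℕ}
variable {V : Type} [AddCommGroup V] [Module F V] [Fintype V]

theorem std_line : ∃ l : Pt F, ∀ y : Fin 3 → F, y ⬝ᵥ l.rep = 0 ↔ y 2 = 0 := by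
  have h0 : (![0, 0, 1] : Fin 3 → F) ≠ 0 := by
    intro h; have := congrFun h 2; simp at this
  refine ⟨.mk F ![0, 0, 1] h0, fun y => ?_⟩
  by_cases hy : y = 0
  · simp [hy]
  · rw [← inc_mk_rep hy, inc_mk hy h0]
    simp [dotProduct, Fin.sum_univ_three]

theorem e3_0 (v x z : V) : e3 F v x z ![1, 0, 0] = v := by simp [e3_apply]
theorem e3_1 (v x z : V) : e3 F v x z ![0, 1, 0] = x := by simp [e3_apply]

theorem e0_ne : (![1, 0, 0] : Fin 3 → F) ≠ 0 := by
  intro h; have := congrFun h 0; simp at this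

theorem plane_cnt (D : FD F p q) {X : Finset V} (hX : IsCone F X) {v : V} (hv : v ∉ X) (x z : V)
    {l : Pt F} (hl : ∀ y : Fin 3 → F, y ⬝ᵥ l.rep = 0 ↔ y 2 = 0) :
    cnt inc (psec F X v x z) l = nv F X v x := by
  have := cnt_psec D hX v x z (ind3_std (F := F)) (l := l) (by rw [hl]; simp) (by rw [hl]; simp)
    (by rwa [e3_0])
  rwa [e3_0, e3_1] at this

theorem plane_dich (D : FD F p q) (hq : q = p ^ 2) (h5 : 5 ≤ p) {X : Finset V} (hX : IsCone F X)
    (R : CRep F q X) {v : V} (hv : v ∉ X) (x z : V)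
    (hN : nv F X v x + gz F X v x z + p ≤ q ^ 3 + q ^ 2 + 1) :
    nv F X v x ≤ q + 1 ∨ q ^ 2 + 1 ≤ nv F X v x + q := by
  obtain ⟨l, hl⟩ := std_line (F := F)
  have h := (psec_PSec D hq h5 hX R v x z).dich (by rwa [card_psec D hX hv]) l
  rwa [plane_cnt D hX hv x z hl] at h

theorem nv_le (D : FD F p q) (X : Finset V) (v x : V) : nv F X v x ≤ q ^ 2 := by
  unfold nv
  exact (Finset.card_le_univ _).trans_eq D.hF

theorem plane_gen (D : FD F p q) (hq : q = p ^ 2) (h5 : 5 ≤ p) {X : Finset V} (hX : IsCone F X)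
    (R : CRep F q X) {v : V} (hv : v ∉ X) (x z : V)
    (hN : nv F X v x + gz F X v x z + p ≤ q ^ 3 + q ^ 2 + 1) (hlong : q + 1 < nv F X v x) :
    ∃ w, nv F X v w + p = q + 1 := by
  obtain ⟨l, hl⟩ := std_line (F := F)
  have ps := psec_PSec D hq h5 hX R v x z
  have hc := plane_cnt D hX hv x z hl
  have hle := nv_le D X v x
  have hN' : (psec F X v x z).card + p ≤ q ^ 3 + q ^ 2 + 1 := by rwa [card_psec D hX hv]
  obtain ⟨K, hK, h0, h2, h1⟩ := ps.PL hN' ⟨l, by rw [hc]; refine ⟨?_, ?_, ?_⟩ <;> omega⟩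
  have ks : KS F inc p q (q ^ 2) (psec F X v x z) K := ⟨ps, hK, h0, h1, h2⟩
  have hlK : l ∈ K := by
    rw [hK]
    have := ps.dich hN' l
    omega
  have hvS : Projectivization.mk F ![1, 0, 0] e0_ne ∉ psec F X v x z := by
    rwa [mem_psec hX, e3_0]
  have hvl : inc (Projectivization.mk F ![1, 0, 0] e0_ne) l := by
    rw [inc_mk_rep, hl]; simp
  have hn := ks.hole_np hvS hlK hvl
  have hk : K.card = q + 1 := by
    rcases ks.np_k hn with h | h
    · exact (ks.small_np D hn h).elim
    · exact h
  obtain ⟨m, hm1, hm2⟩ := ks.generic_line hn hk hvS hlK hvl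
  rw [inc_mk_rep] at hm1
  obtain ⟨x', z', hI, hx'⟩ := line_basis D e0_ne m hm1
  rw [cnt_psec D hX v x z hI hm1 hx' (by rwa [e3_0]), e3_0] at hm2
  exact ⟨_, hm2⟩

theorem plane_thru (D : FD F p q) (hq : q = p ^ 2) (h5 : 5 ≤ p) {X : Finset V} (hX : IsCone F X)
    (R : CRep F q X) {v : V} (hv : v ∉ X) (w z : V) (hw : nv F X v w + p = q + 1)
    (hN : nv F X v w + gz F X v w z + p ≤ q ^ 3 + q ^ 2 + 1) :
    (q + 1) * (q ^ 2 - p) ≤ nv F X v w + gz F X v w z ∨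
    (nv F X v w + gz F X v w z = nv F X v w * q ^ 2 + 1 ∧
      ∃ a b : F, ∀ α β t : F, α • w + β • (z + a • w + b • v) + t • v ∈ X ↔ α • w + t • v ∈ X) := by
  obtain ⟨l, hl⟩ := std_line (F := F)
  have ps := psec_PSec D hq h5 hX R v w z
  have hc := plane_cnt D hX hv w z hl
  have hcard := card_psec D hX hv w z
  have hN' : (psec F X v w z).card + p ≤ q ^ 3 + q ^ 2 + 1 := by rwa [hcard]
  have hq25 := ps.q25
  obtain ⟨K, hK, h0, h2, h1⟩ := ps.PL hN' ⟨l, by rw [hc]; refine ⟨?_, ?_, ?_⟩ <;> omega⟩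
  have ks : KS F inc p q (q ^ 2) (psec F X v w z) K := ⟨ps, hK, h0, h1, h2⟩
  by_cases hn : NP inc K
  · left
    have hk : K.card = q + 1 := by
      rcases ks.np_k hn with h | h
      · exact (ks.small_np D hn h).elim
      · exact h
    rw [← hcard]
    exact ks.np_card hk
  · right
    unfold NP at hn
    push Not at hn
    obtain ⟨x0, hx0⟩ := hn
    obtain ⟨g1, g2, g3, g4, g5⟩ := ks.pencil hx0 (m := l) (by rwa [hc])
    refine ⟨?_, ?_⟩
    · rw [← hcard, g4]
      congr 2
      omega
    · set y := x0.rep with hy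
      have hy0 : y ≠ 0 := x0.rep_nonzero
      have hx0y : x0 = .mk F y hy0 := (Projectivization.mk_rep x0).symm
      have hy2 : y 2 ≠ 0 := by
        rw [hx0y, inc_mk_rep, hl] at g1; exact g1
      have hyX : e3 F v w z y ∈ X := by
        rw [hx0y, mem_psec hX] at g3; exact g3
      refine ⟨(y 2)⁻¹ * y 1, (y 2)⁻¹ * y 0, ?_⟩
      have he : z + ((y 2)⁻¹ * y 1) • w + ((y 2)⁻¹ * y 0) • v = (y 2)⁻¹ • e3 F v w z y := by
        rw [e3_apply]
        simp only [smul_add, smul_smul, inv_mul_cancel₀ hy2, one_smul]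
        abel
      rw [he]
      -- key: adding a multiple of the vertex
      have key : ∀ u : Fin 3 → F, (∀ c : F, u ≠ c • y) → ∀ c : F, e3 F v w z u ∈ X → e3 F v w z (u + c • y) ∈ X := by
        intro u hu c hX'
        have hu0 : u ≠ 0 := by intro h; exact hu 0 (by simp [h])
        have hu1 : u + c • y ≠ 0 := by
          intro h; apply hu (-c); rw [eq_neg_of_add_eq_zero_left h]; module
        have hne : Projectivization.mk F u hu0 ≠ x0 := by
          rw [hx0y, Ne, Projectivization.mk_eq_mk_iff']
          rintro ⟨a, ha⟩
          exact hu a ha.symm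
        obtain ⟨m, hm1, hm2⟩ := (inc_PPl D).join hne
        have := g5 _ ((mem_psec hX hu0).2 hX') (.mk F (u + c • y) hu1) m hne hm1 hm2 (by
          rw [inc_mk_rep] at hm1 ⊢
          rw [hx0y, inc_mk_rep] at hm2
          simp [add_dotProduct, smul_dotProduct, hm1, hm2])
        exact (mem_psec hX hu1).1 this
      intro α β t
      have e1 : α • w + t • v = e3 F v w z ![t, α, 0] := by
        simp [e3_apply, add_comm]
      have e2 : α • w + β • (y 2)⁻¹ • e3 F v w z y + t • v = e3 F v w z (![t, α, 0] + (β * (y 2)⁻¹) • y) := by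
        rw [map_add, ← e1, map_smul]; module
      rw [e1, e2]
      by_cases hz : (![t, α, 0] : Fin 3 → F) = 0
      · rw [hz, zero_add, map_smul, map_zero]
        refine ⟨fun _ => hX.zero, fun _ => ?_⟩
        by_cases hb : β * (y 2)⁻¹ = 0
        · rw [hb, zero_smul]; exact hX.zero
        · rwa [hX.smul_iff hb]
      · have hnp : ∀ c c' : F, (![t, α, 0] : Fin 3 → F) + c' • y ≠ c • y := by
          intro c c' h
          have h2 := congrFun h 2
          simp at h2
          rcases h2 with h2 | h2
          · apply hz
            rw [h2] at h
            exact add_eq_right.1 h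
          · exact hy2 h2
        constructor
        · intro hh
          have := key _ (fun c => hnp c _) (-(β * (y 2)⁻¹)) hh
          convert this using 2
          module
        · exact key _ (fun c => by simpa using hnp c 0) _

end P8b

open Module Matrix

section P9
open scoped Classical
open Finset

variable {F : Type} [Field F] [Fintype F] {p q : ℕ}
variable {V : Type} [AddCommGroup V] [Module F V] [Fintype V]

theorem powform_zero {ι : Type} (s : Finset ι) (β : ι → F) (θ : ι → V →ₗ[F] F) (k : ℕ) {z0 : V}
    (h0 : ∑ i ∈ s, β i * θ i z0 ^ k ≠ 0) :
    Fintype.card F * (univ.filter (fun z : V => ∑ i ∈ s, β i * θ i z ^ k = 0)).card ≤ k * Fintype.card V := by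
  set G : V → F := fun z => ∑ i ∈ s, β i * θ i z ^ k with hG
  have key : ∀ z : V, (univ.filter (fun c : F => G (z + c • z0) = 0)).card ≤ k := by
    intro z
    set P : Polynomial F := ∑ i ∈ s, Polynomial.C (β i) *
      (Polynomial.C (θ i z) + Polynomial.C (θ i z0) * Polynomial.X) ^ k with hP
    have hlin : ∀ i, (Polynomial.C (θ i z) + Polynomial.C (θ i z0) * Polynomial.X).natDegree ≤ 1 := by
      intro i
      rw [add_comm]; exact Polynomial.natDegree_linear_le
    have hdeg : P.natDegree ≤ k := by
      apply Polynomial.natDegree_sum_le_of_forall_le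
      intro i _
      refine (Polynomial.natDegree_C_mul_le _ _).trans ?_
      refine Polynomial.natDegree_pow_le.trans ?_
      have := hlin i
      nlinarith
    have hco : P.coeff k = G z0 := by
      rw [hP, Polynomial.finset_sum_coeff, hG]
      apply Finset.sum_congr rfl
      intro i _
      rw [Polynomial.coeff_C_mul]
      congr 1
      have := Polynomial.coeff_pow_of_natDegree_le (m := k) (hlin i)
      rw [mul_one] at this
      rw [this]
      simp
    have hev : ∀ c, P.eval c = G (z + c • z0) := by
      intro c
      rw [hP, Polynomial.eval_finset_sum, hG]
      apply Finset.sum_congr rfl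
      intro i _
      simp only [Polynomial.eval_mul, Polynomial.eval_C, Polynomial.eval_pow, Polynomial.eval_add,
        Polynomial.eval_X, map_add, map_smul, smul_eq_mul]
      ring
    have hP0 : P ≠ 0 := by
      intro h; rw [h] at hco; exact h0 hco.symm
    refine le_trans ?_ hdeg
    by_contra hc
    push Not at hc
    apply hP0
    apply Polynomial.eq_zero_of_natDegree_lt_card_of_eval_eq_zero' _ _ _ hc
    intro c hc'
    rw [hev]
    simpa using hc'
  have h1 : ∑ z : V, (univ.filter (fun c : F => G (z + c • z0) = 0)).card
      = Fintype.card F * (univ.filter (fun z : V => G z = 0)).card := by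
    simp_rw [Finset.card_filter]
    rw [Finset.sum_comm]
    rw [Finset.sum_congr rfl (g := fun _ => ∑ z : V, if G z = 0 then 1 else 0), Finset.sum_const, Finset.card_univ, smul_eq_mul]
    intro c _
    exact Fintype.sum_equiv (Equiv.addRight (c • z0)) _ _ (fun z => rfl)
  rw [← h1]
  refine (Finset.sum_le_sum (fun z _ => key z)).trans ?_
  simp [mul_comm]

theorem exists_j (D : FD F p q) (hq : q = p ^ 2) (h5 : 5 ≤ p) {X : Finset V} (hX : IsCone F X) (R : CRep F q X)
    {v w : V} (hv : v ∉ X) (hw : nv F X v w + p = q + 1) :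
    ∃ j, 1 ≤ j ∧ j ≤ q ∧ ¬ p ∣ j ∧ mom F X v j w ≠ 0 := by
  by_contra hc
  push Not at hc
  haveI := D.charP
  haveI : Fact p.Prime := ⟨D.hp⟩
  have hall : ∀ k, 1 ≤ k → k ≤ q → mom F X v k w = 0 := by
    intro k
    induction k using Nat.strong_induction_on with
    | _ k ih =>
      intro h1 h2
      by_cases hd : p ∣ k
      · obtain ⟨m, rfl⟩ := hd
        have hm : 1 ≤ m := by
          rcases Nat.eq_zero_or_pos m with rfl | h
          · simp at h1
          · exact h
        have hlt : m < p * m := by nlinarith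
        have := ih m hlt hm (by omega)
        rw [mom_eq_sum] at this ⊢
        have e : ∀ t : F, t ^ (p * m) = (t ^ m) ^ p := by intro t; rw [mul_comm, pow_mul]
        simp_rw [e]
        rw [← sum_pow_char, this, zero_pow (by omega)]
      · exact hc k h1 h2 hd
  have h0 := R.mom_zero D hX hv w
  have hlt : nv F X v w + 1 ≤ q + 1 := by omega
  have van := vandermonde_zero (f := fun t : F => (if w + t • v ∈ X then 1 else 0) - (if t = 0 then 1 else 0)) (K := q + 1)
    (by
      refine le_trans ?_ hlt
      have : univ.filter (fun t : F => ((if w + t • v ∈ X then (1 : F) else 0) - (if t = 0 then 1 else 0)) ≠ 0)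
        ⊆ univ.filter (fun t : F => w + t • v ∈ X) ∪ {0} := by
        intro t ht
        simp only [mem_filter, mem_univ, true_and, mem_union, mem_singleton] at ht ⊢
        by_contra hh
        push Not at hh
        rw [if_neg hh.1, if_neg hh.2] at ht
        simp at ht
      refine (Finset.card_le_card this).trans ((Finset.card_union_le _ _).trans ?_)
      simp [nv])
    (by
      intro k hk
      simp only [mul_sub, Finset.sum_sub_distrib]
      have e1 : ∑ t : F, t ^ k * (if w + t • v ∈ X then (1 : F) else 0) = mom F X v k w := rfl
      rw [e1]
      simp only [mul_ite, mul_one, mul_zero, Finset.sum_ite_eq', mem_univ, if_true]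
      rcases Nat.eq_zero_or_pos k with rfl | hk0
      · rw [h0]; simp
      · rw [hall k hk0 (by omega), zero_pow (by omega)]; simp)
  have h1 : nv F X v w ≤ 1 := by
    unfold nv
    refine (Finset.card_le_card (t := {0}) ?_).trans (by simp)
    intro t ht
    simp only [mem_filter, mem_univ, true_and] at ht
    have := van t
    simp only [ht, if_true] at this
    by_contra h
    rw [if_neg (by simpa using h)] at this
    simp at this
  nlinarith

/-- projection to the kernel of the first moment -/
noncomputable def CRep.prj {X : Finset V} (R : CRep F q X) (v : V) : V →ₗ[F] V :=
  LinearMap.id + (R.lam v).smulRight v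

theorem CRep.prj_apply {X : Finset V} (R : CRep F q X) (v z : V) : R.prj v z = z + R.lam v z • v := rfl

/-- the plane through `v, w, z` is a pencil section -/
def PenC (F : Type) [Field F] {V : Type} [AddCommGroup V] [Module F V] (X : Finset V) (v w z : V) : Prop :=
  ∃ a b : F, ∀ α β t : F, α • w + β • (z + a • w + b • v) + t • v ∈ X ↔ α • w + t • v ∈ X

theorem exists_yh (D : FD F p q) {X : Finset V} (hX : IsCone F X) (R : CRep F q X)
    {v w : V} (hv : v ∉ X) (hlw : R.lam v w = 0) {j : ℕ} (h1 : 1 ≤ j) (hj : j < q ^ 2 - 1) (hpj : ¬ p ∣ j)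
    (hc : mom F X v j w ≠ 0) :
    ∃ yh : V →ₗ[F] F, ∀ z, PenC F X v w z → ∀ k < q ^ 2 - 1,
      mom F X v k (R.prj v z) = mom F X v k w * (yh z) ^ k := by
  haveI := D.charP
  have hj0 : (j : F) ≠ 0 := by
    intro h; exact hpj ((CharP.cast_eq_zero_iff F p j).1 h)
  refine ⟨(mom F X v j w)⁻¹ • ((∑ i ∈ univ.filter (fun i => R.φ i v ≠ 0),
    (R.α i * R.ψ v i w ^ (j - 1)) • R.ψ v i).comp (R.prj v)), ?_⟩
  rintro z ⟨a, b, hab⟩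
  have hm : ∀ k < q ^ 2 - 1, ∀ α β : F, mom F X v k (α • w + β • (z + a • w + b • v)) = α ^ k * mom F X v k w := by
    intro k hk α β
    rw [← R.mom_smul' D v hk]
    unfold mom
    simp_rw [hab]
  have hb : b = R.lam v z := by
    have hq1 : 1 < q ^ 2 - 1 := by omega
    have h2 := hm 1 hq1 0 1
    rw [← R.lam_eq D] at h2
    simp [hlw, R.lam_self D hX hv] at h2
    linear_combination -h2
  have hz : R.prj v z = z + b • v := by rw [R.prj_apply, hb]
  have hpz : ∀ s : F, w + s • R.prj v z = (1 - s * a) • w + s • (z + a • w + b • v) := by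
    intro s; rw [hz]; module
  have hpz' : R.prj v z = (-a) • w + (1 : F) • (z + a • w + b • v) := by
    rw [hz]; module
  have hP : R.momPoly v j w (R.prj v z) = Polynomial.C (mom F X v j w) * (1 - Polynomial.C a * Polynomial.X) ^ j := by
    rw [← sub_eq_zero]
    have hlin : (1 - Polynomial.C a * Polynomial.X).natDegree ≤ 1 := by
      have e : (1 - Polynomial.C a * Polynomial.X) = Polynomial.C (-a) * Polynomial.X + Polynomial.C 1 := by
        simp; ring
      rw [e]; exact Polynomial.natDegree_linear_le
    apply Polynomial.eq_zero_of_natDegree_lt_card_of_eval_eq_zero' _ (univ : Finset F)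
    · intro s _
      rw [Polynomial.eval_sub, R.momPoly_eval D v hj, hpz, hm j hj]
      simp
      ring
    · rw [Finset.card_univ, D.hF]
      refine lt_of_le_of_lt (Polynomial.natDegree_sub_le_of_le (R.momPoly_natDegree v j _ _) (n := j) ?_) (by omega)
      refine (Polynomial.natDegree_C_mul_le _ _).trans ?_
      refine Polynomial.natDegree_pow_le.trans ?_
      nlinarith
  have hder := congrArg (fun P => (Polynomial.derivative P).eval 0) hP
  simp only [CRep.momPoly, Polynomial.derivative_sum, Polynomial.eval_finset_sum] at hder
  simp [Polynomial.derivative_pow] at hder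
  have hyh : ((mom F X v j w)⁻¹ • ((∑ i ∈ univ.filter (fun i => R.φ i v ≠ 0),
    (R.α i * R.ψ v i w ^ (j - 1)) • R.ψ v i).comp (R.prj v))) z = -a := by
    simp only [LinearMap.smul_apply, LinearMap.comp_apply, LinearMap.sum_apply, smul_eq_mul]
    rw [inv_mul_eq_iff_eq_mul₀ hc]
    apply mul_left_cancel₀ hj0
    rw [Finset.mul_sum]
    calc _ = _ := ?_
      _ = _ := hder
      _ = _ := by ring
    apply Finset.sum_congr rfl
    intro i _
    ring
  intro k hk
  rw [hyh, mul_comm, hpz', hm k hk]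

end P9

open Module Matrix

section P10
open scoped Classical
open Finset

variable {F : Type} [Field F] [Fintype F] {p q : ℕ}
variable {V : Type} [AddCommGroup V] [Module F V] [Fintype V]

theorem below_plane (D : FD F p q) (h5 : 5 ≤ p) {X : Finset V} (hX : IsCone F X)
    (R : CRep F q X) (hU : q ^ 4 * X.card ≤ Fintype.card V * (q ^ 3 + 1)) (hV : q ^ 4 ≤ Fintype.card V)
    {v : V} (hv : v ∉ X) {x : V} (hlong : q + 1 < nv F X v x) :
    ∃ z, nv F X v x + gz F X v x z + p ≤ q ^ 3 + q ^ 2 + 1 := by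
  have hq2 := D.two_le
  have hv0 : v ≠ 0 := by rintro rfl; exact hv hX.zero
  have hi : LinearIndependent F ![v, x] := by
    rw [LinearIndependent.pair_iff]
    intro s t hst
    by_cases ht : t = 0
    · subst ht
      simp at hst
      exact ⟨hst.resolve_right hv0, rfl⟩
    · exfalso
      have hx : x = 0 + (-(t⁻¹ * s)) • v := by
        have : x = t⁻¹ • (t • x) := by rw [smul_smul, inv_mul_cancel₀ ht, one_smul]
        rw [this, eq_neg_iff_add_eq_zero.2 ((add_comm _ _).trans hst)]
        module
      rw [hx, nv_shift, nv_zero hX hv] at hlong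
      omega
  have hmod := R.nv_mod D hX hv x
  have hle := nv_le D X v x
  obtain ⟨z, _, hz⟩ := exists_below D hX hv hi (q ^ 3 + 1) (by
    have h1 : (Fintype.card V - q ^ 4) * (q ^ 3 + 1) + q ^ 4 * (q ^ 3 + 1) = Fintype.card V * (q ^ 3 + 1) := by
      rw [← add_mul]; congr 1; omega
    have h2 : q ^ 3 + 1 < 1 + (q ^ 2 - 1) * nv F X v x := by
      have h3 : (q ^ 2 - 1) * (q + 2) ≤ (q ^ 2 - 1) * nv F X v x := Nat.mul_le_mul_left _ (by omega)
      have h4 : q ^ 3 < (q ^ 2 - 1) * (q + 2) := by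
        obtain ⟨m, hm⟩ : ∃ m, q ^ 2 = m + 1 := ⟨q ^ 2 - 1, by have := D.one_lt_Q; omega⟩
        have : q ^ 2 - 1 = m := by omega
        rw [this]
        have e3 : q ^ 3 = q ^ 2 * q := by ring
        rw [e3, hm]
        nlinarith
      omega
    have h3 : q ^ 4 * (q ^ 3 + 1) < q ^ 4 * (1 + (q ^ 2 - 1) * nv F X v x) :=
      Nat.mul_lt_mul_of_pos_left h2 (by positivity)
    omega)
  refine ⟨z, ?_⟩
  have h6 : nv F X v x + p ≤ q ^ 2 + 1 := by
    have hd : p ∣ q ^ 2 := (D.p_dvd).trans (dvd_pow_self q two_ne_zero)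
    have hd2 := (Nat.modEq_iff_dvd' (by omega : 1 ≤ nv F X v x)).1 hmod.symm
    obtain ⟨a, ha⟩ := hd
    obtain ⟨b, hb⟩ := hd2
    have hba : b < a := by
      by_contra hh
      have : p * a ≤ p * b := Nat.mul_le_mul_left _ (by omega)
      omega
    have : p * (b + 1) ≤ p * a := Nat.mul_le_mul_left _ hba
    rw [mul_add, mul_one] at this
    omega
  omega

theorem dich_all (D : FD F p q) (hq : q = p ^ 2) (h5 : 5 ≤ p) {X : Finset V} (hX : IsCone F X)
    (R : CRep F q X) (hU : q ^ 4 * X.card ≤ Fintype.card V * (q ^ 3 + 1)) (hV : q ^ 4 ≤ Fintype.card V)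
    {v : V} (hv : v ∉ X) (x : V) : nv F X v x ≤ q + 1 ∨ q ^ 2 + 1 ≤ nv F X v x + q := by
  by_cases hl : q + 1 < nv F X v x
  · obtain ⟨z, hz⟩ := below_plane D h5 hX R hU hV hv hl
    exact plane_dich D hq h5 hX R hv x z hz
  · left; omega

theorem count_pen (D : FD F p q) (hq : q = p ^ 2) (h5 : 5 ≤ p) {X : Finset V} (hX : IsCone F X)
    (R : CRep F q X) (hU : q ^ 4 * X.card ≤ Fintype.card V * (q ^ 3 + 1))
    {v w : V} (hv : v ∉ X) (hw : nv F X v w + p = q + 1) :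
    2 * q * Fintype.card V < q ^ 2 * (univ.filter (fun z => PenC F X v w z)).card := by
  have hpt : ∀ z : V, q ^ 3 + q ^ 2 ≤ gz F X v w z + (p * q + q + 1) + (if PenC F X v w z then p * q ^ 2 else 0) := by
    intro z
    by_cases hN : nv F X v w + gz F X v w z + p ≤ q ^ 3 + q ^ 2 + 1
    · rcases plane_thru D hq h5 hX R hv w z hw hN with h | ⟨h1, h2⟩
      · have hpq : p ≤ q ^ 2 := by rw [hq]; nlinarith [Nat.pow_le_pow_left h5 3]
        obtain ⟨m, hm⟩ := Nat.exists_eq_add_of_le hpq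
        have hm' : q ^ 2 - p = m := by omega
        rw [hm'] at h
        have e3 : q ^ 3 = q * (p + m) := by rw [← hm]; ring
        have : (q + 1) * m = q * m + m := by ring
        have e4 : q * (p + m) = p * q + q * m := by ring
        omega
      · rw [if_pos (show PenC F X v w z from h2)]
        have e1 : nv F X v w * q ^ 2 + p * q ^ 2 = q ^ 3 + q ^ 2 := by
          rw [← add_mul, hw]; ring
        omega
    · omega
  have hsum := Finset.sum_le_sum (fun (z : V) (_ : z ∈ univ) => hpt z)
  simp only [Finset.sum_add_distrib] at hsum
  rw [sum_gz D, ← Finset.sum_filter] at hsum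
  simp only [Finset.sum_const, Finset.card_univ, smul_eq_mul] at hsum
  set Γ := (univ.filter (fun z => PenC F X v w z)).card
  have hV0 : 0 < Fintype.card V := Fintype.card_pos
  set N := Fintype.card V
  by_contra hc
  push Not at hc
  have h1 : p * (q ^ 2 * Γ) ≤ p * (2 * q * N) := Nat.mul_le_mul_left _ hc
  have h2 : N * (q ^ 3 + q ^ 2) ≤ N * (q ^ 3 + 1) + N * (p * q + q + 1) + N * (2 * p * q) := by
    have e1 : p * (q ^ 2 * Γ) = Γ * (p * q ^ 2) := by ring
    have e2 : p * (2 * q * N) = N * (2 * p * q) := by ring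
    rw [mul_add N (q ^ 3), mul_add N (p * q + q), mul_add N (p * q)]
    omega
  rw [← mul_add, ← mul_add] at h2
  have h3 := Nat.le_of_mul_le_mul_left h2 hV0
  have h4 : q ^ 2 ≤ 3 * p * q + q + 2 := by nlinarith
  have h5' : 5 * (p * q) ≤ q ^ 2 := by
    have : q ^ 2 = p * (p * q) := by rw [hq]; ring
    rw [this]; exact Nat.mul_le_mul_right _ h5
  have h6 : 5 * q ≤ p * q := Nat.mul_le_mul_right _ h5
  have := D.two_le
  nlinarith

theorem rigid (D : FD F p q) (hq : q = p ^ 2) (h5 : 5 ≤ p) {X : Finset V} (hX : IsCone F X)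
    (R : CRep F q X) (hU : q ^ 4 * X.card ≤ Fintype.card V * (q ^ 3 + 1))
    {v w : V} (hv : v ∉ X) (hw : nv F X v w + p = q + 1) (hlw : R.lam v w = 0) :
    ∃ yh : V →ₗ[F] F, ∀ z, ∀ k ≤ 2 * q, mom F X v k (R.prj v z) = mom F X v k w * (yh z) ^ k := by
  obtain ⟨j, j1, j2, j3, j4⟩ := exists_j D hq h5 hX R hv hw
  have hq25 : 25 ≤ q := by rw [hq]; nlinarith
  have hbig : 2 * q < q ^ 2 - 1 := by
    have : 25 * q ≤ q ^ 2 := by nlinarith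
    omega
  obtain ⟨yh, hyh⟩ := exists_yh D hX R hv hlw j1 (by omega) j3 j4
  refine ⟨yh, fun z k hk => ?_⟩
  by_contra hne
  set β : Option R.ι → F := fun o => o.elim (-mom F X v k w) R.α with hβ
  set θ : Option R.ι → V →ₗ[F] F := fun o => o.elim yh (fun i => (R.ψ v i).comp (R.prj v)) with hθ
  set s : Finset (Option R.ι) := insertNone (univ.filter (fun i => R.φ i v ≠ 0)) with hs
  have hG : ∀ z, ∑ o ∈ s, β o * θ o z ^ k = mom F X v k (R.prj v z) - mom F X v k w * (yh z) ^ k := by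
    intro z
    rw [hs, Finset.sum_insertNone, R.mom_eq D v (by omega) (R.prj v z)]
    simp only [hβ, hθ, Option.elim, LinearMap.comp_apply]
    ring
  have h1 := powform_zero s β θ k (z0 := z) (by rw [hG]; exact sub_ne_zero.2 hne)
  have h2 : (univ.filter (fun z => PenC F X v w z)).card
      ≤ (univ.filter (fun z : V => ∑ i ∈ s, β i * θ i z ^ k = 0)).card := by
    apply Finset.card_le_card
    intro y hy
    simp only [mem_filter, mem_univ, true_and] at hy ⊢
    rw [hG, hyh y hy k (by omega), sub_self]
  have h3 := count_pen D hq h5 hX R hU hv hw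
  rw [D.hF] at h1
  have h4 := Nat.mul_le_mul_left (q ^ 2) h2
  have h5 : k * Fintype.card V ≤ 2 * q * Fintype.card V := Nat.mul_le_mul_right _ hk
  omega

theorem no_long (D : FD F p q) (hq : q = p ^ 2) (h5 : 5 ≤ p) {X : Finset V} (hX : IsCone F X)
    (R : CRep F q X) (hU : q ^ 4 * X.card ≤ Fintype.card V * (q ^ 3 + 1)) (hV : q ^ 4 ≤ Fintype.card V)
    {v : V} (hv : v ∉ X) (x : V) : nv F X v x ≤ q + 1 := by
  by_contra hlong
  push Not at hlong
  haveI := D.charP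
  have hq25 : 25 ≤ q := by rw [hq]; nlinarith
  have hbig : 25 * q ≤ q ^ 2 := by nlinarith
  obtain ⟨z, hz⟩ := below_plane D h5 hX R hU hV hv hlong
  obtain ⟨w0, hw0⟩ := plane_gen D hq h5 hX R hv x z hz hlong
  set w := w0 + R.lam v w0 • v with hwdef
  have hw : nv F X v w + p = q + 1 := by rw [hwdef, nv_shift]; exact hw0
  have hlw : R.lam v w = 0 := by
    rw [hwdef, map_add, map_smul, R.lam_self D hX hv]; simp
  obtain ⟨yh, hyh⟩ := rigid D hq h5 hX R hU hv hw hlw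
  have hx' : nv F X v (R.prj v x) = nv F X v x := by rw [R.prj_apply, nv_shift]
  set x' := R.prj v x with hx'def
  set y := yh x with hy
  have hmom := hyh x
  rw [← hx'def, ← hy] at hmom
  have hlong2 : q ^ 2 + 1 ≤ nv F X v x' + q := by
    rcases dich_all D hq h5 hX R hU hV hv x' with h | h
    · omega
    · exact h
  set A0 := univ.filter (fun t : F => w + t • v ∈ X) with hA0
  have cA0 : A0.card + p = q + 1 := hw
  set g : F → F := fun t => ∑ a ∈ A0, if y * a = t then 1 else 0 with hg
  have gmom : ∀ k, ∑ t, t ^ k * g t = mom F X v k w * y ^ k := by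
    intro k
    simp only [hg, Finset.mul_sum]
    rw [Finset.sum_comm, mom_eq_sum, Finset.sum_mul]
    apply Finset.sum_congr rfl
    intro a _
    simp [mul_pow, mul_comm]
  have gsupp : univ.filter (fun t => g t ≠ 0) ⊆ A0.image (fun a => y * a) := by
    intro t ht
    simp only [mem_filter, mem_univ, true_and] at ht
    obtain ⟨a, ha, h1⟩ := Finset.exists_ne_zero_of_sum_ne_zero ht
    simp only [mem_image]
    exact ⟨a, ha, by by_contra hh; simp [hh] at h1⟩
  have g01 : ∀ t, g t = 0 ∨ g t = 1 := by
    intro t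
    by_cases hy0 : y = 0
    · have hc : (A0.card : F) = 1 := by
        have := R.mom_zero D hX hv w
        rw [mom_zero_eq] at this
        exact this
      simp only [hg, hy0, zero_mul]
      by_cases ht : (0 : F) = t
      · right; simp [ht, hc]
      · left; simp [ht]
    · have : ∀ a, (y * a = t) ↔ (a = y⁻¹ * t) := by
        intro a
        rw [eq_inv_mul_iff_mul_eq₀ hy0]
      simp only [hg, this, Finset.sum_ite_eq']
      split_ifs <;> simp
  have van := vandermonde_zero (f := fun t : F => (if x' + t • v ∈ X then 0 else 1) + g t) (K := 2 * q + 1)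
    (by
      have hsub : univ.filter (fun t : F => (if x' + t • v ∈ X then (0 : F) else 1) + g t ≠ 0)
        ⊆ (univ.filter (fun t : F => ¬ (x' + t • v ∈ X))) ∪ A0.image (fun a => y * a) := by
        intro t ht
        simp only [mem_filter, mem_univ, true_and, mem_union] at ht ⊢
        by_contra hh
        push Not at hh
        have : g t = 0 := by
          by_contra h
          exact hh.2 (gsupp (by simpa using h))
        rw [if_pos hh.1, this] at ht
        simp at ht
      have hcomp : (univ.filter (fun t : F => x' + t • v ∈ X)).card
          + (univ.filter (fun t : F => ¬ (x' + t • v ∈ X))).card = q ^ 2 := by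
        rw [Finset.card_filter_add_card_filter_not, Finset.card_univ, D.hF]
      have hcomp' : nv F X v x' + (univ.filter (fun t : F => ¬ (x' + t • v ∈ X))).card = q ^ 2 := hcomp
      have him : (A0.image (fun a => y * a)).card ≤ A0.card := Finset.card_image_le
      refine (Finset.card_le_card hsub).trans ((Finset.card_union_le _ _).trans ?_)
      omega)
    (by
      intro k hk
      simp only [mul_add, Finset.sum_add_distrib]
      rw [gmom, ← hmom k (by omega)]
      unfold mom
      rw [← Finset.sum_add_distrib]
      refine Eq.trans ?_ (D.psum (k := k) (by omega))
      apply Finset.sum_congr rfl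
      intro t _
      split_ifs <;> simp)
  have hex : ∃ t, g t ≠ 0 := by
    by_contra hh
    push Not at hh
    have h0 := gmom 0
    rw [R.mom_zero D hX hv w] at h0
    simp [hh] at h0
  obtain ⟨t, ht⟩ := hex
  have h1 := (g01 t).resolve_left ht
  have h2 := van t
  simp only [h1] at h2
  split_ifs at h2
  · simp at h2
  · have h3 : ((2 : ℕ) : F) = 0 := by push_cast; linear_combination h2
    rw [CharP.cast_eq_zero_iff F p] at h3
    have := Nat.le_of_dvd (by norm_num) h3
    omega

theorem star_of_le {X : Finset V} (D : FD F p q) (hX : IsCone F X) (R : CRep F q X) (hZ : Zsum F q X = 0)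
    (h : ∀ v, v ∉ X → ∀ x, nv F X v x ≤ q + 1) :
    ∀ v, v ∉ X → ∀ x, nv F X v x = 1 ∨ nv F X v x = q + 1 := by
  have hterm : ∀ v, v ∉ X → ∀ x, ((nv F X v x : ℤ) - 1) * ((nv F X v x : ℤ) - q - 1) ≤ 0 := by
    intro v hv x
    have h1 := h v hv x
    have h2 := R.nv_pos D hX hv x
    apply mul_nonpos_of_nonneg_of_nonpos
    · have : (1 : ℤ) ≤ nv F X v x := by exact_mod_cast h2
      linarith
    · have : (nv F X v x : ℤ) ≤ q + 1 := by exact_mod_cast h1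
      linarith
  unfold Zsum at hZ
  rw [Finset.sum_eq_zero_iff_of_nonpos] at hZ
  · intro v hv x
    have h1 := hZ v (by simp [hv])
    rw [Finset.sum_eq_zero_iff_of_nonpos (fun x _ => hterm v hv x)] at h1
    rcases mul_eq_zero.1 (h1 x (mem_univ x)) with h2 | h2
    · left; have : (nv F X v x : ℤ) = 1 := by linarith
      exact_mod_cast this
    · right; have : (nv F X v x : ℤ) = q + 1 := by linarith
      exact_mod_cast this
  · intro v hv
    simp at hv
    exact Finset.sum_nonpos fun x _ => hterm v hv x

theorem star_q_eq_p2 (D : FD F p q) (hq : q = p ^ 2) (h5 : 5 ≤ p) {r d : ℕ} (hr : 3 ≤ r) (hd : d ≤ r - 3)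
    {X : Finset (Fin (r + 1) → F)} (hQ : QData F q r d X) (R : CRep F q X) (hZ : Zsum F q X = 0) :
    ∀ v, v ∉ X → ∀ x, nv F X v x = 1 ∨ nv F X v x = q + 1 := by
  have hX := hQ.cone
  have hb := (hQ.bounds D hr hd).1
  have hcV : Fintype.card (Fin (r + 1) → F) = q ^ (2 * r + 2) := by
    rw [Fintype.card_fun, D.hF, Fintype.card_fin, ← pow_mul]; congr 1
  have hq0 : 0 < q := by have := D.two_le; omega
  apply star_of_le D hX R hZ
  intro v hv x
  apply no_long D hq h5 hX R _ _ hv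
  · rw [hcV]
    refine (Nat.mul_le_mul_left _ hb).trans_eq ?_
    obtain ⟨m, rfl⟩ : ∃ m, r = m + 1 := ⟨r - 1, by omega⟩
    have : 2 * (m + 1) - 2 = 2 * m := by omega
    rw [this]; ring
  · rw [hcV]; exact Nat.pow_le_pow_right hq0 (by omega)

end P10

/-- a `d`-singular quasi-Hermitian variety of PG(r, q²) is a singular
Hermitian variety with singular space of dimension `d` iff its characteristic vector
lies in the `F_p`-code spanned by the hyperplanes. -/
theorem stmt1 (p h q r d : ℕ) (hp : p.Prime) (hq : q = p ^ h)
    (hcase : (r = 3 ∧ d = 0 ∧ 4 < q) ∨ (4 ≤ r ∧ d ≤ r - 3 ∧ q = p ∧ 4 < p) ∨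
      (4 ≤ r ∧ d ≤ r - 3 ∧ q = p ^ 2 ∧ 3 < p))
    (F : Type) [Field F] [Fintype F] (hF : Fintype.card F = q ^ 2)
    (S : Set (ProjPoint F (r + 1))) (hS : IsSingularQuasiHermitian F q r d S) :
    IsSingularHermitian F q (r + 1) d S ↔ charVec F p (r + 1) S ∈ hypCode F p (r + 1) := by
  have D : FD F p q := ⟨hp, ⟨h, hq⟩, hF⟩
  have hr : 3 ≤ r := by omega
  have hd : d ≤ r - 3 := by omega
  constructor
  · rintro ⟨A, hA, _, rfl⟩
    exact herm_mem_code D (by omega) hA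
  · intro hc
    have hQ := QData.of_quasi D hS
    have hZ := QData.Zsum_zero D hS
    obtain ⟨R⟩ := exists_CRep D (by omega) hQ hc
    have hq4 : 4 < q := by
      rcases hcase with h1 | h1 | h1
      · exact h1.2.2
      · omega
      · rw [h1.2.2.1]; nlinarith [h1.2.2.2]
    apply back_dir D hq4 hr hd hQ R
    rcases hcase with ⟨rfl, rfl, _⟩ | ⟨_, _, h1, _⟩ | ⟨_, _, h1, h2⟩
    · exact star_r3 D hQ R hZ
    · exact star_q_eq_p D h1 hQ.cone R hZ
    · have h5 : 5 ≤ p := by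
        rcases Nat.lt_or_ge p 5 with h3 | h3
        · have h4 : p = 4 := by omega
          rw [h4] at hp
          exact absurd hp (by norm_num)
        · exact h3
      exact star_q_eq_p2 D h1 h5 hr hd hQ R hZ
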